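/- Let k be an algebraically closed field, S a polynomial ring over k, and I ⊆ S a homogeneous ideal of height 3 generated by n quadrics. If I has an associated prime p with height(p) = 3 and Hilbert–Samuel multiplicity e(S/p) = 4, then pd_S(S/I) ≤ max{n, 8}. -/

import Mathlib

open CategoryTheory Opposite

universe u

/-- The height of an ideal: the infimum of the heights (in the prime spectrum,
ordered by inclusion) of the primes containing it. -/
noncomputable def Ideal.heightENat {R : Type u} [CommRing R] (I : Ideal R) : ℕ∞ :=
  ⨅ (p : PrimeSpectrum R) (_ : I ≤ p.asIdeal), Order.height p

/-- The projective dimension of an `R`-module `M`: the least `n` such that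
`Ext^i(M, N) = 0` for all `i > n` and all modules `N` (and `⊤` if no such `n` exists). -/
noncomputable def projDim (R : Type u) [CommRing R] (M : Type u) [AddCommGroup M]
    [Module R M] : ℕ∞ :=
  sInf ((↑) '' {n : ℕ | ∀ i : ℕ, n < i → ∀ N : ModuleCat.{u} R,
    Subsingleton (((Ext R (ModuleCat.{u} R) i).obj (op (ModuleCat.of R M))).obj N)})

/-- The Hilbert function of the standard graded ring `S/J`, where
`S = k[x_1, ..., x_N]`: the `k`-dimension of the degree-`d` graded piece of `S/J`. -/
noncomputable def hilbertFunction (k : Type u) [Field k] {N : ℕ}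
    (J : Ideal (MvPolynomial (Fin N) k)) (d : ℕ) : ℕ :=
  Module.finrank k (Submodule.map (Ideal.Quotient.mkₐ k J).toLinearMap
    (MvPolynomial.homogeneousSubmodule (Fin N) k d))

open scoped Classical in
/-- The Hilbert–Samuel multiplicity `e(S/J)` of the graded ring `S/J`:
`(deg P)!` times the leading coefficient of the Hilbert polynomial `P` of `S/J`,
i.e. of the polynomial agreeing with the Hilbert function in all large degrees
(the degree of the Hilbert polynomial being `dim(S/J) - 1`). -/
noncomputable def hilbertSamuelMultiplicity (k : Type u) [Field k] {N : ℕ}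
    (J : Ideal (MvPolynomial (Fin N) k)) : ℚ :=
  if h : ∃ P : Polynomial ℚ, ∀ᶠ d : ℕ in Filter.atTop,
      (hilbertFunction k J d : ℚ) = P.eval (d : ℚ)
  then (h.choose.natDegree).factorial * h.choose.leadingCoeff
  else 0

universe v w

/-- working predicate -/
abbrev PDLT (R : Type u) [CommRing R] (M : Type u) [AddCommGroup M] [Module R M] (n : ℕ) : Prop :=
  HasProjectiveDimensionLT (ModuleCat.of R M) n

theorem projDim_le_of_PDLT (R : Type u) [CommRing R] (M : Type u) [AddCommGroup M] [Module R M] (n : ℕ)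
    (h : PDLT R M (n+1)) : projDim R M ≤ n := by
  unfold projDim
  apply sInf_le
  refine ⟨n, ?_, rfl⟩
  intro i hi N
  obtain ⟨j, rfl⟩ : ∃ j, i = j + 1 := ⟨i - 1, by omega⟩
  let P := projectiveResolution (ModuleCat.of R M)
  have iso := P.isoExt (R := R) (j+1) N
  suffices hz : Limits.IsZero ((P.complex.linearYonedaObj R N).homology (j+1)) by
    have := hz.of_iso iso
    exact ModuleCat.subsingleton_of_isZero this
  rw [← HomologicalComplex.exactAt_iff_isZero_homology,
    HomologicalComplex.exactAt_iff' _ j (j+1) (j+2) (by simp) (by simp)]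
  rw [ShortComplex.moduleCat_exact_iff]
  intro x hx
  change P.complex.X (j+1) ⟶ N at x
  have hx' : P.complex.d (j+2) (j+1) ≫ x = 0 := hx
  have h0 : P.extMk x (j+2) rfl hx' = 0 := Abelian.Ext.eq_zero_of_hasProjectiveDimensionLT _ (n+1) (by omega)
  rw [P.extMk_eq_zero_iff _ _ _ _ j rfl] at h0
  obtain ⟨g, hg⟩ := h0
  exact ⟨g, hg⟩

section PD
variable {R : Type u} [CommRing R]

theorem pdlt_ses {A B C : Type u} [AddCommGroup A] [Module R A] [AddCommGroup B] [Module R B]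
    [AddCommGroup C] [Module R C] (f : A →ₗ[R] B) (g : B →ₗ[R] C) (hf : Function.Injective f)
    (hg : Function.Surjective g) (h : Function.Exact f g) :
    (ShortComplex.mk (ModuleCat.ofHom f) (ModuleCat.ofHom g)
      (by ext x; exact h.apply_apply_eq_zero x)).ShortExact :=
  ModuleCat.shortComplex_shortExact _ h hf hg

theorem pdlt_mid {A B C : Type u} [AddCommGroup A] [Module R A] [AddCommGroup B] [Module R B]
    [AddCommGroup C] [Module R C] (f : A →ₗ[R] B) (g : B →ₗ[R] C) (hf : Function.Injective f)
    (hg : Function.Surjective g) (h : Function.Exact f g) (n : ℕ)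
    (hA : PDLT R A n) (hC : PDLT R C n) : PDLT R B n :=
  (pdlt_ses f g hf hg h).hasProjectiveDimensionLT_X₂ n hA hC

theorem pdlt_right {A B C : Type u} [AddCommGroup A] [Module R A] [AddCommGroup B] [Module R B]
    [AddCommGroup C] [Module R C] (f : A →ₗ[R] B) (g : B →ₗ[R] C) (hf : Function.Injective f)
    (hg : Function.Surjective g) (h : Function.Exact f g) (n : ℕ)
    (hA : PDLT R A n) (hB : PDLT R B (n+1)) : PDLT R C (n+1) :=
  (pdlt_ses f g hf hg h).hasProjectiveDimensionLT_X₃ n hA hB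

theorem pdlt_left {A B C : Type u} [AddCommGroup A] [Module R A] [AddCommGroup B] [Module R B]
    [AddCommGroup C] [Module R C] (f : A →ₗ[R] B) (g : B →ₗ[R] C) (hf : Function.Injective f)
    (hg : Function.Surjective g) (h : Function.Exact f g) (n : ℕ)
    (hB : PDLT R B n) (hC : PDLT R C (n+1)) : PDLT R A n :=
  (pdlt_ses f g hf hg h).hasProjectiveDimensionLT_X₁ n hB hC

theorem pdlt_equiv {A B : Type u} [AddCommGroup A] [Module R A] [AddCommGroup B] [Module R B]
    (e : A ≃ₗ[R] B) {n : ℕ} (hA : PDLT R A n) : PDLT R B n := by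
  have := hA
  exact hasProjectiveDimensionLT_of_iso e.toModuleIso n

theorem pdlt_mono {A : Type u} [AddCommGroup A] [Module R A] {n m : ℕ} (h : n ≤ m)
    (hA : PDLT R A n) : PDLT R A m := by
  have := hA
  exact hasProjectiveDimensionLT_of_ge _ n m h

theorem pdlt_proj {A : Type u} [AddCommGroup A] [Module R A] : 
    PDLT R A 1 ↔ Module.Projective R A := by
  rw [IsProjective.iff_projective, projective_iff_hasProjectiveDimensionLT_one]

theorem pdlt_zero {A : Type u} [AddCommGroup A] [Module R A] [Subsingleton A] (n : ℕ) : 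
    PDLT R A n := by
  have : Limits.IsZero (ModuleCat.of R A) := ModuleCat.isZero_of_subsingleton _
  exact pdlt_mono (Nat.zero_le n) this.hasProjectiveDimensionLT_zero

open TensorProduct in
theorem pdlt_baseChange {S : Type u} [CommRing S] [Algebra R S] [Module.Flat R S] (n : ℕ)
    (A : Type u) [AddCommGroup A] [Module R A] (h : PDLT R A (n+1)) : PDLT S (S ⊗[R] A) (n+1) := by
  induction n generalizing A with
  | zero =>
    rw [zero_add, pdlt_proj] at h ⊢
    infer_instance
  | succ n ih =>
    obtain ⟨F, _, _, _, g, hg⟩ : ∃ (F : Type u) (_ : AddCommGroup F) (_ : Module R F)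
        (_ : Module.Free R F) (g : F →ₗ[R] A), Function.Surjective g :=
      ⟨A →₀ R, inferInstance, inferInstance, inferInstance, Finsupp.linearCombination R id,
        Finsupp.linearCombination_id_surjective R A⟩
    let f : LinearMap.ker g →ₗ[R] F := (LinearMap.ker g).subtype
    have hf : Function.Injective f := Subtype.val_injective
    have hex : Function.Exact f g := LinearMap.exact_subtype_ker_map g
    have hF : PDLT R F 1 := pdlt_proj.2 inferInstance
    have hK : PDLT R (LinearMap.ker g) (n+1) :=
      pdlt_left f g hf hg hex (n+1) (pdlt_mono (by omega) hF) h
    have h1 := ih _ hK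
    have h2 : PDLT S (S ⊗[R] F) 1 := pdlt_proj.2 inferInstance
    refine pdlt_right (f.baseChange S) (g.baseChange S) ?_ ?_ ?_ (n+1) h1 (pdlt_mono (by omega) h2)
    · exact Module.Flat.lTensor_preserves_injective_linearMap (M := S) f hf
    · exact LinearMap.lTensor_surjective S hg
    · exact lTensor_exact (f := f) (g := g) S hex hg

open TensorProduct Polynomial in
theorem pdlt_poly (n : ℕ) (H : ∀ (A : Type u) [AddCommGroup A] [Module R A], PDLT R A (n+1))
    (A : Type u) [AddCommGroup A] [Module R[X] A] : PDLT R[X] A (n+2) := by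
  letI : Module R A := Module.compHom A (algebraMap R R[X])
  haveI : IsScalarTower R R[X] A := IsScalarTower.of_algebraMap_smul (fun r x => rfl)
  have h1 : PDLT R[X] (R[X] ⊗[R] A) (n+1) := pdlt_baseChange n A (H A)
  let xA : A →ₗ[R] A := 
    { toFun := fun a => (X : R[X]) • a
      map_add' := fun a b => smul_add _ _ _
      map_smul' := fun r a => by 
        simp only [RingHom.id_apply]
        rw [smul_comm] }
  let φ : R[X] ⊗[R] A →ₗ[R[X]] R[X] ⊗[R] A :=
    (X : R[X]) • LinearMap.id - xA.baseChange R[X]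
  have hφ : ∀ (f : R[X]) (a : A), φ (f ⊗ₜ a) = (X * f) ⊗ₜ a - f ⊗ₜ ((X : R[X]) • a) := by
    intro f a; simp [φ, xA, TensorProduct.smul_tmul']
  let μ : R[X] ⊗[R] A →ₗ[R[X]] A := 
    TensorProduct.AlgebraTensorModule.lift 
      (LinearMap.toSpanSingleton R[X] (A →ₗ[R] A) LinearMap.id)
  have hμ : ∀ (f : R[X]) (a : A), μ (f ⊗ₜ a) = f • a := by
    intro f a; simp [μ]
  refine pdlt_right φ μ ?_ ?_ ?_ (n+1) h1 (pdlt_mono (by omega) h1)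
  · let e := TensorProduct.equivFinsuppOfBasisLeft (N := A) (Polynomial.basisMonomials R)
    have he : ∀ (f : R[X]) (a : A) (i : ℕ), e (f ⊗ₜ a) i = f.coeff i • a := by
      intro f a i
      rw [TensorProduct.equivFinsuppOfBasisLeft_apply_tmul]
      rfl
    have key : ∀ t i, e (φ t) (i+1) = e t i - (X : R[X]) • e t (i+1) := by
      intro t i
      induction t with
      | zero => simp
      | add s t hs ht => simp only [map_add, Finsupp.add_apply, hs, ht, smul_add]; abel
      | tmul f a =>
        rw [hφ, map_sub, Finsupp.sub_apply, he, he, he, he, coeff_X_mul, smul_comm]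
    rw [injective_iff_map_eq_zero]
    intro t ht
    apply e.injective
    rw [map_zero]
    ext i
    rw [Finsupp.zero_apply]
    have hk : ∀ i, e t i = (X : R[X]) • e t (i+1) := by
      intro i
      have := key t i
      rw [ht, map_zero, Finsupp.zero_apply] at this
      exact (sub_eq_zero.1 this.symm)
    have hk2 : ∀ m i, e t i = (X : R[X])^m • e t (i+m) := by
      intro m
      induction m with
      | zero => simp
      | succ m ih => 
        intro i
        rw [ih i, hk (i+m), pow_succ, mul_smul]; rfl
    obtain ⟨B, hB⟩ := (e t).support.bddAbove
    rw [hk2 (B+1) i]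
    have : e t (i + (B+1)) = 0 := by
      by_contra hne
      have := hB (Finsupp.mem_support_iff.2 hne)
      omega
    rw [this, smul_zero]
  · intro a
    exact ⟨1 ⊗ₜ a, by rw [hμ, one_smul]⟩
  · have hc : ∀ t, μ (φ t) = 0 := by
      intro t
      induction t with
      | zero => simp
      | add s t hs ht => simp [hs, ht]
      | tmul f a => rw [hφ, map_sub, hμ, hμ, mul_comm, mul_smul, sub_self]
    have hr : ∀ t, t - 1 ⊗ₜ (μ t) ∈ LinearMap.range φ := by
      intro t
      induction t with
      | zero => simp
      | add s t hs ht => 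
        rw [map_add, tmul_add]
        have := Submodule.add_mem _ hs ht
        convert this using 1; abel
      | tmul f a => 
        rw [hμ]
        induction f using Polynomial.induction_on' with
        | add p q hp hq =>
          rw [add_tmul, add_smul, tmul_add]
          have := Submodule.add_mem _ hp hq
          convert this using 1; abel
        | monomial m r =>
          induction m generalizing a with
          | zero => 
            have : ((monomial 0) r : R[X]) = r • 1 := by simp [smul_eq_C_mul]
            rw [this, smul_tmul, smul_assoc, one_smul, sub_self]; exact zero_mem _
          | succ m ih =>
            have h3 := ih ((X:R[X]) • a)
            have h4 : φ (monomial m r ⊗ₜ a) ∈ LinearMap.range φ := ⟨_, rfl⟩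
            rw [hφ] at h4
            have := Submodule.add_mem _ h4 h3
            rw [← mul_smul, monomial_mul_X, X_mul_monomial] at this
            convert this using 1; abel
    intro t
    constructor
    · intro ht
      have := hr t
      rw [ht, tmul_zero, sub_zero] at this
      exact this
    · rintro ⟨s, rfl⟩
      exact hc s

theorem pdlt_ringEquiv {R' : Type u} [CommRing R'] (e : R ≃+* R') (n : ℕ)
    (H : ∀ (A : Type u) [AddCommGroup A] [Module R A], PDLT R A (n+1))
    (A : Type u) [AddCommGroup A] [Module R' A] : PDLT R' A (n+1) := by
  letI : Module R A := Module.compHom A e.toRingHom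
  have h1 : HasProjectiveDimensionLE (ModuleCat.of R A) n := H A
  letI := RingHomInvPair.of_ringEquiv e
  letI := RingHomInvPair.of_ringEquiv e.symm
  let e' : (ModuleCat.of R A) ≃ₛₗ[RingHomClass.toRingHom e] (ModuleCat.of R' A) :=
    { AddEquiv.refl A with
      map_smul' := fun r a => rfl }
  exact ModuleCat.hasProjectiveDimensionLE_of_semiLinearEquiv e e' n

end PD

theorem pdlt_mvPolynomial (k : Type u) [Field k] (n : ℕ) (A : Type u) [AddCommGroup A]
    [Module (MvPolynomial (Fin n) k) A] : PDLT (MvPolynomial (Fin n) k) A (n+1) := by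
  induction n generalizing A with
  | zero =>
    apply pdlt_ringEquiv (MvPolynomial.isEmptyAlgEquiv k (Fin 0)).symm.toRingEquiv
    intro A _ _
    rw [zero_add, pdlt_proj]; infer_instance
  | succ n ih =>
    apply pdlt_ringEquiv (MvPolynomial.finSuccEquiv k n).symm.toRingEquiv
    intro A _ _
    exact pdlt_poly n (fun A => ih A) A

theorem pdlt_of_flat_gens {k : Type u} [Field k] {j : ℕ} {S : Type u} [CommRing S]
    (φ : MvPolynomial (Fin j) k →+* S) (hφ : φ.Flat) (J : Ideal (MvPolynomial (Fin j) k)) :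
    PDLT S (S ⧸ J.map φ) (j+1) := by
  algebraize [φ]
  exact pdlt_equiv (Ideal.qoutMapEquivTensorQout S (I := J)).symm
    (pdlt_baseChange j _ (pdlt_mvPolynomial k j _))

section Pluecker

/-- Resolvent coordinates -/
def plk {R : Type*} [CommRing R] (a : Fin 3 → Fin 3 → Fin 3 → R) : Fin 6 → Fin 6 → R :=
  ![![0, -a 0 0 2, a 0 0 1, -a 0 1 2, a 0 2 2 - a 0 1 1, a 0 2 1],
    ![a 0 0 2, 0, a 0 0 0 - a 0 2 2 - a 0 1 1, a 1 1 2, a 1 1 1 - a 1 2 2 - a 0 1 0, -a 1 2 1 + a 0 2 0],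
    ![-a 0 0 1, -a 0 0 0 + a 0 2 2 + a 0 1 1, 0, a 1 2 2 - a 0 1 0, -a 2 2 2 + a 1 2 1 + a 0 2 0, -a 2 2 1],
    ![a 0 1 2, -a 1 1 2, -a 1 2 2 + a 0 1 0, 0, -a 1 1 0, a 1 2 0],
    ![-a 0 2 2 + a 0 1 1, -a 1 1 1 + a 1 2 2 + a 0 1 0, a 2 2 2 - a 1 2 1 - a 0 2 0, a 1 1 0, 0, -a 2 2 0],
    ![-a 0 2 1, a 1 2 1 - a 0 2 0, a 2 2 1, -a 1 2 0, a 2 2 0, 0]]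


/-- associativity relations, coefficient of `z m` in `(z i * z j) * z k = z i * (z j * z k)` -/
def AssocRel {R : Type*} [CommRing R] (a : Fin 3 → Fin 3 → Fin 3 → R) (b : Fin 3 → Fin 3 → R) : Prop :=
  (∀ i j m, a i j m = a j i m) ∧ (∀ i j, b i j = b j i) ∧ (∀ i j k m, ∑ l, a i j l * a l k m + (if k = m then b i j else 0) =
    ∑ l, a j k l * a l i m + (if i = m then b j k else 0))

theorem plk_alt {R : Type*} [CommRing R] (a : Fin 3 → Fin 3 → Fin 3 → R) :
    (∀ x, plk a x x = 0) ∧ ∀ x y, plk a x y = - plk a y x := by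
  constructor
  · intro x; fin_cases x <;> simp [plk]
  · intro x y; fin_cases x <;> fin_cases y <;> simp [plk] <;> ring

theorem pluecker_of_sorted {R : Type*} [CommRing R] (w : Fin 6 → Fin 6 → R)
    (h0 : ∀ x, w x x = 0) (h1 : ∀ x y, w x y = - w y x)
    (hs : ∀ a b c d, a < b → b < c → c < d → w a b * w c d - w a c * w b d + w a d * w b c = 0)
    (a b c d : Fin 6) : w a b * w c d - w a c * w b d + w a d * w b c = 0 := by
  have t3 : ∀ a b c d, b < c → c < d → w a b * w c d - w a c * w b d + w a d * w b c = 0 := by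
    intro a b c d hbc hcd
    rcases lt_trichotomy a b with h | rfl | h
    · exact hs a b c d h hbc hcd
    · rw [h0]; ring
    rcases lt_trichotomy a c with h' | rfl | h'
    · have := hs b a c d h h' hcd
      rw [h1 a b]; linear_combination -this
    · rw [h0, h1 a b]; ring
    rcases lt_trichotomy a d with h'' | rfl | h''
    · have := hs b c a d hbc h' h''
      rw [h1 a b, h1 a c]; linear_combination this
    · rw [h0, h1 a b, h1 a c]; ring
    · have := hs b c d a hbc hcd h''
      rw [h1 a b, h1 a c, h1 a d]; linear_combination -this
  have t2 : ∀ a b c d, c < d → w a b * w c d - w a c * w b d + w a d * w b c = 0 := by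
    intro a b c d hcd
    rcases lt_trichotomy b c with h | rfl | h
    · exact t3 a b c d h hcd
    · rw [h0]; ring
    rcases lt_trichotomy b d with h' | rfl | h'
    · have := t3 a c b d h h'
      rw [h1 b c]; linear_combination -this
    · rw [h0, h1 b c]; ring
    · have := t3 a c d b hcd h'
      rw [h1 b c, h1 b d]; linear_combination this
  rcases lt_trichotomy c d with h | rfl | h
  · exact t2 a b c d h
  · rw [h0]; ring
  · have := t2 a b d c h
    rw [h1 c d]; linear_combination -this

set_option maxHeartbeats 1000000 in
theorem plk_pluecker {R : Type*} [CommRing R] (a : Fin 3 → Fin 3 → Fin 3 → R) (b : Fin 3 → Fin 3 → R)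
    (h : AssocRel a b) (x y z t : Fin 6) :
    plk a x y * plk a z t - plk a x z * plk a y t + plk a x t * plk a y z = 0 := by
  obtain ⟨hs, hb, h⟩ := h
  apply pluecker_of_sorted _ (plk_alt a).1 (plk_alt a).2
  have s1 : ∀ m, a 1 0 m = a 0 1 m := fun m => hs _ _ _
  have s2 : ∀ m, a 2 0 m = a 0 2 m := fun m => hs _ _ _
  have s3 : ∀ m, a 2 1 m = a 1 2 m := fun m => hs _ _ _
  have s4 : b 2 1 = b 1 2 := hb _ _
  simp only [Fin.sum_univ_three] at h
  have e0123 : plk a 0 1 * plk a 2 3 - plk a 0 2 * plk a 1 3 + plk a 0 3 * plk a 1 2 = 0 := by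
    have f0 := h 0 0 1 2
    simp only [s1, s2, s3, s4, Fin.isValue, Fin.reduceEq, if_true, if_false] at f0
    simp only [plk, Matrix.cons_val]
    linear_combination (-1) * f0
  have e0124 : plk a 0 1 * plk a 2 4 - plk a 0 2 * plk a 1 4 + plk a 0 4 * plk a 1 2 = 0 := by
    have f0 := h 0 0 2 2
    have f1 := h 0 0 1 1
    simp only [s1, s2, s3, s4, Fin.isValue, Fin.reduceEq, if_true, if_false] at f0 f1
    simp only [plk, Matrix.cons_val]
    linear_combination (1) * f0 + (-1) * f1
  have e0125 : plk a 0 1 * plk a 2 5 - plk a 0 2 * plk a 1 5 + plk a 0 5 * plk a 1 2 = 0 := by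
    have f0 := h 0 0 2 1
    simp only [s1, s2, s3, s4, Fin.isValue, Fin.reduceEq, if_true, if_false] at f0
    simp only [plk, Matrix.cons_val]
    linear_combination (1) * f0
  have e0134 : plk a 0 1 * plk a 3 4 - plk a 0 3 * plk a 1 4 + plk a 0 4 * plk a 1 3 = 0 := by
    have f0 := h 0 1 1 2
    simp only [s1, s2, s3, s4, Fin.isValue, Fin.reduceEq, if_true, if_false] at f0
    simp only [plk, Matrix.cons_val]
    linear_combination (-1) * f0
  have e0135 : plk a 0 1 * plk a 3 5 - plk a 0 3 * plk a 1 5 + plk a 0 5 * plk a 1 3 = 0 := by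
    have f0 := h 0 1 1 1
    have f1 := h 0 0 1 0
    simp only [s1, s2, s3, s4, Fin.isValue, Fin.reduceEq, if_true, if_false] at f0 f1
    simp only [plk, Matrix.cons_val]
    linear_combination (-1) * f0 + (-1) * f1
  have e0145 : plk a 0 1 * plk a 4 5 - plk a 0 4 * plk a 1 5 + plk a 0 5 * plk a 1 4 = 0 := by
    have f0 := h 0 2 1 1
    have f1 := h 0 0 2 0
    simp only [s1, s2, s3, s4, Fin.isValue, Fin.reduceEq, if_true, if_false] at f0 f1
    simp only [plk, Matrix.cons_val]
    linear_combination (1) * f0 + (1) * f1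
  have e0234 : plk a 0 2 * plk a 3 4 - plk a 0 3 * plk a 2 4 + plk a 0 4 * plk a 2 3 = 0 := by
    have f0 := h 0 1 2 2
    have f1 := h 0 0 1 0
    simp only [s1, s2, s3, s4, Fin.isValue, Fin.reduceEq, if_true, if_false] at f0 f1
    simp only [plk, Matrix.cons_val]
    linear_combination (-1) * f0 + (-1) * f1
  have e0235 : plk a 0 2 * plk a 3 5 - plk a 0 3 * plk a 2 5 + plk a 0 5 * plk a 2 3 = 0 := by
    have f0 := h 0 1 2 1
    simp only [s1, s2, s3, s4, Fin.isValue, Fin.reduceEq, if_true, if_false] at f0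
    simp only [plk, Matrix.cons_val]
    linear_combination (-1) * f0
  have e0245 : plk a 0 2 * plk a 4 5 - plk a 0 4 * plk a 2 5 + plk a 0 5 * plk a 2 4 = 0 := by
    have f0 := h 0 2 2 1
    simp only [s1, s2, s3, s4, Fin.isValue, Fin.reduceEq, if_true, if_false] at f0
    simp only [plk, Matrix.cons_val]
    linear_combination (1) * f0
  have e0345 : plk a 0 3 * plk a 4 5 - plk a 0 4 * plk a 3 5 + plk a 0 5 * plk a 3 4 = 0 := by
    have f0 := h 0 2 1 0
    have f1 := h 0 1 2 0
    simp only [s1, s2, s3, s4, Fin.isValue, Fin.reduceEq, if_true, if_false] at f0 f1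
    simp only [plk, Matrix.cons_val]
    linear_combination (-1) * f0 + (1) * f1
  have e1234 : plk a 1 2 * plk a 3 4 - plk a 1 3 * plk a 2 4 + plk a 1 4 * plk a 2 3 = 0 := by
    have f0 := h 1 1 2 2
    have f1 := h 0 1 1 0
    simp only [s1, s2, s3, s4, Fin.isValue, Fin.reduceEq, if_true, if_false] at f0 f1
    simp only [plk, Matrix.cons_val]
    linear_combination (1) * f0 + (1) * f1
  have e1235 : plk a 1 2 * plk a 3 5 - plk a 1 3 * plk a 2 5 + plk a 1 5 * plk a 2 3 = 0 := by
    have f0 := h 0 2 1 0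
    have f1 := h 1 1 2 1
    simp only [s1, s2, s3, s4, Fin.isValue, Fin.reduceEq, if_true, if_false] at f0 f1
    simp only [plk, Matrix.cons_val]
    linear_combination (-1) * f0 + (1) * f1
  have e1245 : plk a 1 2 * plk a 4 5 - plk a 1 4 * plk a 2 5 + plk a 1 5 * plk a 2 4 = 0 := by
    have f0 := h 1 2 2 1
    have f1 := h 0 2 2 0
    simp only [s1, s2, s3, s4, Fin.isValue, Fin.reduceEq, if_true, if_false] at f0 f1
    simp only [plk, Matrix.cons_val]
    linear_combination (-1) * f0 + (1) * f1
  have e1345 : plk a 1 3 * plk a 4 5 - plk a 1 4 * plk a 3 5 + plk a 1 5 * plk a 3 4 = 0 := by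
    have f0 := h 1 1 2 0
    simp only [s1, s2, s3, s4, Fin.isValue, Fin.reduceEq, if_true, if_false] at f0
    simp only [plk, Matrix.cons_val]
    linear_combination (-1) * f0
  have e2345 : plk a 2 3 * plk a 4 5 - plk a 2 4 * plk a 3 5 + plk a 2 5 * plk a 3 4 = 0 := by
    have f0 := h 1 2 2 0
    simp only [s1, s2, s3, s4, Fin.isValue, Fin.reduceEq, if_true, if_false] at f0
    simp only [plk, Matrix.cons_val]
    linear_combination (-1) * f0
  intro x y z t h1 h2 h3
  fin_cases x <;> fin_cases y <;> first | (exfalso; revert h1; decide) | skip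
  all_goals (fin_cases z <;> first | (exfalso; revert h2; decide) | skip)
  all_goals (fin_cases t <;> first | (exfalso; revert h3; decide) | assumption)

theorem rank_one_le {k : Type*} [Field k] {ι : Type*} [Fintype ι] (hι : Fintype.card ι = 4)
    (L : Submodule k ((ι → k) × (ι → k))) (h : ∀ x ∈ L, ∀ c d, x.1 c * x.2 d = x.1 d * x.2 c) :
    Module.finrank k L ≤ 4 := by
  have pol : ∀ x ∈ L, ∀ y ∈ L, ∀ c d, x.1 c * y.2 d + y.1 c * x.2 d = x.1 d * y.2 c + y.1 d * x.2 c := by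
    intro x hx y hy c d
    have h1 := h x hx c d
    have h2 := h y hy c d
    have h3 := h _ (L.add_mem hx hy) c d
    simp only [Prod.fst_add, Prod.snd_add, Pi.add_apply] at h3
    linear_combination h3 - h1 - h2
  have f4 : Module.finrank k (ι → k) = 4 := by simp [hι]
  let F : L →ₗ[k] (ι → k) := (LinearMap.fst k (ι → k) (ι → k)).comp L.subtype
  let G : L →ₗ[k] (ι → k) := (LinearMap.snd k (ι → k) (ι → k)).comp L.subtype
  by_cases hF : ∀ x ∈ L, x.1 = 0
  · have : Function.Injective G := by
      rw [injective_iff_map_eq_zero]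
      intro x hx
      apply Subtype.ext
      exact Prod.ext (hF _ x.2) hx
    calc _ ≤ _ := LinearMap.finrank_le_finrank_of_injective this
      _ = 4 := f4
  by_cases hK : ∀ x ∈ L, x.1 = 0 → x.2 = 0
  · have : Function.Injective F := by
      rw [injective_iff_map_eq_zero]
      intro x hx
      apply Subtype.ext
      exact Prod.ext hx (hK _ x.2 hx)
    calc _ ≤ _ := LinearMap.finrank_le_finrank_of_injective this
      _ = 4 := f4
  push Not at hF hK
  obtain ⟨x, hx, hx1⟩ := hF
  obtain ⟨y, hy, hy1, hy2⟩ := hK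
  obtain ⟨c, hc⟩ := Function.ne_iff.1 hx1
  obtain ⟨d, hd⟩ := Function.ne_iff.1 hy2
  simp only [Pi.zero_apply] at hc hd
  -- L embeds in k^2
  let E : L →ₗ[k] (Fin 2 → k) :=
    LinearMap.pi ![(LinearMap.proj d).comp F, (LinearMap.proj c).comp G]
  have : Function.Injective E := by
    rw [injective_iff_map_eq_zero]
    rintro ⟨z, hz⟩ hE
    have e0 : z.1 d = 0 := congrFun hE 0
    have e1 : z.2 c = 0 := congrFun hE 1
    have z1 : z.1 = 0 := by
      ext i
      have := pol z hz y hy i d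
      simp only [hy1, Pi.zero_apply, e0] at this
      have h2 : z.1 i * y.2 d = 0 := by linear_combination this
      simpa [hd] using h2
    have z2 : z.2 = 0 := by
      ext i
      have := pol z hz x hx c i
      simp only [z1, Pi.zero_apply, e1] at this
      have h2 : x.1 c * z.2 i = 0 := by linear_combination this
      simpa [hc] using h2
    apply Subtype.ext
    exact Prod.ext z1 z2
  calc _ ≤ _ := LinearMap.finrank_le_finrank_of_injective this
    _ ≤ 4 := by simp

theorem decomposable_le {k : Type*} [Field k] (M : Submodule k (Fin 6 → Fin 6 → k))
    (h0 : ∀ w ∈ M, ∀ a, w a a = 0) (h1 : ∀ w ∈ M, ∀ a b, w a b = - w b a)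
    (hp : ∀ w ∈ M, ∀ a b c d, w a b * w c d - w a c * w b d + w a d * w b c = 0) :
    Module.finrank k M ≤ 5 := by
  by_cases hM : ∀ w ∈ M, ∀ a b, w a b = 0
  · have : M = ⊥ := by
      rw [Submodule.eq_bot_iff]
      intro w hw
      ext a b; exact hM w hw a b
    rw [this]; simp
  push Not at hM
  obtain ⟨w, hw, a, b, hab⟩ := hM
  have hne : a ≠ b := by rintro rfl; exact hab (h0 w hw a)
  have pol : ∀ v ∈ M, ∀ a b c d, w a b * v c d - w a c * v b d + w a d * v b c
      + (v a b * w c d - v a c * w b d + v a d * w b c) = 0 := by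
    intro v hv a b c d
    have e1 := hp w hw a b c d
    have e2 := hp v hv a b c d
    have e3 := hp _ (M.add_mem hw hv) a b c d
    simp only [Pi.add_apply] at e3
    linear_combination e3 - e1 - e2
  let f : M →ₗ[k] k := ((LinearMap.proj b).comp (LinearMap.proj a)).comp M.subtype
  let ι := {c : Fin 6 // c ≠ a ∧ c ≠ b}
  have hι : Fintype.card ι = 4 := by
    have : ∀ a b : Fin 6, a ≠ b → Fintype.card {c : Fin 6 // c ≠ a ∧ c ≠ b} = 4 := by decide
    exact this a b hne
  let g : (LinearMap.ker f) →ₗ[k] (ι → k) × (ι → k) :=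
    { toFun := fun v => (fun c => v.1.1 a c.1, fun c => v.1.1 b c.1)
      map_add' := fun _ _ => rfl
      map_smul' := fun _ _ => rfl }
  have hg : Function.Injective g := by
    rw [injective_iff_map_eq_zero]
    rintro ⟨⟨v, hv⟩, hk⟩ hgv
    have hvab : v a b = 0 := hk
    have hva : ∀ c, v a c = 0 := by
      intro c
      by_cases hca : c = a
      · rw [hca]; exact h0 v hv a
      by_cases hcb : c = b
      · rw [hcb]; exact hvab
      exact congrFun (congrArg Prod.fst hgv) ⟨c, hca, hcb⟩
    have hvb : ∀ c, v b c = 0 := by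
      intro c
      by_cases hca : c = a
      · rw [hca, h1 v hv, hvab, neg_zero]
      by_cases hcb : c = b
      · rw [hcb]; exact h0 v hv b
      exact congrFun (congrArg Prod.snd hgv) ⟨c, hca, hcb⟩
    apply Subtype.ext; apply Subtype.ext
    funext c d
    have := pol v hv a b c d
    simp only [hva, hvb] at this
    have h2 : w a b * v c d = 0 := by linear_combination this
    simpa [hab] using h2
  have h4 : Module.finrank k (LinearMap.ker f) ≤ 4 := by
    rw [← LinearMap.finrank_range_of_inj hg]
    apply rank_one_le hι
    rintro _ ⟨⟨⟨v, hv⟩, hk⟩, rfl⟩ c d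
    have hvab : v a b = 0 := hk
    have := hp v hv a b c.1 d.1
    simp only [hvab] at this
    change v a c.1 * v b d.1 = v a d.1 * v b c.1
    linear_combination -this
  have h5 := LinearMap.finrank_range_add_finrank_ker f
  have h6 : Module.finrank k (LinearMap.range f) ≤ 1 := by
    calc _ ≤ Module.finrank k k := Submodule.finrank_le _
      _ = 1 := Module.finrank_self k
  omega

/-- linear forms version -/
theorem span_plk_le {k V : Type*} [Field k] [AddCommGroup V] [Module k V] [FiniteDimensional k V]
    (l : Fin 6 → Fin 6 → V)
    (h0 : ∀ a, l a a = 0) (h1 : ∀ a b, l a b = - l b a)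
    (hp : ∀ φ : Module.Dual k V, ∀ a b c d, φ (l a b) * φ (l c d) - φ (l a c) * φ (l b d)
      + φ (l a d) * φ (l b c) = 0) :
    Module.finrank k (Submodule.span k (Set.range fun x : Fin 6 × Fin 6 => l x.1 x.2)) ≤ 5 := by
  let T : Module.Dual k V →ₗ[k] (Fin 6 → Fin 6 → k) :=
    { toFun := fun φ a b => φ (l a b)
      map_add' := fun _ _ => rfl
      map_smul' := fun _ _ => rfl }
  have h5 : Module.finrank k (LinearMap.range T) ≤ 5 := by
    apply decomposable_le
    · rintro _ ⟨φ, rfl⟩ a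
      change φ (l a a) = 0; rw [h0, map_zero]
    · rintro _ ⟨φ, rfl⟩ a b
      change φ (l a b) = - φ (l b a); rw [h1, map_neg]
    · rintro _ ⟨φ, rfl⟩ a b c d
      exact hp φ a b c d
  have hk : LinearMap.ker T = (Submodule.span k (Set.range fun x : Fin 6 × Fin 6 => l x.1 x.2)).dualAnnihilator := by
    ext φ
    rw [LinearMap.mem_ker, Submodule.mem_dualAnnihilator]
    constructor
    · intro h v hv
      induction hv using Submodule.span_induction with
      | mem x hx => obtain ⟨⟨a, b⟩, rfl⟩ := hx; exact congrFun (congrFun h a) b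
      | zero => simp
      | add x y _ _ hx hy => rw [map_add, hx, hy, add_zero]
      | smul c x _ hx => rw [map_smul, hx, smul_zero]
    · intro h
      funext a b
      exact h _ (Submodule.subset_span ⟨(a, b), rfl⟩)
  have h6 := LinearMap.finrank_range_add_finrank_ker T
  have h7 := Subspace.finrank_add_finrank_dualAnnihilator_eq
    (Submodule.span k (Set.range fun x : Fin 6 × Fin 6 => l x.1 x.2))
  rw [hk, Subspace.dual_finrank_eq] at h6
  omega

end Pluecker

section LinForms
open MvPolynomial
variable {k : Type u} [Field k] {N : ℕ}

theorem finrank_S1 : Module.finrank k (homogeneousSubmodule (Fin N) k 1) = N := by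
  rw [homogeneousSubmodule_one_eq_span_X, finrank_span_eq_card (linearIndependent_X (σ := Fin N) k),
    Fintype.card_fin]

instance finite_hom {σ : Type*} [Finite σ] (n : ℕ) : Module.Finite k (homogeneousSubmodule σ k n) :=
  Module.Finite.iff_fg.2 (homogeneousSubmodule_fg _ _ n)

theorem span_eq_S1 {σ : Type*} [Fintype σ] (v : σ → MvPolynomial (Fin N) k)
    (hv : ∀ i, (v i).IsHomogeneous 1) (hli : LinearIndependent k v) (hc : Fintype.card σ = N) :
    Submodule.span k (Set.range v) = homogeneousSubmodule (Fin N) k 1 := by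
  apply Submodule.eq_of_le_of_finrank_eq
  · rw [Submodule.span_le]; rintro _ ⟨i, rfl⟩; exact hv i
  · rw [finrank_span_eq_card hli, finrank_S1, hc]

theorem aeval_surj {σ : Type*} [Fintype σ] (v : σ → MvPolynomial (Fin N) k)
    (hv : Submodule.span k (Set.range v) = homogeneousSubmodule (Fin N) k 1) :
    Function.Surjective (aeval v : MvPolynomial σ k →ₐ[k] MvPolynomial (Fin N) k) := by
  rw [← AlgHom.range_eq_top, eq_top_iff, ← adjoin_range_X, Algebra.adjoin_le_iff]
  rintro _ ⟨i, rfl⟩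
  have h1 : (X i : MvPolynomial (Fin N) k) ∈ Submodule.span k (Set.range v) := by
    rw [hv]; exact isHomogeneous_X k i
  have h2 : Submodule.span k (Set.range v) ≤ Subalgebra.toSubmodule
      (aeval v : MvPolynomial σ k →ₐ[k] MvPolynomial (Fin N) k).range := by
    rw [Submodule.span_le]; rintro _ ⟨i, rfl⟩; exact ⟨X i, by simp⟩
  exact h2 h1

theorem noeth_inj {R : Type*} [CommRing R] [IsNoetherianRing R] (f : R →+* R)
    (hf : Function.Surjective f) : Function.Injective f := by
  have hm : ∀ n x, (f ^ n) (f x) = (f ^ (n+1)) x := by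
    intro n x; rw [pow_succ]; rfl
  let s : ℕ →o Ideal R := ⟨fun n => RingHom.ker (f ^ n), by
    apply monotone_nat_of_le_succ
    intro n x hx
    rw [RingHom.mem_ker] at hx ⊢
    rw [pow_succ', RingHom.mul_def, RingHom.comp_apply, hx, map_zero]⟩
  obtain ⟨n, hn⟩ := monotone_stabilizes_iff_noetherian.2 (inferInstanceAs (IsNoetherian R R)) s
  rw [injective_iff_map_eq_zero]
  intro x hx
  have hfn : Function.Surjective (f ^ n) := by
    rw [RingHom.coe_pow]; exact hf.iterate n
  obtain ⟨y, rfl⟩ := hfn x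
  have h1 : y ∈ s (n+1) := by
    change y ∈ RingHom.ker (f ^ (n+1))
    rw [RingHom.mem_ker, pow_succ', RingHom.mul_def, RingHom.comp_apply, hx]
  rw [← hn (n+1) (by omega)] at h1
  exact h1

theorem exists_extend_gen {V : Type*} [AddCommGroup V] [Module k V] [FiniteDimensional k V] {j : ℕ}
    (w : Fin j → V) (hli : LinearIndependent k w) : ∃ (m : ℕ) (v : Fin m → V),
      m + j = Module.finrank k V ∧ LinearIndependent k (Sum.elim v w) := by
  obtain ⟨C, hC⟩ := Submodule.exists_isCompl (Submodule.span k (Set.range w))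
  let b := Module.finBasis k C
  have hfr := Submodule.finrank_add_eq_of_isCompl hC
  rw [finrank_span_eq_card hli, Fintype.card_fin] at hfr
  refine ⟨Module.finrank k C, fun i => b i, by omega, ?_⟩
  apply LinearIndependent.sum_type
  · exact b.linearIndependent.map' C.subtype (by simp)
  · exact hli
  · refine hC.disjoint.symm.mono_left ?_
    rw [Submodule.span_le]; rintro _ ⟨i, rfl⟩; exact (b i).2

theorem aeval_bij {σ : Type*} [Fintype σ] (v : σ → MvPolynomial (Fin N) k)
    (hv : ∀ i, (v i).IsHomogeneous 1) (hli : LinearIndependent k v) (hc : Fintype.card σ = N) :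
    Function.Bijective (aeval v : MvPolynomial σ k →ₐ[k] MvPolynomial (Fin N) k) := by
  have hs := aeval_surj v (span_eq_S1 v hv hli hc)
  refine ⟨?_, hs⟩
  let e : Fin N ≃ σ := (Fintype.equivFinOfCardEq hc).symm
  let f : MvPolynomial (Fin N) k →ₐ[k] MvPolynomial (Fin N) k :=
    (aeval v).comp (renameEquiv k e).toAlgHom
  have hf : Function.Surjective f := by
    simpa [f] using hs.comp (renameEquiv k e).surjective
  have hfi : Function.Injective f := by
    exact noeth_inj f.toRingHom hf
  have : (aeval v : MvPolynomial σ k →ₐ[k] MvPolynomial (Fin N) k)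
     = f.comp (renameEquiv k e).symm.toAlgHom := by
    ext i; simp [f]
  rw [this]
  simpa using hfi.comp (renameEquiv k e).symm.injective

theorem exists_extend {j : ℕ} (w : Fin j → MvPolynomial (Fin N) k) (hw : ∀ i, (w i).IsHomogeneous 1)
    (hli : LinearIndependent k w) : ∃ (m : ℕ) (v : Fin m → MvPolynomial (Fin N) k),
      m + j = N ∧ (∀ i, (v i).IsHomogeneous 1) ∧ LinearIndependent k (Sum.elim v w) := by
  let W := homogeneousSubmodule (Fin N) k 1
  let w' : Fin j → W := fun i => ⟨w i, hw i⟩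
  have hw' : LinearIndependent k w' := LinearIndependent.of_comp W.subtype hli
  obtain ⟨m, v, hm, hv⟩ := exists_extend_gen w' hw'
  rw [finrank_S1] at hm
  refine ⟨m, fun i => (v i : W), hm, fun i => (v i).2, ?_⟩
  have := hv.map' W.subtype (by simp)
  have e : (Sum.elim (fun i => (v i : MvPolynomial (Fin N) k)) w) = W.subtype ∘ Sum.elim v w' := by
    ext1 x; cases x <;> rfl
  rw [e]; exact this

theorem pdlt_of_adjoin {j : ℕ} (w : Fin j → MvPolynomial (Fin N) k) (hw : ∀ i, (w i).IsHomogeneous 1)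
    (hli : LinearIndependent k w) (G : Set (MvPolynomial (Fin N) k))
    (hG : G ⊆ Algebra.adjoin k (Set.range w)) :
    PDLT (MvPolynomial (Fin N) k) (MvPolynomial (Fin N) k ⧸ Ideal.span G) (j+1) := by
  obtain ⟨m, v, hm, hv, hvw⟩ := exists_extend w hw hli
  let φ : MvPolynomial (Fin j) k →ₐ[k] MvPolynomial (Fin N) k := aeval w
  have hb := aeval_bij (Sum.elim v w) (by rintro (i | i); exacts [hv i, hw i]) hvw (by simp [hm])
  have hflat : φ.toRingHom.Flat := by
    let e := sumAlgEquiv k (Fin m) (Fin j)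
    have h1 : (algebraMap (MvPolynomial (Fin j) k) (MvPolynomial (Fin m) (MvPolynomial (Fin j) k))).Flat := by
      rw [RingHom.flat_algebraMap_iff]; infer_instance
    have h2 : (e.symm.toRingEquiv.toRingHom).Flat := RingHom.Flat.of_bijective e.symm.bijective
    have h3 : (aeval (Sum.elim v w) : _ →ₐ[k] MvPolynomial (Fin N) k).toRingHom.Flat :=
      RingHom.Flat.of_bijective hb
    have h4 := (h1.comp h2).comp h3
    convert h4 using 1
    apply MvPolynomial.ringHom_ext
    · intro r; simp [φ, e, MvPolynomial.algebraMap_eq]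
    · intro i; simp [φ, e, MvPolynomial.algebraMap_eq]
  have hG2 : G ⊆ Set.range φ := by
    intro g hg
    have := hG hg
    rw [Algebra.adjoin_range_eq_range_aeval] at this
    exact this
  have hI : Ideal.span G = (Ideal.span (φ ⁻¹' G)).map φ.toRingHom := by
    rw [Ideal.map_span]
    congr 1
    exact (Set.image_preimage_eq_of_subset hG2).symm
  rw [hI]
  exact pdlt_of_flat_gens _ hflat _

end LinForms

section P4
open MvPolynomial
variable {k : Type u} [Field k] {N : ℕ}


theorem plk_mem {k R : Type*} [Field k] [CommRing R] [Algebra k R] (V : Submodule k R)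
    (a : Fin 3 → Fin 3 → Fin 3 → R) (h : ∀ i j l, a i j l ∈ V) (x y : Fin 6) : plk a x y ∈ V := by
  have h0 : (0 : R) ∈ V := zero_mem _
  fin_cases x <;> fin_cases y <;> simp only [plk, Fin.isValue] <;>
  first
    | exact h0
    | exact h _ _ _
    | exact neg_mem (h _ _ _)
    | exact sub_mem (h _ _ _) (h _ _ _)
    | exact add_mem (neg_mem (h _ _ _)) (h _ _ _)
    | exact sub_mem (sub_mem (h _ _ _) (h _ _ _)) (h _ _ _)
    | exact add_mem (add_mem (neg_mem (h _ _ _)) (h _ _ _)) (h _ _ _)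

theorem exists_point (V : Submodule k (MvPolynomial (Fin N) k)) (hV : V ≤ homogeneousSubmodule (Fin N) k 1) (φ : Module.Dual k V) :
    ∃ ψ : (MvPolynomial (Fin N) k) →ₐ[k] k, ∀ v : V, ψ v = φ v := by
  obtain ⟨φ', h⟩ := φ.exists_extend
  refine ⟨aeval (fun i => φ' (X i)), ?_⟩
  have : ∀ x ∈ homogeneousSubmodule (Fin N) k 1, aeval (fun i => φ' (X i)) x = φ' x := by
    intro x hx
    rw [homogeneousSubmodule_one_eq_span_X] at hx
    induction hx using Submodule.span_induction with
    | mem x h => obtain ⟨i, rfl⟩ := h; simp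
    | zero => simp
    | add x y _ _ h1 h2 => rw [map_add, map_add, h1, h2]
    | smul a x _ h => simp [h]
  intro v
  rw [this v (hV v.2), ← h]; rfl

structure QuadStr {d : ℕ} (p : Ideal (MvPolynomial (Fin N) k)) (y : Fin d → (MvPolynomial (Fin N) k)) (z : Fin 3 → (MvPolynomial (Fin N) k)) (a : Fin 3 → Fin 3 → Fin 3 → (MvPolynomial (Fin N) k))
    (b : Fin 3 → Fin 3 → (MvPolynomial (Fin N) k)) : Prop where
  hy : ∀ i, (y i).IsHomogeneous 1
  hz : ∀ i, (z i).IsHomogeneous 1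
  hyz : homogeneousSubmodule (Fin N) k 1 ≤ Submodule.span k (Set.range y) ⊔ Submodule.span k (Set.range z)
  ha : ∀ i j l, a i j l ∈ Submodule.span k (Set.range y)
  hb : ∀ i j, b i j ∈ Algebra.adjoin k (Set.range y)
  hmul : ∀ i j, z i * z j - ∑ l, a i j l * z l - b i j ∈ p
  hind : ∀ (c : (MvPolynomial (Fin N) k)) (e : Fin 3 → (MvPolynomial (Fin N) k)), c ∈ Algebra.adjoin k (Set.range y) →
    (∀ i, e i ∈ Algebra.adjoin k (Set.range y)) → c + ∑ i, e i * z i ∈ p → c = 0 ∧ ∀ i, e i = 0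

namespace QuadStr
variable {d : ℕ} {p : Ideal (MvPolynomial (Fin N) k)} {y : Fin d → (MvPolynomial (Fin N) k)} {z : Fin 3 → (MvPolynomial (Fin N) k)} {a : Fin 3 → Fin 3 → Fin 3 → (MvPolynomial (Fin N) k)}
    {b : Fin 3 → Fin 3 → (MvPolynomial (Fin N) k)}

theorem ha' (h : QuadStr p y z a b) (i j l) : a i j l ∈ Algebra.adjoin k (Set.range y) :=
  (Submodule.span_le.2 (Algebra.subset_adjoin) : Submodule.span k (Set.range y) ≤
    Subalgebra.toSubmodule (Algebra.adjoin k (Set.range y))) (h.ha i j l)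

theorem sym (h : QuadStr p y z a b) (i j : Fin 3) : b i j = b j i ∧ ∀ l, a i j l = a j i l := by
  have h1 := p.sub_mem (h.hmul i j) (h.hmul j i)
  have h2 := h.hind (b j i - b i j) (fun l => a j i l - a i j l) (sub_mem (h.hb _ _) (h.hb _ _))
    (fun l => sub_mem (h.ha' _ _ _) (h.ha' _ _ _)) (by
      convert h1 using 1
      simp only [sub_mul, Finset.sum_sub_distrib]; ring)
  exact ⟨(sub_eq_zero.1 h2.1).symm, fun l => (sub_eq_zero.1 (h2.2 l)).symm⟩

theorem assoc (h : QuadStr p y z a b) : AssocRel a b := by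
  refine ⟨fun i j m => (h.sym i j).2 m, fun i j => (h.sym i j).1, fun i j q m => ?_⟩
  have key : ∀ i j q, z i * z j * z q - (∑ l, a i j l * b l q +
      ∑ m, (∑ l, a i j l * a l q m + (if q = m then b i j else 0)) * z m) ∈ p := by
    intro i j q
    have e1 := p.mul_mem_right (z q) (h.hmul i j)
    have e2 : ∑ l, a i j l * (z l * z q - ∑ m, a l q m * z m - b l q) ∈ p :=
      p.sum_mem fun l _ => p.mul_mem_left _ (h.hmul l q)
    convert p.add_mem e1 e2 using 1
    fin_cases q <;> simp [Fin.sum_univ_three] <;> ring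
  have h1 := p.sub_mem (key j q i) (key i j q)
  have h2 := h.hind (∑ l, a i j l * b l q - ∑ l, a j q l * b l i)
    (fun m => (∑ l, a i j l * a l q m + (if q = m then b i j else 0)) -
      (∑ l, a j q l * a l i m + (if i = m then b j q else 0))) ?_ ?_ (by
      convert h1 using 1
      simp only [sub_mul, Finset.sum_sub_distrib]; ring)
  · exact sub_eq_zero.1 (h2.2 m)
  · exact sub_mem (sum_mem fun l _ => mul_mem (h.ha' _ _ _) (h.hb _ _))
      (sum_mem fun l _ => mul_mem (h.ha' _ _ _) (h.hb _ _))
  · intro m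
    refine sub_mem (add_mem (sum_mem fun l _ => mul_mem (h.ha' _ _ _) (h.ha' _ _ _)) ?_)
      (add_mem (sum_mem fun l _ => mul_mem (h.ha' _ _ _) (h.ha' _ _ _)) ?_)
    · split_ifs; exacts [h.hb _ _, zero_mem _]
    · split_ifs; exacts [h.hb _ _, zero_mem _]

theorem shift (h : QuadStr p y z a b) (l : Fin 3 → (MvPolynomial (Fin N) k)) (hl : ∀ i, l i ∈ Submodule.span k (Set.range y)) :
    QuadStr p y (fun i => z i + l i)
      (fun i j m => a i j m + (if i = m then l j else 0) + (if j = m then l i else 0))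
      (fun i j => b i j - ∑ m, a i j m * l m - l i * l j) := by
  have hV : Submodule.span k (Set.range y) ≤ homogeneousSubmodule (Fin N) k 1 := by
    rw [Submodule.span_le]; rintro _ ⟨i, rfl⟩; exact h.hy i
  have hl' : ∀ i, l i ∈ Algebra.adjoin k (Set.range y) := fun i => 
    (Submodule.span_le.2 (Algebra.subset_adjoin) : Submodule.span k (Set.range y) ≤
    Subalgebra.toSubmodule (Algebra.adjoin k (Set.range y))) (hl i)
  refine ⟨h.hy, fun i => (h.hz i).add (hV (hl i)), ?_, ?_, ?_, ?_, ?_⟩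
  · refine h.hyz.trans (sup_le le_sup_left ?_)
    rw [Submodule.span_le]; rintro _ ⟨i, rfl⟩
    have : z i = - l i + (z i + l i) := by ring
    rw [this]
    exact add_mem (Submodule.mem_sup_left (neg_mem (hl i)))
      (Submodule.mem_sup_right (Submodule.subset_span ⟨i, rfl⟩))
  · intro i j m
    refine add_mem (add_mem (h.ha _ _ _) ?_) ?_
    · split_ifs; exacts [hl _, zero_mem _]
    · split_ifs; exacts [hl _, zero_mem _]
  · intro i j
    exact sub_mem (sub_mem (h.hb _ _) (sum_mem fun m _ => mul_mem (h.ha' _ _ _) (hl' _)))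
      (mul_mem (hl' _) (hl' _))
  · intro i j
    convert h.hmul i j using 1
    fin_cases i <;> fin_cases j <;> simp [Fin.sum_univ_three] <;> ring
  · intro c e hc he hce
    have := h.hind (c + ∑ i, e i * l i) e (add_mem hc (sum_mem fun i _ => mul_mem (he i) (hl' i))) he (by
      convert hce using 1
      simp only [mul_add, Finset.sum_add_distrib]; ring)
    refine ⟨?_, this.2⟩
    simpa [this.2] using this.1

theorem finrank_plk (h : QuadStr p y z a b) :
    Module.finrank k (Submodule.span k (Set.range (fun x : Fin 6 × Fin 6 => plk a x.1 x.2))) ≤ 5 := by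
  set V := Submodule.span k (Set.range y) with hVdef
  have hV : V ≤ homogeneousSubmodule (Fin N) k 1 := by
    rw [hVdef, Submodule.span_le]; rintro _ ⟨i, rfl⟩; exact h.hy i
  haveI : FiniteDimensional k V := FiniteDimensional.span_of_finite k (Set.finite_range y)
  have hm : ∀ x y, plk a x y ∈ V := by
    exact plk_mem _ _ h.ha
  have := span_plk_le (fun x y => (⟨plk a x y, hm x y⟩ : V))
    (fun x => Subtype.ext ((plk_alt a).1 x)) (fun x y => Subtype.ext ((plk_alt a).2 x y)) (by
      intro φ x y z t
      obtain ⟨ψ, hψ⟩ := exists_point V hV φ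
      have e := plk_pluecker a b h.assoc x y z t
      simp only [← hψ, ← map_mul, ← map_sub, ← map_add, e, map_zero])
  have e : (Submodule.span k (Set.range (fun x : Fin 6 × Fin 6 => plk a x.1 x.2)))
      = (Submodule.span k (Set.range (fun x : Fin 6 × Fin 6 => (⟨plk a x.1 x.2, hm _ _⟩ : V)))).map V.subtype := by
    rw [Submodule.map_span, ← Set.range_comp]; rfl
  rw [e]
  rwa [LinearEquiv.finrank_eq (Submodule.equivMapOfInjective V.subtype (by simp) _).symm]

theorem shape (h : QuadStr p y z a b) (f : (MvPolynomial (Fin N) k)) (hf : f.IsHomogeneous 2) :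
    ∃ (c : Fin 3 → Fin 3 → k) (e : Fin 3 → (MvPolynomial (Fin N) k)) (g : (MvPolynomial (Fin N) k)), (∀ i, e i ∈ Algebra.adjoin k (Set.range y)) ∧
      g ∈ Algebra.adjoin k (Set.range y) ∧
      f = g + ∑ i, e i * z i + ∑ i, ∑ j, c i j • (z i * z j) := by
  have hf' : f ∈ homogeneousSubmodule (Fin N) k 1 * homogeneousSubmodule (Fin N) k 1 := by
    rw [← pow_two, homogeneousSubmodule_one_pow]; exact hf
  have hV : Submodule.span k (Set.range y) ≤ Subalgebra.toSubmodule (Algebra.adjoin k (Set.range y)) :=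
    Submodule.span_le.2 Algebra.subset_adjoin
  have lin : ∀ x ∈ homogeneousSubmodule (Fin N) k 1, ∃ g ∈ Algebra.adjoin k (Set.range y), ∃ c : Fin 3 → k,
      x = g + ∑ i, c i • z i := by
    intro x hx
    obtain ⟨g, hg, w, hw, rfl⟩ := Submodule.mem_sup.1 (h.hyz hx)
    obtain ⟨c, rfl⟩ := (Submodule.mem_span_range_iff_exists_fun k).1 hw
    exact ⟨g, hV hg, c, rfl⟩
  induction hf' using Submodule.mul_induction_on' with
  | mem_mul_mem m hm n hn =>
    obtain ⟨g, hg, c, rfl⟩ := lin m hm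
    obtain ⟨g', hg', c', rfl⟩ := lin n hn
    refine ⟨fun i j => c i * c' j, fun i => c' i • g + c i • g', g * g', fun i =>
      add_mem (Subalgebra.smul_mem _ hg _) (Subalgebra.smul_mem _ hg' _), mul_mem hg hg', ?_⟩
    simp only [Fin.sum_univ_three, smul_eq_C_mul, map_mul]; ring
  | add x hx y hy h1 h2 =>
    obtain ⟨c, e, g, he, hg, rfl⟩ := h1 (by
      rw [← pow_two, homogeneousSubmodule_one_pow] at hx; exact hx)
    obtain ⟨c', e', g', he', hg', rfl⟩ := h2 (by
      rw [← pow_two, homogeneousSubmodule_one_pow] at hy; exact hy)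
    refine ⟨fun i j => c i j + c' i j, fun i => e i + e' i, g + g', fun i => add_mem (he i) (he' i),
      add_mem hg hg', ?_⟩
    simp only [Fin.sum_univ_three, add_smul]; ring

theorem shape_mem (h : QuadStr p y z a b) (f : (MvPolynomial (Fin N) k)) (hf : f.IsHomogeneous 2) (hfp : f ∈ p) :
    ∃ (c : Fin 3 → Fin 3 → k), f = ∑ i, ∑ j, c i j • (z i * z j - ∑ l, a i j l * z l - b i j) := by
  obtain ⟨c, e, g, he, hg, rfl⟩ := h.shape f hf
  refine ⟨c, ?_⟩
  have h1 : ∑ i, ∑ j, c i j • (z i * z j - ∑ l, a i j l * z l - b i j) ∈ p :=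
    p.sum_mem fun i _ => p.sum_mem fun j _ => by
      rw [smul_eq_C_mul]; exact p.mul_mem_left _ (h.hmul i j)
  have h2 := p.sub_mem hfp h1
  have h3 := h.hind (g + ∑ i, ∑ j, c i j • b i j) (fun m => e m + ∑ i, ∑ j, c i j • a i j m)
    (add_mem hg (sum_mem fun i _ => sum_mem fun j _ => Subalgebra.smul_mem _ (h.hb _ _) _))
    (fun m => add_mem (he m) (sum_mem fun i _ => sum_mem fun j _ => Subalgebra.smul_mem _ (h.ha' _ _ _) _))
    (by
      convert h2 using 1
      simp only [Fin.sum_univ_three, smul_eq_C_mul]; ring)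
  obtain ⟨h4, h5⟩ := h3
  have e0 := h5 0
  have e1 := h5 1
  have e2 := h5 2
  simp only [Fin.sum_univ_three, smul_eq_C_mul] at h4 e0 e1 e2 ⊢
  linear_combination h4 + e0 * z 0 + e1 * z 1 + e2 * z 2

theorem pd_norm (h : QuadStr p y z a b) (n1 : a 0 1 0 = 0) (n2 : a 0 1 1 = 0) (n3 : a 0 2 0 = 0)
    (G : Set (MvPolynomial (Fin N) k)) (hG : ∀ g ∈ G, g.IsHomogeneous 2 ∧ g ∈ p) : PDLT (MvPolynomial (Fin N) k) ((MvPolynomial (Fin N) k) ⧸ Ideal.span G) 9 := by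
  set L := Submodule.span k (Set.range (fun x : Fin 6 × Fin 6 => plk a x.1 x.2)) with hL
  haveI : FiniteDimensional k L := FiniteDimensional.span_of_finite k (Set.finite_range _)
  have h5 : Module.finrank k L ≤ 5 := h.finrank_plk
  have hm : ∀ x y, plk a x y ∈ L := fun x y => Submodule.subset_span ⟨(x, y), rfl⟩
  obtain ⟨hs, hbs, hr⟩ := h.assoc
  have q01 := hm 0 1
  have q02 := hm 0 2
  have q03 := hm 0 3
  have q04 := hm 0 4
  have q05 := hm 0 5
  have q12 := hm 1 2
  have q13 := hm 1 3
  have q14 := hm 1 4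
  have q15 := hm 1 5
  have q23 := hm 2 3
  have q24 := hm 2 4
  have q25 := hm 2 5
  have q34 := hm 3 4
  have q35 := hm 3 5
  have q45 := hm 4 5
  simp [plk, n1, n2, n3] at q01 q02 q03 q04 q05 q12 q13 q14 q15 q23 q24 q25 q34 q35 q45
  have q12' : a 0 0 0 ∈ L := by simpa using add_mem q12 q04
  have q14' : a 1 1 1 ∈ L := by simpa using add_mem q14 q23
  have q24' : a 2 2 2 ∈ L := by
    have := sub_mem q15 q24
    ring_nf at this; exact this
  have hz0 : (0 : (MvPolynomial (Fin N) k)) ∈ L := zero_mem _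
  have haL : ∀ i j m, a i j m ∈ L := by
    have n1' : a 1 0 0 = 0 := by rw [hs, n1]
    have n2' : a 1 0 1 = 0 := by rw [hs, n2]
    have n3' : a 2 0 0 = 0 := by rw [hs, n3]
    intro i j m
    fin_cases i <;> fin_cases j <;> fin_cases m <;>
      simp [n1, n2, n3, n1', n2', n3'] <;> first | assumption | (rw [hs]; assumption)
  let B := Module.finBasis k L
  let w : Fin (Module.finrank k L) ⊕ Fin 3 → (MvPolynomial (Fin N) k) := Sum.elim (fun i => (B i : (MvPolynomial (Fin N) k))) z
  have hV : Submodule.span k (Set.range y) ≤ homogeneousSubmodule (Fin N) k 1 := by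
    rw [Submodule.span_le]; rintro _ ⟨i, rfl⟩; exact h.hy i
  have hLV : L ≤ Submodule.span k (Set.range y) := by
    rw [hL, Submodule.span_le]
    rintro _ ⟨⟨x, t⟩, rfl⟩
    exact plk_mem _ _ h.ha x t
  have hVA : Submodule.span k (Set.range y) ≤ Subalgebra.toSubmodule (Algebra.adjoin k (Set.range y)) :=
    Submodule.span_le.2 Algebra.subset_adjoin
  have hw1 : ∀ i, (w i).IsHomogeneous 1 := by
    rintro (i | i)
    · exact hV (hLV (B i).2)
    · exact h.hz i
  have hwl : LinearIndependent k w := by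
    apply LinearIndependent.sum_type
    · exact B.linearIndependent.map' L.subtype (by simp)
    · rw [Fintype.linearIndependent_iff]
      intro g hg i
      have := (h.hind 0 (fun i => C (g i)) (zero_mem _) (fun i => Subalgebra.algebraMap_mem _ _) (by
        simp only [← smul_eq_C_mul, hg, zero_add]; exact p.zero_mem)).2 i
      simpa using this
    · rw [Submodule.disjoint_def]
      intro x hx hx2
      have hxL : x ∈ L := by
        refine (Submodule.span_le.2 ?_ : Submodule.span k _ ≤ L) hx
        rintro _ ⟨i, rfl⟩; exact (B i).2
      obtain ⟨g, rfl⟩ := (Submodule.mem_span_range_iff_exists_fun k).1 hx2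
      have := (h.hind (-∑ i, g i • z i) (fun i => C (g i)) (neg_mem (hVA (hLV hxL))) (fun i => Subalgebra.algebraMap_mem _ _) (by
        simp only [← smul_eq_C_mul, neg_add_cancel]; exact p.zero_mem)).1
      simpa using this
  set T := Algebra.adjoin k (Set.range w) with hT
  have hLT : L ≤ Subalgebra.toSubmodule T := by
    intro x hx
    have : x = ((∑ i, B.repr ⟨x, hx⟩ i • B i : L) : (MvPolynomial (Fin N) k)) := by rw [B.sum_repr]
    rw [this, Submodule.coe_sum]
    refine sum_mem fun i _ => ?_
    exact Subalgebra.smul_mem T (Algebra.subset_adjoin (show (B i : MvPolynomial (Fin N) k) ∈ Set.range w from ⟨Sum.inl i, rfl⟩)) _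
  have hzT : ∀ i, z i ∈ T := fun i => Algebra.subset_adjoin ⟨Sum.inr i, rfl⟩
  have haT : ∀ i j m, a i j m ∈ T := fun i j m => hLT (haL i j m)
  have hbT : ∀ i j, b i j ∈ T := by
    intro i j
    obtain ⟨q, hq⟩ : ∃ q : Fin 3, i ≠ q := ⟨i + 1, by fin_cases i <;> decide⟩
    have e := hr i j q q
    rw [if_pos rfl, if_neg hq, add_zero] at e
    rw [eq_sub_of_add_eq' e]
    exact sub_mem (sum_mem fun l _ => mul_mem (haT _ _ _) (haT _ _ _))
      (sum_mem fun l _ => mul_mem (haT _ _ _) (haT _ _ _))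
  have hGT : G ⊆ T := by
    intro g hg
    obtain ⟨c, rfl⟩ := h.shape_mem g (hG g hg).1 (hG g hg).2
    exact sum_mem fun i _ => sum_mem fun j _ => Subalgebra.smul_mem _ (sub_mem (sub_mem
      (mul_mem (hzT _) (hzT _)) (sum_mem fun l _ => mul_mem (haT _ _ _) (hzT _))) (hbT _ _)) _
  have := pdlt_of_adjoin (w ∘ finSumFinEquiv.symm) (fun i => hw1 _)
    (hwl.comp _ finSumFinEquiv.symm.injective) G (by
      rw [Set.range_comp, finSumFinEquiv.symm.surjective.range_eq, Set.image_univ]; exact hGT)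
  exact pdlt_mono (by omega) this

theorem pd (h : QuadStr p y z a b)
    (G : Set (MvPolynomial (Fin N) k)) (hG : ∀ g ∈ G, g.IsHomogeneous 2 ∧ g ∈ p) : PDLT (MvPolynomial (Fin N) k) ((MvPolynomial (Fin N) k) ⧸ Ideal.span G) 9 := by
  refine (h.shift ![-a 0 1 1, -a 0 1 0, -a 0 2 0] ?_).pd_norm ?_ ?_ ?_ G hG
  · intro i; fin_cases i <;> exact neg_mem (h.ha _ _ _)
  all_goals simp

end QuadStr
end P4

section AlgInd
open MvPolynomial
open scoped IntermediateField.algebraAdjoinAdjoin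
variable {k : Type u} {E : Type v} [Field k] [Field E] [Algebra k E] {ι : Type w}

theorem ac_descend (t : ι → E) (ht : AlgebraicIndependent k t) (h : E)
    (hh : h ∈ IntermediateField.adjoin k (Set.range t)) (ha : IsAlgebraic k h) :
    ∃ c : k, algebraMap k E c = h := by
  have ht' := ht.algebraicClosure
  obtain ⟨x, hx, y, hy, e⟩ := IntermediateField.mem_adjoin_iff_div.1 hh
  rw [Algebra.adjoin_range_eq_range_aeval] at hx hy
  obtain ⟨P, rfl⟩ := hx
  obtain ⟨Q, rfl⟩ := hy
  by_cases hQ : Q = 0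
  · refine ⟨0, ?_⟩
    rw [map_zero, e, hQ]; simp
  let η : algebraicClosure k E := ⟨h, mem_algebraicClosure_iff.2 ha⟩
  have hQ' : aeval t Q ≠ 0 := fun h0 => hQ (ht (by
    change aeval t Q = aeval t 0; rw [h0, map_zero]))
  have e2 : aeval t P = h * aeval t Q := by
    rw [e]; exact (div_mul_cancel₀ _ hQ').symm
  have e3 : map (algebraMap k (algebraicClosure k E)) P = C η * map (algebraMap k (algebraicClosure k E)) Q := by
    apply ht'
    change aeval t _ = aeval t _
    rw [map_mul, aeval_map_algebraMap, aeval_map_algebraMap, e2, aeval_C]; rfl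
  obtain ⟨m, hm⟩ := MvPolynomial.ne_zero_iff.1 hQ
  have e4 := congrArg (coeff m) e3
  rw [coeff_C_mul, coeff_map, coeff_map] at e4
  have e5 : algebraMap k E (coeff m P) = h * algebraMap k E (coeff m Q) := congrArg Subtype.val e4
  refine ⟨coeff m P / coeff m Q, ?_⟩
  rw [map_div₀, e5, mul_div_assoc, div_self, mul_one]
  simpa using hm

theorem algInd_gen [Finite ι] (s x : ι → E) (hs : AlgebraicIndependent k s)
    (h1 : ∀ i, x i ∈ IntermediateField.adjoin k (Set.range s))
    (h2 : ∀ i, s i ∈ IntermediateField.adjoin k (Set.range x)) : AlgebraicIndependent k x := by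
  set K := IntermediateField.adjoin k (Set.range s) with hK
  let s' : ι → K := fun i => ⟨s i, IntermediateField.subset_adjoin _ _ ⟨i, rfl⟩⟩
  let x' : ι → K := fun i => ⟨x i, h1 i⟩
  have gen : ∀ y : ι → K, IntermediateField.adjoin k (Set.range y) = ⊤ →
      Algebra.IsAlgebraic (Algebra.adjoin k (Set.range y)) K := by
    intro y hy
    constructor
    intro z
    have hz : z ∈ IntermediateField.adjoin k (Set.range y) := by rw [hy]; trivial
    obtain ⟨a, ha, b, hb, e⟩ := IntermediateField.mem_adjoin_iff_div.1 hz
    rw [e, div_eq_mul_inv]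
    exact (isAlgebraic_algebraMap (⟨a, ha⟩ : Algebra.adjoin k (Set.range y))).mul
      ((isAlgebraic_algebraMap (⟨b, hb⟩ : Algebra.adjoin k (Set.range y))).inv)
  have key : ∀ y : ι → K, (∀ i, s i ∈ IntermediateField.adjoin k (Set.range (fun j => (y j : E)))) → 
      IntermediateField.adjoin k (Set.range y) = ⊤ := by
    intro y hy
    apply IntermediateField.map_injective K.val
    rw [IntermediateField.adjoin_map, ← Set.range_comp]
    apply le_antisymm
    · exact (IntermediateField.adjoin_map k _ K.val).symm ▸ IntermediateField.map_mono _ le_top |>.trans' (by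
        rw [← Set.range_comp])
    · rintro _ ⟨a, _, rfl⟩
      have : K ≤ IntermediateField.adjoin k (Set.range (fun j => (y j : E))) := by
        refine IntermediateField.adjoin_le_iff.2 ?_
        rintro _ ⟨i, rfl⟩; exact hy i
      exact this a.2
  have hs' : AlgebraicIndependent k s' := AlgebraicIndependent.of_comp K.val hs
  have i1 := gen s' (key s' fun i => IntermediateField.subset_adjoin _ _ ⟨i, rfl⟩)
  have i2 := gen x' (key x' h2)
  have hb : IsTranscendenceBasis k s' := isTranscendenceBasis_iff_algebraicIndependent_isAlgebraic.2 ⟨hs', i1⟩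
  have hx' := Algebra.IsAlgebraic.isTranscendenceBasis_of_lift_le_trdeg_of_finite k x' (by
    rw [hb.lift_cardinalMk_eq_trdeg])
  have := hx'.1.map' (f := K.val) K.val.injective
  exact this

theorem algInd_mob [Finite ι] [DecidableEq ι] (s : ι → E) (hs : AlgebraicIndependent k s) (i0 : ι) :
    AlgebraicIndependent k (fun i => if i = i0 then (s i0)⁻¹ else s i / s i0) ∧
    IntermediateField.adjoin k (Set.range (fun i => if i = i0 then (s i0)⁻¹ else s i / s i0)) =
     IntermediateField.adjoin k (Set.range s) := by
  have h0 : s i0 ≠ 0 := hs.ne_zero i0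
  set x := (fun i => if i = i0 then (s i0)⁻¹ else s i / s i0) with hx
  have m : ∀ i, s i ∈ IntermediateField.adjoin k (Set.range s) := fun i =>
    IntermediateField.subset_adjoin _ _ ⟨i, rfl⟩
  have m' : ∀ i, x i ∈ IntermediateField.adjoin k (Set.range x) := fun i =>
    IntermediateField.subset_adjoin _ _ ⟨i, rfl⟩
  have h1 : ∀ i, x i ∈ IntermediateField.adjoin k (Set.range s) := by
    intro i
    simp only [hx]
    split_ifs
    · exact inv_mem (m _)
    · exact div_mem (m _) (m _)
  have h20 : s i0 ∈ IntermediateField.adjoin k (Set.range x) := by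
    have := inv_mem (m' i0)
    simpa [hx] using this
  have h2 : ∀ i, s i ∈ IntermediateField.adjoin k (Set.range x) := by
    intro i
    by_cases h : i = i0
    · rw [h]; exact h20
    · have := mul_mem (m' i) h20
      simpa [hx, h, h0] using this
  refine ⟨algInd_gen s x hs h1 h2, le_antisymm ?_ ?_⟩
  · rw [IntermediateField.adjoin_le_iff]; rintro _ ⟨i, rfl⟩; exact h1 i
  · rw [IntermediateField.adjoin_le_iff]; rintro _ ⟨i, rfl⟩; exact h2 i

theorem algInd_field (t : E) (x : ι → E) (h : AlgebraicIndependent (Algebra.adjoin k {t}) x) :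
    AlgebraicIndependent (IntermediateField.adjoin k {t}) x := by
  exact h.extendScalars _

theorem algInd_step [Finite ι] [DecidableEq ι] (s : ι → E) (hs : AlgebraicIndependent k s) (i0 i1 : ι) (h01 : i0 ≠ i1) :
    AlgebraicIndependent (IntermediateField.adjoin k {s i1 / s i0}) (fun i : {i // i ≠ i1} => s i) := by
  have h0 : s i0 ≠ 0 := hs.ne_zero i0
  set x := (fun i => if i = i1 then s i1 / s i0 else s i) with hx
  have m : ∀ i, s i ∈ IntermediateField.adjoin k (Set.range s) := fun i =>
    IntermediateField.subset_adjoin _ _ ⟨i, rfl⟩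
  have m' : ∀ i, x i ∈ IntermediateField.adjoin k (Set.range x) := fun i =>
    IntermediateField.subset_adjoin _ _ ⟨i, rfl⟩
  have h1 : ∀ i, x i ∈ IntermediateField.adjoin k (Set.range s) := by
    intro i
    simp only [hx]
    split_ifs
    · exact div_mem (m _) (m _)
    · exact (m _)
  have h2 : ∀ i, s i ∈ IntermediateField.adjoin k (Set.range x) := by
    intro i
    by_cases h : i = i1
    · have := mul_mem (m' i1) (m' i0)
      rw [h]; simpa [hx, h01, h0] using this
    · have := (m' i)
      simpa [hx, h, h0] using this
  have hxi := algInd_gen s x hs h1 h2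
  have h3 := ((AlgebraicIndependent.iff_adjoin_image_compl {i1}ᶜ).1 hxi).2
  apply algInd_field
  have e : x '' {i1}ᶜᶜ = {s i1 / s i0} := by simp [hx]
  rw [e] at h3
  have e2 : (fun i : {i // i ≠ i1} => s i) = fun i : ({i1}ᶜ : Set ι) => x i := by
    ext i; simp [hx, i.2]
  rw [e2]; exact h3
end AlgInd

section AlgLemma
open MvPolynomial
open scoped IntermediateField.algebraAdjoinAdjoin
variable {k : Type u} {E : Type v} [Field k] [Field E] [Algebra k E] {ι : Type w}

theorem W_pow {V W : Submodule k E} (M : ℕ) (hM : W^(M+1) ≤ V * W^M) (m : ℕ) : W^(m+M) ≤ V^m * W^M := by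
  induction m with
  | zero => simp
  | succ m ih =>
    calc W^(m+1+M) = W^m * W^(M+1) := by rw [← pow_add]; congr 1; ring
      _ ≤ W^m * (V * W^M) := by gcongr
      _ = V * W^(m+M) := by rw [pow_add]; ring
      _ ≤ V * (V^m * W^M) := by gcongr
      _ = _ := by ring

theorem int_lemma {V W : Submodule k E} (hW1 : 1 ∈ W) (hWfg : W.FG) (M : ℕ) (hM : W^(M+1) ≤ V * W^M)
    (v : E) (hv : v ≠ 0) (m : ℕ) (h : E) (hh : v^m * h ∈ W^m) (R : Subalgebra k E)
    (hR : ∀ x ∈ V, x / v ∈ R) : IsIntegral R h := by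
  have h1 : ∀ m, ∀ a ∈ V^m, a / v^m ∈ R := by
    intro m
    induction m with
    | zero => 
      intro a ha
      rw [pow_zero, Submodule.mem_one] at ha
      obtain ⟨c, rfl⟩ := ha
      simpa using R.algebraMap_mem c
    | succ m ih =>
      intro a ha
      rw [pow_succ] at ha
      induction ha using Submodule.mul_induction_on' with
      | mem_mul_mem a ha b hb =>
        rw [pow_succ, mul_div_mul_comm]
        exact mul_mem (ih a ha) (hR b hb)
      | add x _ y _ hx hy => rw [add_div]; exact add_mem hx hy
  let N : Submodule R E := Submodule.span R (W^M : Submodule k E)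
  have hN1 : (1 : E) ∈ N := Submodule.subset_span (by
    have := Submodule.pow_mem_pow W hW1 M
    simpa using this)
  refine isIntegral_of_smul_mem_submodule (R := R) (M := E) N ?_ ?_ h ?_
  · intro h0
    rw [h0, Submodule.mem_bot] at hN1
    exact one_ne_zero hN1
  · obtain ⟨T, hT⟩ := (hWfg.pow M)
    refine ⟨T, le_antisymm ?_ ?_⟩
    · apply Submodule.span_mono
      rw [← hT]; exact Submodule.subset_span
    · rw [Submodule.span_le, ← hT]
      have : Submodule.span k (T : Set E) ≤ (Submodule.span R (T : Set E)).restrictScalars k :=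
        Submodule.span_le.2 Submodule.subset_span
      exact this
  · intro n hn
    induction hn using Submodule.span_induction with
    | mem n hn =>
      have h2 : v^m * (h • n) ∈ V^m * W^M := by
        refine W_pow M hM m ?_
        rw [smul_eq_mul, ← mul_assoc, pow_add]
        exact Submodule.mul_mem_mul hh hn
      have h3 : ∀ x ∈ V^m * W^M, x / v^m ∈ N := by
        intro x hx
        induction hx using Submodule.mul_induction_on' with
        | mem_mul_mem a ha b hb =>
          have : a * b / v^m = (⟨a / v^m, h1 m a ha⟩ : R) • b := by
            change _ = a / v^m * b
            ring
          rw [this]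
          exact N.smul_mem _ (Submodule.subset_span hb)
        | add x _ y _ hx hy => rw [add_div]; exact add_mem hx hy
      have := h3 _ h2
      rwa [mul_div_cancel_left₀ _ (pow_ne_zero _ hv)] at this
    | zero => simp
    | add x y _ _ hx hy => rw [smul_add]; exact add_mem hx hy
    | smul r x _ hx => rw [smul_comm]; exact N.smul_mem _ hx

theorem coeff_lemma [Finite ι] (x : ι → E) (hx : AlgebraicIndependent k x) (h : E)
    (hh : IsIntegral (Algebra.adjoin k (Set.range x)) h) (K : IntermediateField k E)
    (hK : IntermediateField.adjoin k (Set.range x) = K) (n : ℕ) :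
    ((minpoly K h).coeff n : E) ∈ Algebra.adjoin k (Set.range x) := by
  subst hK
  haveI : IsIntegrallyClosed (Algebra.adjoin k (Set.range x)) :=
    IsIntegrallyClosed.of_equiv hx.aevalEquiv.toRingEquiv
  rw [minpoly.isIntegrallyClosed_eq_field_fractions' _ hh, Polynomial.coeff_map]
  exact ((minpoly (Algebra.adjoin k (Set.range x)) h).coeff n).2

theorem mob_mem [Finite ι] [DecidableEq ι] (s : ι → E) (i0 : ι) (h0 : s i0 ≠ 0) (c : E)
    (hc : c ∈ Algebra.adjoin k (Set.range (fun i => if i = i0 then (s i0)⁻¹ else s i / s i0))) :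
    ∃ (n : ℕ) (Q : MvPolynomial ι k), Q.totalDegree ≤ n ∧ s i0 ^ n * c = aeval s Q := by
  induction hc using Algebra.adjoin_induction with
  | mem x hx =>
    obtain ⟨i, rfl⟩ := hx
    by_cases h : i = i0
    · exact ⟨1, 1, by simp, by simp [h, h0]⟩
    · refine ⟨1, X i, by simp, ?_⟩
      simp only [h, if_false, pow_one, aeval_X]; field_simp
  | algebraMap r => exact ⟨0, C r, by simp, by simp⟩
  | add x y _ _ hx hy =>
    obtain ⟨n, Q, hQ, e⟩ := hx
    obtain ⟨m, P, hP, f⟩ := hy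
    refine ⟨n + m, X i0 ^ m * Q + X i0 ^ n * P, ?_, ?_⟩
    · refine (totalDegree_add _ _).trans (max_le ?_ ?_)
      · refine (totalDegree_mul _ _).trans ?_
        have := totalDegree_X_pow (R := k) i0 m
        omega
      · refine (totalDegree_mul _ _).trans ?_
        have := totalDegree_X_pow (R := k) i0 n
        omega
    · simp only [map_add, map_mul, map_pow, aeval_X, ← e, ← f]; ring
  | mul x y _ _ hx hy =>
    obtain ⟨n, Q, hQ, e⟩ := hx
    obtain ⟨m, P, hP, f⟩ := hy
    refine ⟨n + m, Q * P, (totalDegree_mul _ _).trans (by omega), ?_⟩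
    simp only [map_mul, ← e, ← f]; ring

theorem const_lemma [Finite ι] [DecidableEq ι] (s : ι → E) (hs : AlgebraicIndependent k s) (i0 : ι) (c : E)
    (hc : c ∈ Algebra.adjoin k (Set.range (fun i => if i = i0 then (s i0)⁻¹ else s i / s i0)))
    (U : MvPolynomial ι k) (hU : ¬ X i0 ∣ U) (m : ℕ) (P : MvPolynomial ι k)
    (hP : (aeval s U) ^ m * c = aeval s P) : ∃ a : k, algebraMap k E a = c := by
  have h0 : s i0 ≠ 0 := hs.ne_zero i0
  obtain ⟨n, Q, hQ, e⟩ := mob_mem s i0 h0 c hc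
  have e2 : X i0 ^ n * P = U ^ m * Q := by
    apply hs
    change aeval s _ = aeval s _
    simp only [map_mul, map_pow, aeval_X, ← e, ← hP]; ring
  have pr : Prime (X i0 : MvPolynomial ι k) := X_prime
  have h1 : X i0 ^ n ∣ Q := by
    refine pr.pow_dvd_of_dvd_mul_left n ?_ ⟨P, e2.symm⟩
    intro h
    exact hU (pr.dvd_of_dvd_pow h)
  obtain ⟨Q', rfl⟩ := h1
  by_cases hQ' : Q' = 0
  · refine ⟨0, ?_⟩
    rw [hQ', mul_zero, map_zero] at e
    rw [map_zero]
    exact ((mul_eq_zero.1 e).resolve_left (pow_ne_zero _ h0)).symm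
  rw [totalDegree_mul_of_isDomain (pow_ne_zero _ pr.ne_zero) hQ', totalDegree_X_pow] at hQ
  have h2 : Q'.totalDegree = 0 := by omega
  rw [totalDegree_eq_zero_iff_eq_C] at h2
  refine ⟨coeff 0 Q', ?_⟩
  rw [h2, map_mul, map_pow, aeval_X, aeval_C] at e
  exact (mul_left_cancel₀ (pow_ne_zero _ h0) e).symm

theorem alg_lemma [Finite ι] (s : ι → E) (hs : AlgebraicIndependent k s) (i0 : ι)
    (V W : Submodule k E) (hV : V = Submodule.span k (insert 1 (Set.range s))) 
    (hW1 : 1 ∈ W) (hWfg : W.FG) (M : ℕ) (hM : W^(M+1) ≤ V * W^M) (u : E)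
    (hu : u = 1 ∨ ∃ j ≠ i0, u = s j) (m : ℕ) (h : E) (h1 : u^m * h ∈ W^m) (h2 : s i0^m * h ∈ W^m) :
    IsAlgebraic k h := by
  classical
  have hR : ∀ i, ∀ x ∈ V, x / s i ∈ Algebra.adjoin k (Set.range (fun j => if j = i then (s i)⁻¹ else s j / s i)) := by
    intro i x hx
    have h0 : s i ≠ 0 := hs.ne_zero i
    rw [hV] at hx
    induction hx using Submodule.span_induction with
    | mem x hx =>
      obtain rfl | ⟨j, rfl⟩ := hx
      · exact Algebra.subset_adjoin ⟨i, by simp⟩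
      · by_cases h : j = i
        · rw [h, div_self h0]; exact one_mem _
        · exact Algebra.subset_adjoin ⟨j, by simp [h]⟩
    | zero => simp
    | add x y _ _ hx hy => rw [add_div]; exact add_mem hx hy
    | smul a x _ hx => rw [smul_div_assoc]; exact Subalgebra.smul_mem _ hx _
  have hR1 : ∀ x ∈ V, x / 1 ∈ Algebra.adjoin k (Set.range s) := by
    intro x hx
    rw [div_one]
    have : V ≤ Subalgebra.toSubmodule (Algebra.adjoin k (Set.range s)) := by
      rw [hV, Submodule.span_le]
      rintro x (rfl | ⟨j, rfl⟩)
      · exact (Algebra.adjoin k (Set.range s)).one_mem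
      · exact Algebra.subset_adjoin ⟨j, rfl⟩
    exact this hx
  set K := IntermediateField.adjoin k (Set.range s) with hK
  have hInt := int_lemma hW1 hWfg M hM (s i0) (hs.ne_zero _) m h h2 _ (hR i0)
  have c1 := coeff_lemma _ (algInd_mob s hs i0).1 h hInt K (algInd_mob s hs i0).2
  have c2 : ∃ U : MvPolynomial ι k, ¬ X i0 ∣ U ∧ ∀ n, ∃ (r : ℕ) (P : MvPolynomial ι k),
      (aeval s U) ^ r * ((minpoly K h).coeff n : E) = aeval s P := by
    obtain rfl | ⟨j, hj, rfl⟩ := hu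
    · refine ⟨1, ?_, ?_⟩
      · intro h; exact (X_prime (R := k) (i := i0)).not_unit (isUnit_of_dvd_one h)
      · intro n
        have hInt' := int_lemma hW1 hWfg M hM 1 one_ne_zero m h h1 _ hR1
        have := coeff_lemma _ hs h hInt' K rfl n
        rw [Algebra.adjoin_range_eq_range_aeval] at this
        obtain ⟨P, hP⟩ := this
        exact ⟨0, P, by simpa using hP.symm⟩
    · refine ⟨X j, ?_, ?_⟩
      · rw [X_dvd_X]; tauto
      · intro n
        have hInt' := int_lemma hW1 hWfg M hM (s j) (hs.ne_zero _) m h h1 _ (hR j)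
        have := coeff_lemma _ (algInd_mob s hs j).1 h hInt' K (algInd_mob s hs j).2 n
        obtain ⟨r, Q, _, e⟩ := mob_mem s j (hs.ne_zero _) _ this
        exact ⟨r, Q, by simpa using e⟩
  obtain ⟨U, hU, c2⟩ := c2
  have c3 : ∀ n, ∃ a : k, algebraMap k E a = (minpoly K h).coeff n := by
    intro n
    obtain ⟨r, P, e⟩ := c2 n
    exact const_lemma s hs i0 _ (c1 n) U hU r P e
  have hl : minpoly K h ∈ Polynomial.lifts (algebraMap k K) := by
    rw [Polynomial.lifts_iff_coeff_lifts]
    intro n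
    obtain ⟨a, ha⟩ := c3 n
    exact ⟨a, Subtype.ext ha⟩
  obtain ⟨q, hq⟩ := (Polynomial.mem_lifts _).1 hl
  have hintK : IsIntegral K h := by
    haveI := (algInd_mob s hs i0).2
    have h3 : IsIntegral (IntermediateField.adjoin k (Set.range (fun j => if j = i0 then (s i0)⁻¹ else s j / s i0))) h :=
      hInt.tower_top
    rw [(algInd_mob s hs i0).2] at h3
    exact h3
  refine ⟨q, ?_, ?_⟩
  · rintro rfl
    rw [Polynomial.map_zero] at hq
    exact minpoly.ne_zero hintK hq.symm
  · have := minpoly.aeval K h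
    rwa [← hq, Polynomial.aeval_map_algebraMap] at this

end AlgLemma

section ND
open Polynomial
variable {E : Type u} [Field E]

theorem clear_den {k : Type v} [Field k] [Algebra k E] {J : Type w} [Fintype J] (t : E)
    (c : J → E) (hc : ∀ j, c j ∈ IntermediateField.adjoin k {t}) (hne : ∃ j, c j ≠ 0) :
    ∃ (r : E) (P : J → k[X]), r ≠ 0 ∧ (∀ j, aeval t (P j) = r * c j) ∧ ∃ j, (P j).coeff 0 ≠ 0 := by
  classical
  choose a b hab using fun j => (IntermediateField.mem_adjoin_simple_iff k (c j)).1 (hc j)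
  have hx : ∃ A B : J → k[X], ∀ j, c j = aeval t (A j) / aeval t (B j) ∧ aeval t (B j) ≠ 0 := by
    refine ⟨fun j => if aeval t (b j) = 0 then 0 else a j, fun j => if aeval t (b j) = 0 then 1 else b j, ?_⟩
    intro j
    by_cases h : aeval t (b j) = 0
    · simp [hab j, h]
    · simp [hab j, h]
  obtain ⟨A, B, hAB⟩ := hx
  let P0 : J → k[X] := fun j => A j * ∏ i ∈ Finset.univ.erase j, B i
  have hP0 : ∀ j, aeval t (P0 j) = aeval t (∏ i, B i) * c j := by
    intro j
    rw [(hAB j).1, ← Finset.mul_prod_erase _ _ (Finset.mem_univ j)]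
    simp only [P0, map_mul]
    have := (hAB j).2
    field_simp
  have hr0 : aeval t (∏ i, B i) ≠ 0 := by
    rw [map_prod, Finset.prod_ne_zero_iff]
    intro i _; exact (hAB i).2
  letI : NormalizedGCDMonoid k[X] := Classical.choice inferInstance
  obtain ⟨j0, hj0⟩ := hne
  obtain ⟨g, hg, hg1⟩ := Finset.extract_gcd P0 (s := Finset.univ) ⟨j0, Finset.mem_univ _⟩
  set d := Finset.univ.gcd P0
  have hd : aeval t d ≠ 0 := by
    intro h
    have := hP0 j0
    rw [hg j0 (Finset.mem_univ _), map_mul, h, zero_mul] at this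
    exact mul_ne_zero hr0 hj0 this.symm
  refine ⟨aeval t (∏ i, B i) / aeval t d, g, div_ne_zero hr0 hd, ?_, ?_⟩
  · intro j
    have := hP0 j
    rw [hg j (Finset.mem_univ _), map_mul] at this
    field_simp
    linear_combination this
  · by_contra! h
    have : X ∣ Finset.univ.gcd g := Finset.dvd_gcd (fun j _ => X_dvd_iff.2 (h j))
    rw [hg1] at this
    exact Polynomial.not_isUnit_X (isUnit_of_dvd_one this)

def ACl (L : Set E) : Prop := ∀ (h : E) (P : E[X]), P ≠ 0 → (∀ n, P.coeff n ∈ L) → P.eval h = 0 → h ∈ L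

theorem ACl.mem {k : Type v} [Field k] [Algebra k E] {L : Set E} (hL : ACl L) (hk : ∀ c, algebraMap k E c ∈ L)
    {h : E} (hh : IsAlgebraic k h) : h ∈ L := by
  obtain ⟨q, hq, e⟩ := hh
  refine hL h (q.map (algebraMap k E)) ?_ ?_ ?_
  · rwa [Ne, Polynomial.map_eq_zero]
  · intro n; rw [coeff_map]; exact hk _
  · rw [eval_map_algebraMap]; exact e

theorem nd_step {k : Type v} [Field k] [Algebra k E] {ι J : Type w} [Finite ι] [Fintype J] 
    (s : ι → E) (hs : AlgebraicIndependent k s) (i0 i1 : ι) (h01 : i0 ≠ i1)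
    (hAC : ACl (IntermediateField.adjoin k (Set.range (fun i => s i / s i0)) : Set E))
    (w : J → E) (hw : LinearIndependent k w) (e : ι → J) (he : ∀ i, w (e i) = s i)
    (h1 : 1 ∈ Submodule.span k (Set.range w)) (M : ℕ)
    (hM : (Submodule.span k (Set.range w))^(M+1) ≤ Submodule.span k (insert 1 (Set.range s)) * (Submodule.span k (Set.range w))^M)
    (c : J → E) (hc : ∀ j, c j ∈ IntermediateField.adjoin k {s i1 / s i0}) (hc1 : c (e i1) = 0)
    (hrel : ∑ j, c j * w j = 0) : ∀ j, c j = 0 := by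
  classical
  by_contra! hne
  have h0 : s i0 ≠ 0 := hs.ne_zero i0
  have h1' : s i1 ≠ 0 := hs.ne_zero i1
  set t := s i1 / s i0 with ht
  set W := Submodule.span k (Set.range w) with hW
  have hwW : ∀ j, w j ∈ W := fun j => Submodule.subset_span ⟨j, rfl⟩
  have hsW : ∀ i, s i ∈ W := fun j => he j ▸ hwW (e j)
  obtain ⟨r, P, hr, hP, j0, hj0⟩ := clear_den t c hc hne
  -- linear combination
  set l := ∑ j, (P j).coeff 0 • w j with hl
  set b := ∑ j, aeval t (P j).divX * w j with hb
  have hlb : l = - (t * b) := by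
    have : l + t * b = r * ∑ j, c j * w j := by
      rw [hl, hb, Finset.mul_sum, Finset.mul_sum, ← Finset.sum_add_distrib]
      refine Finset.sum_congr rfl fun j _ => ?_
      rw [← mul_assoc r, ← hP]
      conv_rhs => rw [← divX_mul_X_add (P j)]
      simp only [map_add, map_mul, aeval_X, aeval_C, Algebra.smul_def]
      ring
    rw [hrel, mul_zero] at this
    exact eq_neg_of_add_eq_zero_left this
  set h := l / s i1 with hh
  have hh2 : h = - b / s i0 := by
    rw [hh, hlb, ht]; field_simp
  obtain ⟨m, hm⟩ : ∃ m, ∀ j, (P j).divX.natDegree ≤ m := 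
    ⟨Finset.univ.sup fun j => (P j).divX.natDegree, fun j => Finset.le_sup (f := fun j => (P j).divX.natDegree) (Finset.mem_univ j)⟩
  have hlW : l ∈ W := Submodule.sum_mem _ fun j _ => W.smul_mem _ (hwW j)
  have e1 : s i1^(m+1) * h ∈ W^(m+1) := by
    have : s i1^(m+1) * h = s i1^m * l := by rw [hh]; field_simp; ring
    rw [this, pow_succ]
    exact Submodule.mul_mem_mul (Submodule.pow_mem_pow _ (hsW _) _) hlW
  have e2 : s i0^(m+1) * h ∈ W^(m+1) := by
    have : s i0^(m+1) * h = ∑ j, -((s i0^m * aeval t (P j).divX) * w j) := by 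
      rw [Finset.sum_neg_distrib]
      simp_rw [mul_assoc]
      rw [← Finset.mul_sum, ← hb, hh2]; field_simp; ring
    rw [this, pow_succ]
    refine Submodule.sum_mem _ fun j _ => Submodule.neg_mem _ (Submodule.mul_mem_mul ?_ (hwW j))
    rw [aeval_eq_sum_range, Finset.mul_sum]
    refine Submodule.sum_mem _ fun i hi => ?_
    rw [mul_smul_comm]
    refine Submodule.smul_mem _ _ ?_
    have hi' : i ≤ m := by have := hm j; simp at hi; omega
    have : s i0^m * t^i = s i0^(m-i) * s i1^i := by
      rw [ht, div_pow, ← Nat.sub_add_cancel hi', pow_add, Nat.add_sub_cancel]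
      field_simp
    rw [this, show m = (m - i) + i by omega, pow_add, Nat.add_sub_cancel]
    exact Submodule.mul_mem_mul (Submodule.pow_mem_pow _ (hsW _) _) (Submodule.pow_mem_pow _ (hsW _) _)
  have halg : IsAlgebraic k h := alg_lemma s hs i0 _ W rfl h1 (Submodule.fg_span (Set.finite_range _)) M hM (s i1) 
    (Or.inr ⟨i1, h01.symm, rfl⟩) (m+1) h e1 e2
  have hL := hAC.mem (fun c => IntermediateField.algebraMap_mem _ c) halg
  have hmob := (algInd_mob s hs i0).1
  have hres := hmob.comp (fun i : {i // i ≠ i0} => i.1) Subtype.val_injective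
  have hres' : AlgebraicIndependent k (fun i : {i // i ≠ i0} => s i.1 / s i0) := by
    convert hres using 2 with i
    simp [i.2]
  obtain ⟨a, ha⟩ := ac_descend _ hres' h (by
    refine (IntermediateField.adjoin_le_iff.2 ?_ : IntermediateField.adjoin k (Set.range (fun i => s i / s i0)) ≤ _) hL
    rintro _ ⟨i, rfl⟩
    by_cases hi : i = i0
    · simp only [hi, div_self h0]; exact one_mem _
    · exact IntermediateField.subset_adjoin _ _ ⟨⟨i, hi⟩, rfl⟩) halg
  have hl2 : l = a • w (e i1) := by
    rw [he, Algebra.smul_def, ha, hh]; field_simp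
  rw [Fintype.linearIndependent_iff] at hw
  have hfin := hw (fun j => (P j).coeff 0 - if j = e i1 then a else 0) (by
    simp_rw [sub_smul, Finset.sum_sub_distrib, ite_smul, zero_smul]
    rw [Finset.sum_ite_eq' Finset.univ (e i1)]
    rw [← hl, hl2]; simp) 
  have hPe : aeval t (P (e i1)) = 0 := by rw [hP, hc1, mul_zero]
  -- t transcendental
  have htr : Transcendental k t := by
    have := hres'.transcendental ⟨i1, h01.symm⟩
    exact this
  have hPe0 : P (e i1) = 0 := by
    by_contra hne
    exact htr ⟨_, hne, hPe⟩
  have ha0 := hfin (e i1)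
  rw [hPe0] at ha0
  simp only [coeff_zero, if_true, zero_sub, neg_eq_zero] at ha0
  have := hfin j0
  rw [ha0] at this
  simp at this
  exact hj0 this

theorem nd_induct (n : ℕ) : ∀ {k : Type u} [Field k] [Algebra k E] {ι J : Type w} [Finite ι] [Fintype J] 
    (_ : Nat.card ι = n + 1)
    (s : ι → E) (_ : AlgebraicIndependent k s) (i0 : ι) 
    (_ : ACl (IntermediateField.adjoin k (Set.range (fun i => s i / s i0)) : Set E))
    (w : J → E) (_ : LinearIndependent k w) (e : ι → J) (_ : ∀ i, w (e i) = s i)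
    (_ : 1 ∈ Submodule.span k (Set.range w)) (M : ℕ)
    (_ : (Submodule.span k (Set.range w))^(M+1) ≤ Submodule.span k (insert 1 (Set.range s)) * (Submodule.span k (Set.range w))^M)
    (c : J → E) (_ : ∀ j, c j ∈ IntermediateField.adjoin k (Set.range (fun i => s i / s i0))) 
    (_ : ∀ i, i ≠ i0 → c (e i) = 0)
    (_ : ∑ j, c j * w j = 0), ∀ j, c j = 0 := by
  induction n with
  | zero =>
    intro k _ _ ι J _ _ hcard s hs i0 hAC w hw e he h1 M hM c hc hc1 hrel
    have h0 : s i0 ≠ 0 := hs.ne_zero i0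
    have hsub : ∀ i, i = i0 := by
      have := (Nat.card_eq_one_iff_unique.1 hcard).1
      intro i; exact Subsingleton.elim _ _
    have hb : ∀ j, ∃ a : k, algebraMap k E a = c j := by
      intro j
      have h2 : IntermediateField.adjoin k (Set.range (fun i => s i / s i0)) ≤ ⊥ := by
        rw [IntermediateField.adjoin_le_iff]
        rintro _ ⟨i, rfl⟩
        simp only [hsub i, div_self h0]; exact one_mem _
      exact IntermediateField.mem_bot.1 (h2 (hc j))
    choose a ha using hb
    rw [Fintype.linearIndependent_iff] at hw
    intro j
    rw [← ha, hw a (by simp_rw [Algebra.smul_def, ha]; exact hrel) j, map_zero]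
  | succ n ih =>
    intro k _ _ ι J _ _ hcard s hs i0 hAC w hw e he h1 M hM c hc hc1 hrel
    classical
    have h0 : s i0 ≠ 0 := hs.ne_zero i0
    obtain ⟨i1, h10⟩ : ∃ i1, i1 ≠ i0 := by
      haveI : Nontrivial ι := by
        rw [← Finite.one_lt_card_iff_nontrivial]; omega
      exact exists_ne i0
    have heinj : Function.Injective e := by
      intro i j hij
      refine hs.injective ?_
      rw [← he, ← he, hij]
    set t := s i1 / s i0 with ht
    have hts : algebraMap (IntermediateField.adjoin k {t}) E (IntermediateField.AdjoinSimple.gen k t) * s i0 = s i1 := by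
      rw [IntermediateField.AdjoinSimple.algebraMap_gen, ht]; field_simp
    let k2 := IntermediateField.adjoin k {t}
    have hstep := nd_step s hs i0 i1 h10.symm hAC w hw e he h1 M hM
    let ι' := {i // i ≠ i1}
    let J' := {j // j ≠ e i1}
    let i0' : ι' := ⟨i0, h10.symm⟩
    have hcard' : Nat.card ι' = n + 1 := by
      haveI := Fintype.ofFinite ι
      have h2 := Fintype.card_subtype_compl (fun i => i = i1)
      simp only [Fintype.card_subtype_eq] at h2
      rw [Nat.card_eq_fintype_card] at hcard ⊢
      rw [hcard] at h2
      rw [Nat.add_sub_cancel] at h2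
      exact h2
    have hadj : ∀ x, x ∈ IntermediateField.adjoin k (Set.range (fun i => s i / s i0)) ↔ 
        x ∈ IntermediateField.adjoin k2 (Set.range (fun i : ι' => s i / s i0'.1)) := by
      have h3 : (Set.range (fun i => s i / s i0)) = {t} ∪ (Set.range (fun i : ι' => s i / s i0'.1)) := by
        ext x
        constructor
        · rintro ⟨i, rfl⟩
          by_cases h : i = i1
          · left; simp [h, ht]
          · right; exact ⟨⟨i, h⟩, rfl⟩
        · rintro (rfl | ⟨i, rfl⟩)
          · exact ⟨i1, rfl⟩
          · exact ⟨i.1, rfl⟩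
      intro x
      rw [h3, ← IntermediateField.adjoin_adjoin_left, IntermediateField.mem_restrictScalars]
    have hspan : Submodule.span k2 (Set.range w) = Submodule.span k2 (Set.range (fun j : J' => w j)) := by
      apply le_antisymm
      · rw [Submodule.span_le]
        rintro _ ⟨j, rfl⟩
        by_cases h : j = e i1
        · rw [h, he, ← hts]
          have : s i0 ∈ Submodule.span k2 (Set.range (fun j : J' => w j)) := 
            Submodule.subset_span ⟨⟨e i0, fun h => h10.symm (heinj h)⟩, he i0⟩
          have h4 := Submodule.smul_mem _ (IntermediateField.AdjoinSimple.gen k t) this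
          rwa [Algebra.smul_def] at h4
        · exact Submodule.subset_span ⟨⟨j, h⟩, rfl⟩
      · apply Submodule.span_mono
        rintro _ ⟨j, rfl⟩; exact ⟨j.1, rfl⟩
    have hle : ∀ X : Set E, Submodule.span k X ≤ (Submodule.span k2 X).restrictScalars k := fun X =>
      Submodule.span_le.2 Submodule.subset_span
    have hspan2 : Submodule.span k2 (insert 1 (Set.range s)) = Submodule.span k2 (insert 1 (Set.range (fun j : ι' => s j))) := by
      apply le_antisymm
      · rw [Submodule.span_le]
        rintro _ (rfl | ⟨j, rfl⟩)
        · exact Submodule.subset_span (Or.inl rfl)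
        · by_cases h : j = i1
          · rw [h, ← hts]
            have : s i0 ∈ Submodule.span k2 (insert 1 (Set.range (fun j : ι' => s j))) := 
              Submodule.subset_span (Or.inr ⟨⟨i0, h10.symm⟩, rfl⟩)
            have h4 := Submodule.smul_mem _ (IntermediateField.AdjoinSimple.gen k t) this
            rwa [Algebra.smul_def] at h4
          · exact Submodule.subset_span (Or.inr ⟨⟨j, h⟩, rfl⟩)
      · apply Submodule.span_mono
        rintro _ (rfl | ⟨j, rfl⟩)
        · exact Or.inl rfl
        · exact Or.inr ⟨j.1, rfl⟩
    have hce : c (e i1) = 0 := hc1 i1 h10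
    have main := ih (k := k2) (ι := ι') (J := J') hcard' (fun i => s i.1) (algInd_step s hs i0 i1 h10.symm) i0' 
      (by
        have : (IntermediateField.adjoin k (Set.range (fun i => s i / s i0)) : Set E) = 
           (IntermediateField.adjoin k2 (Set.range (fun i : ι' => s i / s i0'.1)) : Set E) := by
          ext x; exact hadj x
        rw [← this]; exact hAC) (fun j => w j.1) 
      (by
        rw [Fintype.linearIndependent_iff]
        intro g hg
        have := hstep (fun j => if h : j ≠ e i1 then (g ⟨j, h⟩ : E) else 0) (by
          intro j
          by_cases h : j ≠ e i1
          · simp only [h, ne_eq, not_false_eq_true, dite_true]; exact (g ⟨j, h⟩).2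
          · simp only [h, dite_false]; exact zero_mem _) (by simp) (by
          rw [← Finset.add_sum_erase _ _ (Finset.mem_univ (e i1))]
          simp only [ne_eq, not_true_eq_false, dite_false, zero_mul, zero_add]
          rw [← hg]
          rw [Finset.sum_subtype (p := fun j => j ≠ e i1) (Finset.univ.erase (e i1)) (by simp)]
          refine Finset.sum_congr rfl fun j _ => ?_
          rw [dif_pos j.2]; rfl)
        intro j
        have h5 := this j.1
        rw [dif_pos j.2] at h5
        exact Subtype.ext h5)
      (fun i => ⟨e i.1, fun h => i.2 (heinj h)⟩) (fun i => he i.1)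
      (by 
        rw [← hspan]
        exact hle _ h1) M
      (by
        rw [← hspan, ← hspan2, Submodule.span_pow, Submodule.span_pow, Submodule.span_mul_span, Submodule.span_le]
        rw [Submodule.span_pow, Submodule.span_pow, Submodule.span_mul_span] at hM
        intro x hx
        exact hle _ (hM (Submodule.subset_span hx)))
      (fun j => c j.1) (fun j => (hadj _).1 (hc _)) 
      (fun i hi => hc1 i.1 (fun h => hi (Subtype.ext h)))
      (by
        rw [← hrel, ← Finset.add_sum_erase _ _ (Finset.mem_univ (e i1)), hce, zero_mul, zero_add]
        rw [Finset.sum_subtype (p := fun j => j ≠ e i1) (Finset.univ.erase (e i1)) (by simp)])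
    intro j
    by_cases h : j = e i1
    · rw [h, hce]
    · exact main ⟨j, h⟩
end ND

section T3
open Polynomial
variable {E : Type u} [Field E] {κ : Type v} [Field κ] [Algebra κ E] {T : Type} [Fintype T]

theorem pow_mono_W {W : Submodule κ E} (h1 : 1 ∈ W) {a b : ℕ} (h : a ≤ b) : W ^ a ≤ W ^ b := by
  have : (1 : Submodule κ E) ≤ W := by rwa [Submodule.one_le]
  exact pow_le_pow_right' this h

theorem aeval_mem_W {W : Submodule κ E} (h1 : 1 ∈ W) {s : E} (hs : s ∈ W) (P : κ[X]) (m : ℕ) (hm : P.natDegree ≤ m) :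
    aeval s P ∈ W ^ m := by
  rw [aeval_eq_sum_range]
  refine Submodule.sum_mem _ fun i hi => Submodule.smul_mem _ _ ?_
  have hi' : i ≤ m := by simp at hi; omega
  exact pow_mono_W h1 hi' (Submodule.pow_mem_pow _ hs _)

/-- one step of dividing a relation by s -/
theorem div_step {W : Submodule κ E} (h1 : 1 ∈ W) {s : E} (hs : s ∈ W) (hs0 : s ≠ 0) {J : Type} [Fintype J]
    (v : J → E) (n0 D : ℕ) (hv : ∀ j, v j ∈ W ^ (n0 + (D+1)) ∧ s ^ n0 * v j ∈ W ^ (n0 + (D+1)))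
    (c : J → E) (hc : ∀ j, c j ∈ IntermediateField.adjoin κ {s}) (hne : ∃ j, c j ≠ 0)
    (hrel : ∑ j, c j * v j = 0) : ∃ (γ : J → κ) (h : E), (∃ j, γ j ≠ 0) ∧ (∑ j, γ j • v j = s * h) ∧
      ∃ n, h ∈ W ^ (n + D) ∧ s ^ n * h ∈ W ^ (n + D) := by
  classical
  obtain ⟨r, P, hr, hP, hj0⟩ := clear_den s c hc hne
  obtain ⟨m, hm⟩ : ∃ m, ∀ j, (P j).divX.natDegree ≤ m := 
    ⟨Finset.univ.sup fun j => (P j).divX.natDegree, fun j => Finset.le_sup (f := fun j => (P j).divX.natDegree) (Finset.mem_univ j)⟩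
  have hlb : ∑ j, (P j).coeff 0 • v j = s * - ∑ j, aeval s (P j).divX * v j := by
    have : ∑ j, (P j).coeff 0 • v j + s * ∑ j, aeval s (P j).divX * v j = r * ∑ j, c j * v j := by
      rw [Finset.mul_sum, Finset.mul_sum, ← Finset.sum_add_distrib]
      refine Finset.sum_congr rfl fun j _ => ?_
      rw [← mul_assoc r, ← hP]
      conv_rhs => rw [← divX_mul_X_add (P j)]
      simp only [map_add, map_mul, aeval_X, aeval_C, Algebra.smul_def]
      ring
    rw [hrel, mul_zero] at this
    rw [mul_neg]
    exact eq_neg_of_add_eq_zero_left this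
  refine ⟨fun j => (P j).coeff 0, - ∑ j, aeval s (P j).divX * v j, hj0, hlb, m + n0 + 1, ?_, ?_⟩
  · refine Submodule.neg_mem _ (Submodule.sum_mem _ fun j _ => ?_)
    have := Submodule.mul_mem_mul (aeval_mem_W h1 hs _ m (hm j)) (hv j).1
    rw [← pow_add] at this
    exact pow_mono_W h1 (by omega) this
  · have e : s ^ (m + n0 + 1) * - ∑ j, aeval s (P j).divX * v j = ∑ j, (P j).coeff 0 • (s ^ m * (s ^ n0 * v j)) := by
      have : s ^ (m + n0 + 1) * - ∑ j, aeval s (P j).divX * v j = s^m * (s ^ n0 * ∑ j, (P j).coeff 0 • v j) := by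
        rw [hlb]; ring
      rw [this, Finset.mul_sum, Finset.mul_sum]
      simp only [mul_smul_comm]
    rw [e]
    refine Submodule.sum_mem _ fun j _ => Submodule.smul_mem _ _ ?_
    have := Submodule.mul_mem_mul (Submodule.pow_mem_pow _ hs m) (hv j).2
    rw [← pow_add] at this
    exact pow_mono_W h1 (by omega) this

theorem T3_const {V W : Submodule κ E} {s : E} (hs : Transcendental κ s) 
    (hV : V = Submodule.span κ {1, s})
    (h1 : 1 ∈ W) (hfg : W.FG) (M : ℕ) (hM : W^(M+1) ≤ V * W^M)
    (hAC : ACl (Set.range (algebraMap κ E))) (h : E) (n : ℕ) (hn : h ∈ W ^ n) (hn2 : s ^ n * h ∈ W ^ n) :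
    ∃ c : κ, algebraMap κ E c = h := by
  have := alg_lemma (k := κ) (fun _ : Unit => s) ((algebraicIndependent_unique_type_iff).2 hs) () V W
    (by rw [hV, Set.range_const]) h1 hfg M hM 1 (Or.inl rfl) n h (by simpa using hn) hn2
  exact hAC.mem (k := κ) (fun c => ⟨c, rfl⟩) this

theorem T3_a {s : E} (hs : Transcendental κ s) (ζ : T → E)
    (W : Submodule κ E) (hW : W = Submodule.span κ (insert 1 (insert s (Set.range ζ)))) (M : ℕ) (hM : W^(M+1) ≤ Submodule.span κ {1, s} * W^M)
    (hAC : ACl (Set.range (algebraMap κ E)))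
    (hind : ∀ (c0 c1 : κ) (c : T → κ), algebraMap κ E c0 + c1 • s + ∑ i, c i • ζ i = 0 → c0 = 0 ∧ c1 = 0 ∧ ∀ i, c i = 0)
    (c0 : E) (c : T → E) (hc0 : c0 ∈ IntermediateField.adjoin κ {s}) (hc : ∀ i, c i ∈ IntermediateField.adjoin κ {s})
    (hrel : c0 + ∑ i, c i * ζ i = 0) : c0 = 0 ∧ ∀ i, c i = 0 := by
  classical
  have h1 : 1 ∈ W := by rw [hW]; exact Submodule.subset_span (by simp)
  have hsW : s ∈ W := by rw [hW]; exact Submodule.subset_span (by simp)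
  have hζW : ∀ i, ζ i ∈ W := by intro i; rw [hW]; exact Submodule.subset_span (by simp)
  have hfg : W.FG := by rw [hW]; exact Submodule.fg_span (((Set.finite_range _).insert _).insert _)
  have hs0 : s ≠ 0 := by rintro rfl; exact hs isAlgebraic_zero
  by_contra hcon
  let v : Option T → E := fun o => o.elim 1 ζ
  let d : Option T → E := fun o => o.elim c0 c
  obtain ⟨γ, h, ⟨j0, hj0⟩, e, n, hn, hn2⟩ := div_step h1 hsW hs0 v 0 0 (by
    rintro (_ | i)
    · simpa [v] using h1
    · simpa [v] using hζW i) d (by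
    rintro (_ | i)
    · exact hc0
    · exact hc i) (by
    by_contra! h
    exact hcon ⟨h none, fun i => h (some i)⟩) (by
    simpa [v, d, Fintype.sum_option] using hrel)
  obtain ⟨a, ha⟩ := T3_const hs rfl h1 hfg M hM hAC h n hn hn2
  have := hind (γ none) (-a) (fun i => γ (some i)) (by
    simp only [Fintype.sum_option, v, Option.elim] at e
    rw [← ha] at e
    simp only [Algebra.smul_def, mul_one, map_neg] at e ⊢
    linear_combination e)
  rcases j0 with _ | i
  · exact hj0 this.1
  · exact hj0 (this.2.2 i)

theorem T3_b {s : E} (hs : Transcendental κ s) (ζ : T → E)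
    (W : Submodule κ E) (hW : W = Submodule.span κ (insert 1 (insert s (Set.range ζ)))) (M : ℕ) (hM : W^(M+1) ≤ Submodule.span κ {1, s} * W^M)
    (hAC : ACl (Set.range (algebraMap κ E)))
    (hind : ∀ (c0 c1 : κ) (c : T → κ), algebraMap κ E c0 + c1 • s + ∑ i, c i • ζ i = 0 → c0 = 0 ∧ c1 = 0 ∧ ∀ i, c i = 0)
    (hdim : ∀ v : Option (Option T) → E, ∃ c : Option (Option T) → E, (∀ j, c j ∈ IntermediateField.adjoin κ {s}) ∧ 
      (∃ j, c j ≠ 0) ∧ ∑ j, c j * v j = 0)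
    (D : ℕ) : ∀ (b : E) (n : ℕ), b ∈ W ^ (n + D) → s ^ n * b ∈ W ^ (n + D) →
      ∃ (P0 : κ[X]) (P : T → κ[X]), P0 ∈ degreeLT κ (D+1) ∧ (∀ i, P i ∈ degreeLT κ D) ∧
        b = aeval s P0 + ∑ i, aeval s (P i) * ζ i := by
  classical
  have h1 : 1 ∈ W := by rw [hW]; exact Submodule.subset_span (by simp)
  have hsW : s ∈ W := by rw [hW]; exact Submodule.subset_span (by simp)
  have hζW : ∀ i, ζ i ∈ W := by intro i; rw [hW]; exact Submodule.subset_span (by simp)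
  have hfg : W.FG := by rw [hW]; exact Submodule.fg_span (((Set.finite_range _).insert _).insert _)
  have hs0 : s ≠ 0 := by rintro rfl; exact hs isAlgebraic_zero
  have hpol : ∀ P : κ[X], aeval s P ∈ IntermediateField.adjoin κ {s} := fun P =>
    (IntermediateField.mem_adjoin_simple_iff κ _).2 ⟨P, 1, by simp⟩
  have hX : ∀ (P : κ[X]) n, P ∈ degreeLT κ n → X * P ∈ degreeLT κ (n+1) := by
    intro P n hP
    rw [mem_degreeLT] at *
    by_cases h : P = 0
    · simp [h, WithBot.bot_lt_coe]
    · rw [degree_mul, degree_X, add_comm]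
      push_cast
      exact WithBot.add_lt_add_right (by simp) hP
  have hC : ∀ (a : κ) n, C a ∈ degreeLT κ (n+1) := by
    intro a n
    rw [mem_degreeLT]
    exact degree_C_le.trans_lt (by exact_mod_cast Nat.succ_pos n)
  induction D with
  | zero =>
    intro b n hn hn2
    obtain ⟨a, ha⟩ := T3_const hs rfl h1 hfg M hM hAC b n hn hn2
    exact ⟨C a, 0, hC a 0, fun i => Submodule.zero_mem _, by simp [ha]⟩
  | succ D ih =>
    intro b n hn hn2
    let v : Option (Option T) → E := fun o => o.elim b (fun o => o.elim 1 ζ)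
    obtain ⟨c, hc, hne, hrel⟩ := hdim v
    have hmem : ∀ x ∈ W, x ∈ W ^ (n + (D+1)) ∧ s ^ n * x ∈ W ^ (n + (D+1)) := by
      intro x hx
      refine ⟨pow_mono_W h1 (a := 1) (by omega) (by simpa using hx), ?_⟩
      have := Submodule.mul_mem_mul (Submodule.pow_mem_pow _ hsW n) hx
      rw [← pow_succ] at this
      exact pow_mono_W h1 (by omega) this
    obtain ⟨γ, h, ⟨j0, hj0⟩, e, n', hn', hn2'⟩ := div_step h1 hsW hs0 v n D (by
      rintro (_ | _ | i)
      · exact ⟨hn, hn2⟩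
      · exact hmem 1 h1
      · exact hmem _ (hζW i)) c hc hne hrel
    obtain ⟨P0, P, hP0, hP, eh⟩ := ih h n' hn' hn2'
    simp only [Fintype.sum_option, v, Option.elim] at e
    have e2 : γ none • b = aeval s (X * P0 - C (γ (some none))) + ∑ i, aeval s (X * P i - C (γ (some (some i)))) * ζ i := by
      rw [eh] at e
      simp only [map_sub, map_mul, aeval_X, aeval_C, sub_mul, Finset.sum_sub_distrib, mul_assoc]
      rw [← Finset.mul_sum]
      simp only [Algebra.smul_def, mul_one] at e ⊢
      linear_combination e
    by_cases hγ : γ none = 0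
    · exfalso
      rw [hγ, zero_smul] at e2
      obtain ⟨f0, f1⟩ := T3_a hs ζ W hW M hM hAC hind _ _ (hpol _) (fun i => hpol _) e2.symm
      have key : ∀ (Q : κ[X]) a, aeval s (X * Q - C a) = 0 → a = 0 := by
        intro Q a h
        have : X * Q - C a = 0 := by
          by_contra hne
          exact hs ⟨_, hne, h⟩
        have := congrArg (fun p => p.coeff 0) this
        simpa using this
      rcases j0 with _ | _ | i
      · exact hj0 hγ
      · exact hj0 (key _ _ f0)
      · exact hj0 (key _ _ (f1 i))
    · refine ⟨C (γ none)⁻¹ * (X * P0 - C (γ (some none))), fun i => C (γ none)⁻¹ * (X * P i - C (γ (some (some i)))), ?_, ?_, ?_⟩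
      · rw [← smul_eq_C_mul]
        exact Submodule.smul_mem _ _ (Submodule.sub_mem _ (hX _ _ hP0) (hC _ _))
      · intro i
        beta_reduce
        rw [← smul_eq_C_mul]
        exact Submodule.smul_mem _ _ (Submodule.sub_mem _ (hX _ _ (hP i)) (hC _ _))
      · have e3 : b = algebraMap κ E (γ none)⁻¹ * (γ none • b) := by
          rw [Algebra.smul_def, ← mul_assoc, ← map_mul, inv_mul_cancel₀ hγ, map_one, one_mul]
        rw [e3, e2, mul_add, Finset.mul_sum]
        simp only [map_mul, aeval_C, mul_assoc]
end T3

section Hensel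
open Polynomial

theorem hensel_root {k : Type v} [Field k] [IsAlgClosed k] {L : Type u} [Field L] [Algebra k L]
    (F U V : (PowerSeries L)[X]) (hF : F.Monic) (hdeg : F.natDegree ≠ 0)
    (hc : ∀ n, ∃ a : k, algebraMap k L a = PowerSeries.constantCoeff (F.coeff n))
    (hUV : U * F + V * derivative F = 1) : ∃ y, F.IsRoot y := by
  obtain ⟨G, hG⟩ : ∃ G : k[X], G.map (algebraMap k L) = F.map (PowerSeries.constantCoeff) := by
    have : F.map (PowerSeries.constantCoeff) ∈ lifts (algebraMap k L) := by
      rw [lifts_iff_coeff_lifts]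
      intro n
      obtain ⟨a, ha⟩ := hc n
      exact ⟨a, by rw [ha, coeff_map]⟩
    exact (mem_lifts _).1 this
  have hdG : G.natDegree = F.natDegree := by
    rw [← natDegree_map (algebraMap k L), hG, hF.natDegree_map]
  obtain ⟨r, hr⟩ := IsAlgClosed.exists_root G (by
    intro h
    rw [natDegree_eq_of_degree_eq_some h] at hdG
    exact hdeg hdG.symm)
  let a0 : PowerSeries L := PowerSeries.C (algebraMap k L r)
  have ha0 : PowerSeries.constantCoeff a0 = algebraMap k L r := PowerSeries.constantCoeff_C _
  have hev : PowerSeries.constantCoeff (F.eval a0) = 0 := by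
    rw [← eval_map_apply, ← hG, ha0, eval_map_apply, hr.eq_zero, map_zero]
  have hmem : F.eval a0 ∈ Ideal.span {(PowerSeries.X : PowerSeries L)} := by
    rw [Ideal.mem_span_singleton, PowerSeries.X_dvd_iff]; exact hev
  have hunit : IsUnit ((derivative F).eval a0) := by
    rw [PowerSeries.isUnit_iff_constantCoeff, isUnit_iff_ne_zero]
    intro h
    have := congrArg (fun p => PowerSeries.constantCoeff (p.eval a0)) hUV
    simp only [eval_add, eval_mul, map_add, map_mul, hev, h, mul_zero, add_zero, eval_one, map_one] at this
    exact zero_ne_one this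
  obtain ⟨y, hy, _⟩ := HenselianRing.is_henselian (I := Ideal.span {(PowerSeries.X : PowerSeries L)}) F hF a0 hmem
    (hunit.map _)
  exact ⟨y, hy⟩

theorem alg_const {L : Type u} [Field L] (x : FractionRing (PowerSeries L)) (P : L[X]) (hP : P ≠ 0)
    (h : P.eval₂ ((algebraMap (PowerSeries L) (FractionRing (PowerSeries L))).comp PowerSeries.C) x = 0) :
    ∃ a : L, x = algebraMap (PowerSeries L) (FractionRing (PowerSeries L)) (PowerSeries.C a) := by
  have hInt : IsIntegral (PowerSeries L) x := by
    refine ⟨(C (P.leadingCoeff)⁻¹ * P).map PowerSeries.C, ?_, ?_⟩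
    · apply Monic.map
      rw [mul_comm]
      exact monic_mul_leadingCoeff_inv hP
    · rw [eval₂_map, eval₂_mul, h, mul_zero]
  obtain ⟨y, rfl⟩ := IsIntegrallyClosed.isIntegral_iff.1 hInt
  have hinj : Function.Injective (algebraMap (PowerSeries L) (FractionRing (PowerSeries L))) := IsFractionRing.injective _ _
  have hy : P.eval₂ PowerSeries.C y = 0 := by
    apply hinj
    rw [map_zero, ← h, hom_eval₂]
  have hyalg : IsIntegral L y := by
    rw [← isAlgebraic_iff_isIntegral]
    exact ⟨P, hP, hy⟩
  set a := PowerSeries.constantCoeff y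
  refine ⟨a, ?_⟩
  by_contra hne
  have hne' : y - algebraMap L (PowerSeries L) a ≠ 0 := by
    intro h
    rw [sub_eq_zero] at h
    exact hne (congrArg _ h)
  have hz : IsIntegral L (y - algebraMap L (PowerSeries L) a) := hyalg.sub isIntegral_algebraMap
  have h1 := minpoly.coeff_zero_ne_zero hz hne'
  have h2 := minpoly.aeval L (y - algebraMap L (PowerSeries L) a)
  set z := y - algebraMap L (PowerSeries L) a
  have hz0 : PowerSeries.constantCoeff z = 0 := by
    have : PowerSeries.constantCoeff (algebraMap L (PowerSeries L) a) = a := PowerSeries.constantCoeff_C _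
    simp only [z, map_sub, this]
    exact sub_self _
  apply h1
  have h3 := congrArg (PowerSeries.constantCoeff) h2
  rw [aeval_def, hom_eval₂, hz0, map_zero] at h3
  have h4 : (PowerSeries.constantCoeff (R := L)).comp (algebraMap L (PowerSeries L)) = RingHom.id L := by
    ext c; exact PowerSeries.constantCoeff_C _
  rw [h4, eval₂_id] at h3
  rwa [coeff_zero_eq_eval_zero]

open scoped IntermediateField.algebraAdjoinAdjoin

theorem exists_psi {k : Type v} [Field k] {E : Type u} [Field E] [Algebra k E] {ι : Type w} [Finite ι]
    (s : ι → E) (hs : AlgebraicIndependent k s) (i0 : ι)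
    (L : IntermediateField k E) (hL : ∀ i, s i / s i0 ∈ L)
    (φ : MvPolynomial ι k →+* PowerSeries L) (hφ : φ = MvPolynomial.eval₂Hom ((PowerSeries.C).comp (algebraMap k L)) 
      (fun i => PowerSeries.C (⟨s i / s i0, hL i⟩ : L) * PowerSeries.X)) :
    ∃ ψ : IntermediateField.adjoin k (Set.range s) →+* FractionRing (PowerSeries L), 
      ∀ (P : MvPolynomial ι k) (x : IntermediateField.adjoin k (Set.range s)), (x : E) = MvPolynomial.aeval s P →
        ψ x = algebraMap _ _ (φ P) := by
  have h0 : s i0 ≠ 0 := hs.ne_zero i0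
  have hinj : Function.Injective φ := by
    let φ1 : MvPolynomial ι k →+* L[X] := MvPolynomial.eval₂Hom ((C : L →+* L[X]).comp (algebraMap k L)) 
      (fun i => C (⟨s i / s i0, hL i⟩ : L) * X)
    have e1 : φ = (Polynomial.coeToPowerSeries.ringHom (R := L)).comp φ1 := by
      rw [hφ]
      apply MvPolynomial.ringHom_ext
      · intro r
        simp only [φ1, RingHom.comp_apply, MvPolynomial.coe_eval₂Hom, MvPolynomial.eval₂_C, coeToPowerSeries.ringHom_apply]
        exact (Polynomial.coe_C _).symm
      · intro i
        simp only [φ1, RingHom.comp_apply, MvPolynomial.coe_eval₂Hom, MvPolynomial.eval₂_X, coeToPowerSeries.ringHom_apply,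
          Polynomial.coe_mul, Polynomial.coe_C, Polynomial.coe_X]
    have e2 : ((aeval (s i0) : L[X] →ₐ[L] E) : L[X] →+* E).comp φ1 = (MvPolynomial.aeval s : MvPolynomial ι k →ₐ[k] E) := by
      apply MvPolynomial.ringHom_ext
      · intro r
        simp only [φ1, RingHom.comp_apply, MvPolynomial.coe_eval₂Hom, MvPolynomial.eval₂_C, RingHom.coe_coe, MvPolynomial.aeval_C]
        exact aeval_C _ _
      · intro i
        simp only [φ1, RingHom.comp_apply, MvPolynomial.coe_eval₂Hom, MvPolynomial.eval₂_X, RingHom.coe_coe, MvPolynomial.aeval_X,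
          map_mul, aeval_C, aeval_X]
        change s i / s i0 * s i0 = s i
        field_simp
    have i2 : Function.Injective φ1 := by
      intro a b hab
      apply hs
      have := congrArg (aeval (s i0) : L[X] →ₐ[L] E) hab
      have h1 := RingHom.congr_fun e2 a
      have h2 := RingHom.congr_fun e2 b
      simp only [RingHom.comp_apply, RingHom.coe_coe] at h1 h2
      rw [h1, h2] at this
      exact this
    rw [e1]
    exact (Polynomial.coe_injective L).comp i2
  let ψA : Algebra.adjoin k (Set.range s) →+* FractionRing (PowerSeries L) :=
    ((algebraMap _ _).comp φ).comp (hs.aevalEquiv.symm : _ →+* _)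
  have hψA : Function.Injective ψA := 
    ((IsFractionRing.injective (PowerSeries L) (FractionRing (PowerSeries L))).comp hinj).comp hs.aevalEquiv.symm.injective
  refine ⟨IsFractionRing.lift hψA, ?_⟩
  intro P x hx
  have : x = algebraMap (Algebra.adjoin k (Set.range s)) _ (hs.aevalEquiv P) := by
    apply Subtype.ext
    rw [hx]
    rfl
  rw [this, IsFractionRing.lift_algebraMap]
  simp only [ψA, RingHom.comp_apply, RingHom.coe_coe, AlgEquiv.symm_apply_apply]

theorem AC_hensel {k : Type v} [Field k] [IsAlgClosed k] {E : Type u} [Field E] [Algebra k E] {ι : Type w} [Finite ι]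
    (s : ι → E) (hs : AlgebraicIndependent k s) (i0 : ι)
    (K : IntermediateField k E) (hK : K = IntermediateField.adjoin k (Set.range s))
    (pb : PowerBasis K E) (f a b : K[X]) (hf : f = minpoly K pb.gen) (hab : a * f + b * derivative f = 1)
    (hgood : ∀ n, ∀ c : K, (c = f.coeff n ∨ c = a.coeff n ∨ c = b.coeff n) → 
      ∃ P D : MvPolynomial ι k, MvPolynomial.constantCoeff D ≠ 0 ∧ 
        MvPolynomial.aeval s D * (c : E) = MvPolynomial.aeval s P) :
    ACl (IntermediateField.adjoin k (Set.range (fun i => s i / s i0)) : Set E) := by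
  subst hK
  have h0 : s i0 ≠ 0 := hs.ne_zero i0
  set L := IntermediateField.adjoin k (Set.range (fun i => s i / s i0)) with hL
  have htL : ∀ i, s i / s i0 ∈ L := fun i => IntermediateField.subset_adjoin _ _ ⟨i, rfl⟩
  obtain ⟨φ, hφ⟩ : ∃ φ : MvPolynomial ι k →+* PowerSeries L, φ = MvPolynomial.eval₂Hom ((PowerSeries.C).comp (algebraMap k L)) 
      (fun i => PowerSeries.C (⟨s i / s i0, htL i⟩ : L) * PowerSeries.X) := ⟨_, rfl⟩
  obtain ⟨ψ, hψ⟩ := exists_psi s hs i0 L htL φ hφ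
  have hφC : ∀ c, φ (MvPolynomial.C c) = PowerSeries.C (algebraMap k L c) := by
    intro c; rw [hφ]; simp only [MvPolynomial.coe_eval₂Hom, MvPolynomial.eval₂_C]; rfl
  have hφX : ∀ i, φ (MvPolynomial.X i) = PowerSeries.C (⟨s i / s i0, htL i⟩ : L) * PowerSeries.X := by
    intro i; rw [hφ]; simp only [MvPolynomial.coe_eval₂Hom, MvPolynomial.eval₂_X]
  have hφ0 : ∀ P, PowerSeries.constantCoeff (φ P) = algebraMap k L (MvPolynomial.constantCoeff P) := by
    intro P
    have : (PowerSeries.constantCoeff (R := L)).comp φ = (algebraMap k L).comp MvPolynomial.constantCoeff := by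
      apply MvPolynomial.ringHom_ext
      · intro r; simp [hφC]
      · intro i; simp [hφX]
    exact RingHom.congr_fun this P
  set FF := FractionRing (PowerSeries L)
  have hinj : Function.Injective (algebraMap (PowerSeries L) FF) := IsFractionRing.injective _ _
  have hLK : L ≤ IntermediateField.adjoin k (Set.range s) := by
    rw [hL, IntermediateField.adjoin_le_iff]
    rintro _ ⟨i, rfl⟩
    exact div_mem (IntermediateField.subset_adjoin _ _ ⟨i, rfl⟩) (IntermediateField.subset_adjoin _ _ ⟨i0, rfl⟩)
  have hψL : ∀ (x : E) (hx : x ∈ L), ψ ⟨x, hLK hx⟩ = algebraMap _ _ (PowerSeries.C (⟨x, hx⟩ : L)) := by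
    intro x hx
    induction hx using IntermediateField.adjoin_induction with
    | mem x hx =>
      obtain ⟨i, rfl⟩ := hx
      have e1 := hψ (MvPolynomial.X i) ⟨s i, IntermediateField.subset_adjoin _ _ ⟨i, rfl⟩⟩ (by simp)
      have e2 := hψ (MvPolynomial.X i0) ⟨s i0, IntermediateField.subset_adjoin _ _ ⟨i0, rfl⟩⟩ (by simp)
      have e3 : (⟨s i / s i0, hLK (htL i)⟩ : IntermediateField.adjoin k (Set.range s)) = 
        ⟨s i, IntermediateField.subset_adjoin _ _ ⟨i, rfl⟩⟩ / ⟨s i0, IntermediateField.subset_adjoin _ _ ⟨i0, rfl⟩⟩ := rfl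
      have e4 : (⟨s i0 / s i0, htL i0⟩ : L) = 1 := Subtype.ext (div_self h0)
      have e5 : algebraMap (PowerSeries L) FF PowerSeries.X ≠ 0 := by
        rw [Ne, map_eq_zero_iff _ hinj]; exact PowerSeries.X_ne_zero
      rw [e3, map_div₀, e1, e2, hφX, hφX, e4, map_one, one_mul, map_mul, mul_div_assoc, div_self e5, mul_one]
    | algebraMap c =>
      rw [hψ (MvPolynomial.C c) _ (by simp), hφC]; rfl
    | add x y hx hy h1 h2 =>
      have := congrArg₂ (· + ·) h1 h2
      simp only [← map_add] at this
      exact this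
    | inv x hx h1 =>
      have := congrArg (·⁻¹) h1
      simp only [← map_inv₀] at this
      refine this.trans ?_
      by_cases hx0 : x = 0
      · subst hx0
        have z1 : (⟨0, hx⟩ : L) = 0 := rfl
        have z2 : (⟨0⁻¹, inv_mem hx⟩ : L) = 0 := Subtype.ext inv_zero
        rw [z1, z2]; simp
      · have hx1 : (⟨x, hx⟩ : L) ≠ 0 := fun h => hx0 (congrArg Subtype.val h)
        have z2 : (⟨x⁻¹, inv_mem hx⟩ : L) = (⟨x, hx⟩ : L)⁻¹ := rfl
        apply inv_eq_of_mul_eq_one_left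
        rw [z2, ← map_mul, ← map_mul, inv_mul_cancel₀ hx1, map_one, map_one]
    | mul x y hx hy h1 h2 =>
      have := congrArg₂ (· * ·) h1 h2
      simp only [← map_mul] at this
      exact this
  -- coefficients
  have hlift : ∀ n, ∀ c : IntermediateField.adjoin k (Set.range s), (c = f.coeff n ∨ c = a.coeff n ∨ c = b.coeff n) → 
      ∃ F : PowerSeries L, algebraMap _ _ F = ψ c ∧ ∃ r : k, algebraMap k L r = PowerSeries.constantCoeff F := by
    intro n c hc
    obtain ⟨P, D, hD, e⟩ := hgood n c hc
    have hPK : ∀ P : MvPolynomial ι k, MvPolynomial.aeval s P ∈ IntermediateField.adjoin k (Set.range s) := by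
      intro P
      apply IntermediateField.algebra_adjoin_le_adjoin
      rw [Algebra.adjoin_range_eq_range_aeval]
      exact ⟨P, rfl⟩
    have hcD : PowerSeries.constantCoeff (φ D) ≠ 0 := by
      rw [hφ0]; simpa using hD
    have hu : φ D * (φ D)⁻¹ = 1 := PowerSeries.mul_inv_cancel _ hcD
    refine ⟨φ P * (φ D)⁻¹, ?_, MvPolynomial.constantCoeff P * (MvPolynomial.constantCoeff D)⁻¹, ?_⟩
    · have e2 : (⟨_, hPK D⟩ : IntermediateField.adjoin k (Set.range s)) * c = ⟨_, hPK P⟩ := Subtype.ext e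
      have e3 := congrArg ψ e2
      rw [map_mul, hψ D ⟨_, hPK D⟩ rfl, hψ P ⟨_, hPK P⟩ rfl] at e3
      rw [map_mul, ← e3, mul_right_comm, ← map_mul, hu, map_one, one_mul]
    · rw [map_mul, map_mul, map_inv₀, ← hφ0, ← hφ0, PowerSeries.constantCoeff_inv]
  have hpl : ∀ g : (IntermediateField.adjoin k (Set.range s))[X], (∀ n, ∃ F : PowerSeries L, algebraMap _ _ F = ψ (g.coeff n)) →
      ∃ G : (PowerSeries L)[X], G.map (algebraMap _ FF) = g.map ψ := by
    intro g hg
    have : g.map ψ ∈ lifts (algebraMap (PowerSeries L) FF) := by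
      rw [lifts_iff_coeff_lifts]
      intro n
      obtain ⟨F, hF⟩ := hg n
      exact ⟨F, by rw [hF, coeff_map]⟩
    exact (mem_lifts _).1 this
  obtain ⟨F, hF⟩ := hpl f (fun n => (hlift n _ (Or.inl rfl)).imp fun _ h => h.1)
  obtain ⟨A, hA⟩ := hpl a (fun n => (hlift n _ (Or.inr (Or.inl rfl))).imp fun _ h => h.1)
  obtain ⟨B, hB⟩ := hpl b (fun n => (hlift n _ (Or.inr (Or.inr rfl))).imp fun _ h => h.1)
  have hintg : IsIntegral (IntermediateField.adjoin k (Set.range s)) pb.gen := pb.isIntegral_gen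
  have hfm : f.Monic := hf ▸ minpoly.monic hintg
  have hFm : F.Monic := by
    rw [Function.Injective.monic_map_iff hinj, hF]; exact hfm.map _
  obtain ⟨y, hy⟩ := hensel_root (k := k) F A B hFm (by
    rw [← natDegree_map_eq_of_injective hinj, hF, natDegree_map, hf]
    exact (minpoly.natDegree_pos hintg).ne') (by
    intro n
    obtain ⟨G, hG, r, hr⟩ := hlift n _ (Or.inl rfl)
    refine ⟨r, hr.trans ?_⟩
    congr 1
    apply hinj
    rw [hG, ← coeff_map, ← coeff_map, hF]) (by
    apply map_injective _ hinj
    simp only [Polynomial.map_add, Polynomial.map_mul, ← derivative_map, hF, hA, hB, Polynomial.map_one]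
    rw [derivative_map, ← Polynomial.map_mul, ← Polynomial.map_mul, ← Polynomial.map_add, hab, Polynomial.map_one])
  letI : Algebra (IntermediateField.adjoin k (Set.range s)) FF := ψ.toAlgebra
  have hyroot : aeval (algebraMap _ FF y) (minpoly (IntermediateField.adjoin k (Set.range s)) pb.gen) = 0 := by
    rw [← hf, aeval_def]
    change eval₂ ψ _ f = 0
    rw [← Polynomial.eval_map, ← hF, Polynomial.eval_map, eval₂_at_apply, hy.eq_zero, map_zero]
  let Φ : E →ₐ[IntermediateField.adjoin k (Set.range s)] FF := pb.lift _ hyroot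
  have hΦL : ∀ (x : E) (hx : x ∈ L), Φ x = algebraMap _ FF (PowerSeries.C (⟨x, hx⟩ : L)) := by
    intro x hx
    rw [← hψL x hx]
    exact Φ.commutes ⟨x, hLK hx⟩
  intro h P hP0 hPL hPh
  obtain ⟨Q, hQ⟩ : ∃ Q : L[X], Q.map (algebraMap L E) = P := by
    have : P ∈ lifts (algebraMap L E) := by
      rw [lifts_iff_coeff_lifts]
      intro n
      exact ⟨⟨_, hPL n⟩, rfl⟩
    exact (mem_lifts _).1 this
  have hQ0 : Q ≠ 0 := by rintro rfl; exact hP0 (by rw [← hQ, Polynomial.map_zero])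
  obtain ⟨c, hc⟩ := alg_const (Φ h) Q hQ0 (by
    have := congrArg Φ hPh
    rw [map_zero, ← hQ, Polynomial.eval_map] at this
    have h2 : Φ (eval₂ (algebraMap L E) h Q) = eval₂ ((Φ : E →+* FF).comp (algebraMap L E)) (Φ h) Q :=
      hom_eval₂ Q (algebraMap L E) (Φ : E →+* FF) h
    rw [h2] at this
    have h3 : (Φ : E →+* FF).comp (algebraMap L E) = (algebraMap (PowerSeries L) FF).comp PowerSeries.C := by
      ext x
      exact hΦL x.1 x.2
    rwa [h3] at this)
  have : Φ h = Φ (c : E) := by rw [hc, hΦL c c.2]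
  have := Φ.toRingHom.injective this
  rw [this]
  exact c.2

end Hensel

section Hom
open MvPolynomial
variable {k : Type v} [Field k] {ι : Type w}

theorem factor_const (D q R : MvPolynomial ι k) (m : ℕ) (hR : R.IsHomogeneous m) (hR0 : R ≠ 0) (e : D * q = R)
    (hD : constantCoeff D ≠ 0) : ∃ c : k, D = C c := by
  let h : MvPolynomial ι k →+* Polynomial (MvPolynomial ι k) := eval₂Hom (Polynomial.C.comp C) (fun i => Polynomial.C (X i) * Polynomial.X)
  have hhom : ∀ (P : MvPolynomial ι k) m, P.IsHomogeneous m → h P = Polynomial.C P * Polynomial.X ^ m := by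
    intro P m hP
    have : h P = ∑ d ∈ P.support, h (monomial d (P.coeff d)) := by
      conv_lhs => rw [P.as_sum]
      rw [map_sum]
    rw [this]
    conv_rhs => rw [P.as_sum, map_sum, Finset.sum_mul]
    refine Finset.sum_congr rfl fun d hd => ?_
    have hdm : d.degree = m := by
      have := hP (mem_support_iff.1 hd)
      rw [Finsupp.degree_eq_weight_one]; exact this
    rw [← hdm]
    simp only [h, coe_eval₂Hom, eval₂_monomial, RingHom.comp_apply]
    rw [monomial_eq, map_mul, mul_assoc]
    congr 1
    simp only [Finsupp.prod, Finsupp.degree_apply, map_prod, map_pow, mul_pow, Finset.prod_mul_distrib, Finset.prod_pow_eq_pow_sum]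
  have hev : ∀ P, (h P).eval 1 = P := by
    intro P
    have : (Polynomial.evalRingHom 1).comp h = RingHom.id _ := by
      apply ringHom_ext
      · intro r; simp [h]
      · intro i; simp [h]
    exact RingHom.congr_fun this P
  have hc0 : ∀ P, (h P).coeff 0 = C (constantCoeff P) := by
    intro P
    have : (Polynomial.constantCoeff).comp h = C.comp constantCoeff := by
      apply ringHom_ext
      · intro r; simp [h]
      · intro i; simp [h]
    exact RingHom.congr_fun this P
  have e2 : h D * h q = Polynomial.C R * Polynomial.X ^ m := by rw [← map_mul, e, hhom _ _ hR]
  have hne : Polynomial.C R * Polynomial.X ^ m ≠ 0 := 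
    mul_ne_zero (by rwa [Ne, Polynomial.C_eq_zero]) (pow_ne_zero _ Polynomial.X_ne_zero)
  have hD0 : h D ≠ 0 := by intro h0; rw [h0, zero_mul] at e2; exact hne e2.symm
  have hq0 : h q ≠ 0 := by intro h0; rw [h0, mul_zero] at e2; exact hne e2.symm
  have d1 : (h D).natDegree + (h q).natDegree = m := by
    rw [← Polynomial.natDegree_mul hD0 hq0, e2, Polynomial.natDegree_C_mul_X_pow _ _ hR0]
  have d2 : (h D).natTrailingDegree + (h q).natTrailingDegree = m := by
    rw [← Polynomial.natTrailingDegree_mul hD0 hq0, e2, Polynomial.C_mul_X_pow_eq_monomial, Polynomial.natTrailingDegree_monomial hR0]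
  have t1 := Polynomial.natTrailingDegree_le_natDegree (h D)
  have t2 := Polynomial.natTrailingDegree_le_natDegree (h q)
  have t3 : (h D).natTrailingDegree = 0 := by
    apply Nat.le_zero.1
    apply Polynomial.natTrailingDegree_le_of_ne_zero
    rw [hc0]
    simpa using hD
  have t4 : (h D).natDegree = 0 := by omega
  rw [Polynomial.natDegree_eq_zero] at t4
  obtain ⟨x, hx⟩ := t4
  refine ⟨constantCoeff D, ?_⟩
  rw [← hc0, ← hx, Polynomial.coeff_C_zero]
  have := hev D
  rw [← hx, Polynomial.eval_C] at this
  exact this.symm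

theorem totalDegree_shift_le (o : ι → k) (P : MvPolynomial ι k) : 
    (aeval (fun i => X i + C (o i)) P : MvPolynomial ι k).totalDegree ≤ P.totalDegree := by
  conv_lhs => rw [P.as_sum, map_sum]
  refine totalDegree_finsetSum_le fun d hd => ?_
  rw [aeval_monomial]
  refine (totalDegree_mul _ _).trans ?_
  rw [show (algebraMap k (MvPolynomial ι k)) = C from rfl, totalDegree_C, zero_add, Finsupp.prod]
  refine (totalDegree_finset_prod _ _).trans ?_
  refine le_trans ?_ (le_totalDegree hd)
  refine Finset.sum_le_sum fun i _ => ?_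
  refine (totalDegree_pow _ _).trans ?_
  have : (X i + C (o i) : MvPolynomial ι k).totalDegree ≤ 1 := by
    refine (totalDegree_add _ _).trans ?_
    simp [totalDegree_X]
  nlinarith

theorem exists_eval_ne [Infinite k] [Finite ι] (g : MvPolynomial ι k) (hg : g ≠ 0) : ∃ o : ι → k, eval o g ≠ 0 := by
  by_contra! h
  exact hg (MvPolynomial.funext (by simpa using h))

variable {E : Type u} [Field E] [Algebra k E]

def PrDeg (s : ι → E) (e : ℕ) (f : E) : Prop := ∃ (m : ℕ) (R Q : MvPolynomial ι k), R.IsHomogeneous m ∧ aeval s R ≠ 0 ∧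
  Q.totalDegree ≤ m + e ∧ aeval s R * f = aeval s Q

theorem PrDeg.add {s : ι → E} {e : ℕ} {f g : E} (hf : PrDeg (k := k) s e f) (hg : PrDeg (k := k) s e g) : PrDeg (k := k) s e (f + g) := by
  obtain ⟨m, R, Q, hR, h0, hQ, e1⟩ := hf
  obtain ⟨m', R', Q', hR', h0', hQ', e1'⟩ := hg
  refine ⟨m + m', R * R', R' * Q + R * Q', hR.mul hR', by rw [map_mul]; exact mul_ne_zero h0 h0', ?_, ?_⟩
  · refine (totalDegree_add _ _).trans (max_le ?_ ?_)
    · refine (totalDegree_mul _ _).trans ?_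
      have := hR'.totalDegree_le
      omega
    · refine (totalDegree_mul _ _).trans ?_
      have := hR.totalDegree_le
      omega
  · simp only [map_add, map_mul, ← e1, ← e1']; ring

theorem PrDeg_L (s : ι → E) (i0 : ι) (h0 : s i0 ≠ 0) (c : E)
    (hc : c ∈ IntermediateField.adjoin k (Set.range (fun i => s i / s i0))) :
    ∃ (m : ℕ) (R Q : MvPolynomial ι k), R.IsHomogeneous m ∧ aeval s R ≠ 0 ∧
      Q.IsHomogeneous m ∧ aeval s R * c = aeval s Q := by
  induction hc using IntermediateField.adjoin_induction with
  | mem x hx =>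
    obtain ⟨i, rfl⟩ := hx
    refine ⟨1, X i0, X i, isHomogeneous_X _ _, by simpa using h0, isHomogeneous_X _ _, ?_⟩
    simp only [aeval_X]; field_simp
  | algebraMap x => exact ⟨0, 1, C x, isHomogeneous_one _ _, by simp, isHomogeneous_C _ _, by simp⟩
  | add x y _ _ hx hy =>
    obtain ⟨m, R, Q, hR, h0, hQ, e1⟩ := hx
    obtain ⟨m', R', Q', hR', h0', hQ', e1'⟩ := hy
    refine ⟨m + m', R * R', Q * R' + R * Q', hR.mul hR', by rw [map_mul]; exact mul_ne_zero h0 h0', 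
      (hQ.mul hR').add (hR.mul hQ'), ?_⟩
    simp only [map_add, map_mul, ← e1, ← e1']; ring
  | inv x _ hx =>
    obtain ⟨m, R, Q, hR, h0, hQ, e1⟩ := hx
    by_cases hx0 : x = 0
    · exact ⟨0, 1, 0, isHomogeneous_one _ _, by simp, isHomogeneous_zero _ _ _, by simp [hx0]⟩
    · refine ⟨m, Q, R, hQ, ?_, hR, ?_⟩
      · rw [← e1]; exact mul_ne_zero h0 hx0
      · rw [← e1]; field_simp
  | mul x y _ _ hx hy =>
    obtain ⟨m, R, Q, hR, h0, hQ, e1⟩ := hx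
    obtain ⟨m', R', Q', hR', h0', hQ', e1'⟩ := hy
    refine ⟨m + m', R * R', Q * Q', hR.mul hR', by rw [map_mul]; exact mul_ne_zero h0 h0', hQ.mul hQ', ?_⟩
    simp only [map_mul, ← e1, ← e1']; ring

theorem PrDeg_poly (s : ι → E) (i0 : ι) (h0 : s i0 ≠ 0) (e : ℕ)
    (P : Polynomial (IntermediateField.adjoin k (Set.range (fun i => s i / s i0)))) 
    (hP : P ∈ Polynomial.degreeLT _ (e+1)) : PrDeg (k := k) s e (Polynomial.aeval (s i0) P) := by
  rw [Polynomial.aeval_eq_sum_range' (n := e + 1) (by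
    rw [Polynomial.mem_degreeLT] at hP
    by_cases h : P = 0
    · simp [h]
    · exact (Polynomial.natDegree_lt_iff_degree_lt h).2 hP)]
  have : ∀ n ≤ e + 1, PrDeg (k := k) s e (∑ i ∈ Finset.range n, P.coeff i • s i0 ^ i) := by
    intro n
    induction n with
    | zero => intro _; exact ⟨0, 1, 0, isHomogeneous_one _ _, by simp, by simp, by simp⟩
    | succ n ih =>
      intro hn
      rw [Finset.sum_range_succ]
      refine (ih (by omega)).add ?_
      obtain ⟨m, R, Q, hR, h0, hQ, e1⟩ := PrDeg_L s i0 h0 _ (P.coeff n).2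
      refine ⟨m, R, Q * X i0 ^ n, hR, h0, ?_, ?_⟩
      · refine (totalDegree_mul _ _).trans ?_
        have := hQ.totalDegree_le
        rw [totalDegree_X_pow]; omega
      · rw [Algebra.smul_def, map_mul, ← e1, map_pow, aeval_X, ← mul_assoc]; rfl
  exact this _ le_rfl

/-- Final descent : an element of `k(s)` having PrDeg after shifting by a general point is a polynomial. -/
theorem PrDeg_final (s : ι → E) (hs : AlgebraicIndependent k s) (f : E) (N D : MvPolynomial ι k) 
    (hND : IsRelPrime D N) (hf : aeval s D * f = aeval s N) (o : ι → k) (ho : eval o D ≠ 0) (e : ℕ)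
    (h : PrDeg (k := k) (fun i => s i - algebraMap k E (o i)) e f) : 
    ∃ P : MvPolynomial ι k, P.totalDegree ≤ e ∧ f = aeval s P := by
  obtain ⟨m, R, Q, hR, hR0, hQ, e1⟩ := h
  set s' := (fun i => s i - algebraMap k E (o i)) with hs'
  let sh : MvPolynomial ι k →ₐ[k] MvPolynomial ι k := aeval (fun i => X i + C (o i))
  let shi : MvPolynomial ι k →ₐ[k] MvPolynomial ι k := aeval (fun i => X i + C (- o i))
  have h1 : ∀ P, sh (shi P) = P := by
    intro P
    have : sh.comp shi = AlgHom.id k _ := by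
      apply algHom_ext; intro i; simp only [AlgHom.comp_apply, sh, shi, aeval_X, map_add, aeval_C]; simp
    exact DFunLike.congr_fun this P
  have h2 : ∀ P, shi (sh P) = P := by
    intro P
    have : shi.comp sh = AlgHom.id k _ := by
      apply algHom_ext; intro i; simp only [AlgHom.comp_apply, sh, shi, aeval_X, map_add, aeval_C]; simp
    exact DFunLike.congr_fun this P
  have h3 : ∀ P, aeval s (shi P) = aeval s' P := by
    intro P
    have : (aeval s).comp shi = aeval s' := by
      apply algHom_ext; intro i; simp [shi, hs', sub_eq_add_neg]
    exact DFunLike.congr_fun this P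
  have h4 : ∀ P, constantCoeff (sh P) = eval o P := by
    intro P
    have : constantCoeff.comp (sh : MvPolynomial ι k →+* MvPolynomial ι k) = eval o := by
      apply ringHom_ext
      · intro r; simp [sh]
      · intro i; simp [sh]
    exact RingHom.congr_fun this P
  have key : shi R * N = shi Q * D := by
    apply hs
    change aeval s _ = aeval s _
    rw [map_mul, map_mul, h3, h3, ← hf, ← e1]; ring
  have hdvd : D ∣ shi R := hND.dvd_of_dvd_mul_right (Dvd.intro_left _ key.symm)
  obtain ⟨q, hq⟩ := hdvd
  have hRne : R ≠ 0 := by rintro rfl; simp at hR0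
  obtain ⟨c, hc⟩ := factor_const (sh D) (sh q) R m hR hRne (by rw [← map_mul, ← hq, h1]) (by rwa [h4])
  have hDc : D = C c := by
    have := congrArg shi hc
    rw [h2] at this
    rw [this]; simp [shi]
  have hc0 : c ≠ 0 := by rintro rfl; rw [hDc] at ho; simp at ho
  have hfN : f = aeval s (C c⁻¹ * N) := by
    rw [map_mul, ← hf, hDc, aeval_C, aeval_C, ← mul_assoc, ← map_mul, inv_mul_cancel₀ hc0, map_one, one_mul]
  refine ⟨C c⁻¹ * N, ?_, hfN⟩
  set P := C c⁻¹ * N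
  have e3 : R * sh P = Q := by
    have : shi R * P = shi Q := by
      apply hs
      change aeval s _ = aeval s _
      rw [map_mul, h3, h3, ← hfN, e1]
    have := congrArg sh this
    rwa [map_mul, h1, h1] at this
  have e4 : (sh P).totalDegree ≤ e := by
    by_cases h0 : sh P = 0
    · rw [h0]; simp
    · rw [← e3, totalDegree_mul_of_isDomain hRne h0, hR.totalDegree hRne] at hQ
      omega
  rw [← h2 P]
  exact (totalDegree_shift_le _ _).trans e4
end Hom

section TF
open Polynomial

theorem PrDeg.mem {k E : Type u} [Field k] [Field E] [Algebra k E] {ι : Type} {s : ι → E} {e : ℕ} {f : E} (h : PrDeg (k := k) s e f) :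
    f ∈ IntermediateField.adjoin k (Set.range s) := by
  obtain ⟨m, R, Q, -, h0, -, e1⟩ := h
  have hm : ∀ P : MvPolynomial ι k, MvPolynomial.aeval s P ∈ IntermediateField.adjoin k (Set.range s) := by
    intro P
    apply IntermediateField.algebra_adjoin_le_adjoin
    rw [Algebra.adjoin_range_eq_range_aeval]
    exact ⟨P, rfl⟩
  have : f = MvPolynomial.aeval s Q / MvPolynomial.aeval s R := by
    rw [← e1]; field_simp
  rw [this]
  exact div_mem (hm _) (hm _)

/-- the frame `1, s, ζ` -/
def frame {E : Type u} [One E] {ι T : Type} (s : ι → E) (ζ : T → E) : Option (ι ⊕ T) → E := fun o => o.elim 1 (Sum.elim s ζ)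

theorem range_frame {E : Type u} [One E] {ι T : Type} (s : ι → E) (ζ : T → E) : 
    Set.range (frame s ζ) = insert 1 (Set.range s ∪ Set.range ζ) := by
  ext x
  constructor
  · rintro ⟨(_ | (i | i)), rfl⟩ <;> simp [frame]
  · rintro (rfl | ⟨i, rfl⟩ | ⟨i, rfl⟩)
    · exact ⟨none, rfl⟩
    · exact ⟨some (Sum.inl i), rfl⟩
    · exact ⟨some (Sum.inr i), rfl⟩

open scoped IntermediateField.algebraAdjoinAdjoin in
theorem trans_L {k E : Type u} [Field k] [Field E] [Algebra k E] {ι : Type} [Fintype ι]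
    (s : ι → E) (hs : AlgebraicIndependent k s) (i0 : ι) : 
    Transcendental (IntermediateField.adjoin k (Set.range (fun i => s i / s i0))) (s i0) := by
  classical
  have h0 : s i0 ≠ 0 := hs.ne_zero i0
  obtain ⟨hx, -⟩ := algInd_mob s hs i0
  have h2 := hx.transcendental_adjoin (s := {i | i ≠ i0}) (i := i0) (by simp)
  simp only [if_true] at h2
  set x := (fun i => if i = i0 then (s i0)⁻¹ else s i / s i0) with hxd
  have hA : IntermediateField.adjoin k (Set.range (fun i => s i / s i0)) = IntermediateField.adjoin k (x '' {i | i ≠ i0}) := by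
    apply le_antisymm
    · rw [IntermediateField.adjoin_le_iff]
      rintro _ ⟨i, rfl⟩
      by_cases h : i = i0
      · simp only [h, div_self h0]; exact one_mem _
      · exact IntermediateField.subset_adjoin _ _ ⟨i, h, by simp [hxd, h]⟩
    · rw [IntermediateField.adjoin_le_iff]
      rintro _ ⟨i, hi, rfl⟩
      have hi' : i ≠ i0 := hi
      exact IntermediateField.subset_adjoin _ _ ⟨i, by simp [hxd, hi']⟩
  rw [hA]
  intro h3
  have h4 : IsAlgebraic (IntermediateField.adjoin k (x '' {i | i ≠ i0})) (s i0)⁻¹ := h3.inv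
  apply h2
  exact (IsFractionRing.isAlgebraic_iff _ _ _).2 h4

theorem T_at_0 {k E : Type u} [Field k] [Field E] [Algebra k E] {ι T : Type} [Fintype ι] [Fintype T]
    (s : ι → E) (hs : AlgebraicIndependent k s) (i0 : ι) 
    (hAC : ACl (IntermediateField.adjoin k (Set.range (fun i => s i / s i0)) : Set E))
    (ζ : T → E) (hw : LinearIndependent k (frame s ζ)) (M : ℕ) 
    (hM : (Submodule.span k (Set.range (frame s ζ)))^(M+1) ≤ 
      Submodule.span k (insert 1 (Set.range s)) * (Submodule.span k (Set.range (frame s ζ)))^M) :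
    (∀ (c0 : E) (c : T → E), c0 ∈ IntermediateField.adjoin k (Set.range s) → (∀ i, c i ∈ IntermediateField.adjoin k (Set.range s)) → 
      c0 + ∑ i, c i * ζ i = 0 → c0 = 0 ∧ ∀ i, c i = 0) ∧ 
    ((∀ v : Option (Option T) → E, ∃ c : Option (Option T) → E, (∀ j, c j ∈ IntermediateField.adjoin k (Set.range s)) ∧ 
      (∃ j, c j ≠ 0) ∧ ∑ j, c j * v j = 0) → 
     ∀ a b, ∃ (f0 : E) (f : T → E), PrDeg (k := k) s 2 f0 ∧ (∀ i, PrDeg (k := k) s 1 (f i)) ∧ 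
       ζ a * ζ b = f0 + ∑ i, f i * ζ i) := by
  classical
  have h0 : s i0 ≠ 0 := hs.ne_zero i0
  set L := IntermediateField.adjoin k (Set.range (fun i => s i / s i0)) with hL
  have htL : ∀ i, s i / s i0 ∈ L := fun i => IntermediateField.subset_adjoin _ _ ⟨i, rfl⟩
  have htr : Transcendental L (s i0) := trans_L s hs i0
  have hsm : ∀ i, s i = (⟨s i / s i0, htL i⟩ : L) • s i0 := by
    intro i; rw [Algebra.smul_def]; change _ = s i / s i0 * s i0; field_simp
  set W := Submodule.span L (insert 1 (insert (s i0) (Set.range ζ))) with hW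
  have hspan : Submodule.span L (Set.range (frame s ζ)) = W := by
    rw [range_frame]
    apply le_antisymm
    · rw [Submodule.span_le]
      rintro _ (rfl | ⟨i, rfl⟩ | ⟨i, rfl⟩)
      · exact Submodule.subset_span (by simp)
      · rw [hsm i]; exact Submodule.smul_mem _ _ (Submodule.subset_span (by simp))
      · exact Submodule.subset_span (by simp)
    · apply Submodule.span_mono
      rintro _ (rfl | rfl | ⟨i, rfl⟩) <;> simp
  have hspan2 : Submodule.span L (insert 1 (Set.range s)) = Submodule.span L {1, s i0} := by
    apply le_antisymm
    · rw [Submodule.span_le]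
      rintro _ (rfl | ⟨i, rfl⟩)
      · exact Submodule.subset_span (by simp)
      · rw [hsm i]; exact Submodule.smul_mem _ _ (Submodule.subset_span (by simp))
    · apply Submodule.span_mono
      rintro _ (rfl | rfl) <;> simp
  have hle : ∀ X : Set E, Submodule.span k X ≤ (Submodule.span L X).restrictScalars k := fun X =>
    Submodule.span_le.2 Submodule.subset_span
  have hM' : W^(M+1) ≤ Submodule.span L {1, s i0} * W^M := by
    rw [← hspan, ← hspan2, Submodule.span_pow, Submodule.span_pow, Submodule.span_mul_span, Submodule.span_le]
    rw [Submodule.span_pow, Submodule.span_pow, Submodule.span_mul_span] at hM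
    intro x hx
    exact hle _ (hM (Submodule.subset_span hx))
  have hAC' : ACl (Set.range (algebraMap L E)) := by
    have : Set.range (algebraMap L E) = (L : Set E) := by
      ext x; constructor
      · rintro ⟨y, rfl⟩; exact y.2
      · intro h; exact ⟨⟨x, h⟩, rfl⟩
    rw [this]; exact hAC
  have hind : ∀ (c0 c1 : L) (c : T → L), algebraMap L E c0 + c1 • s i0 + ∑ i, c i • ζ i = 0 → c0 = 0 ∧ c1 = 0 ∧ ∀ i, c i = 0 := by
    intro c0 c1 c hrel
    have main := nd_induct (Nat.card ι - 1) (k := k) (E := E) (ι := ι) (J := Option (ι ⊕ T)) 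
      (by have : 0 < Nat.card ι := Nat.card_pos_iff.2 ⟨⟨i0⟩, inferInstance⟩
          omega) s hs i0 hAC (frame s ζ) hw (fun i => some (Sum.inl i)) (fun i => rfl) 
      (Submodule.subset_span ⟨none, rfl⟩) M hM 
      (fun o => o.elim (c0 : E) (Sum.elim (fun i => if i = i0 then (c1 : E) else 0) (fun i => (c i : E)))) 
      (by
        rintro (_ | (i | i))
        · exact c0.2
        · simp only [Option.elim, Sum.elim_inl]
          split_ifs
          · exact c1.2
          · exact zero_mem _
        · exact (c i).2)
      (by intro i hi; simp [hi]) 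
      (by
        refine Eq.trans ?_ hrel
        simp [Fintype.sum_option, Fintype.sum_sum_type, frame, Algebra.smul_def, add_assoc])
    refine ⟨Subtype.ext (main none), Subtype.ext ?_, fun i => Subtype.ext (main (some (Sum.inr i)))⟩
    have := main (some (Sum.inl i0))
    simpa using this
  have hKL : ∀ x, x ∈ IntermediateField.adjoin k (Set.range s) → x ∈ IntermediateField.adjoin L {s i0} := by
    intro x hx
    have : IntermediateField.adjoin k (Set.range s) ≤ (IntermediateField.adjoin L {s i0}).restrictScalars k := by
      rw [IntermediateField.adjoin_le_iff]
      rintro _ ⟨i, rfl⟩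
      change s i ∈ IntermediateField.adjoin L {s i0}
      have e1 : s i = algebraMap L E ⟨s i / s i0, htL i⟩ * s i0 := by
        change _ = s i / s i0 * s i0; field_simp
      rw [e1]
      exact mul_mem (IntermediateField.algebraMap_mem _ _) (IntermediateField.subset_adjoin _ _ rfl)
    exact this hx
  constructor
  · intro c0 c hc0 hc hrel
    exact T3_a htr ζ W hW M hM' hAC' hind c0 c (hKL _ hc0) (fun i => hKL _ (hc i)) hrel
  · intro hdim a b
    have hζW : ∀ i, ζ i ∈ W := by intro i; rw [hW]; exact Submodule.subset_span (by simp)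
    have hab : ζ a * ζ b ∈ W ^ (0 + 2) := by
      rw [zero_add, pow_two]; exact Submodule.mul_mem_mul (hζW a) (hζW b)
    obtain ⟨P0, P, hP0, hP, e⟩ := T3_b htr ζ W hW M hM' hAC' hind (by
      intro v
      obtain ⟨c, h1, h2, h3⟩ := hdim v
      exact ⟨c, fun j => hKL _ (h1 j), h2, h3⟩) 2 (ζ a * ζ b) 0 hab (by rw [pow_zero, one_mul]; exact hab)
    exact ⟨_, _, PrDeg_poly s i0 h0 2 P0 hP0, fun i => PrDeg_poly s i0 h0 1 (P i) (hP i), e⟩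
end TF

section TM
open Polynomial

theorem exists_frac {k E : Type u} [Field k] [Field E] [Algebra k E] {ι : Type} (s : ι → E) (hs : AlgebraicIndependent k s) (c : E)
    (hc : c ∈ IntermediateField.adjoin k (Set.range s)) : 
    ∃ N D : MvPolynomial ι k, D ≠ 0 ∧ IsRelPrime D N ∧ MvPolynomial.aeval s D * c = MvPolynomial.aeval s N := by
  obtain ⟨x, hx, y, hy, e⟩ := IntermediateField.mem_adjoin_iff_div.1 hc
  rw [Algebra.adjoin_range_eq_range_aeval] at hx hy
  obtain ⟨P, rfl⟩ := hx
  obtain ⟨Q, rfl⟩ := hy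
  have hinj : Function.Injective (MvPolynomial.aeval (R := k) s) := hs
  by_cases hQ : Q = 0
  · refine ⟨0, 1, one_ne_zero, isRelPrime_one_left, ?_⟩
    rw [e, hQ]; simp
  obtain ⟨D, N, c', h1, h2, h3⟩ := UniqueFactorizationMonoid.exists_reduced_factors Q hQ P
  have hc' : c' ≠ 0 := by rintro rfl; rw [zero_mul] at h2; exact hQ h2.symm
  have hD : D ≠ 0 := by rintro rfl; rw [mul_zero] at h2; exact hQ h2.symm
  refine ⟨N, D, hD, h1, ?_⟩
  have hc2 : MvPolynomial.aeval s c' ≠ 0 := by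
    rw [← map_zero (MvPolynomial.aeval (R := k) s)]; exact hinj.ne hc'
  have hD2 : MvPolynomial.aeval s D ≠ 0 := by
    rw [← map_zero (MvPolynomial.aeval (R := k) s)]; exact hinj.ne hD
  have e : c = MvPolynomial.aeval s P / MvPolynomial.aeval s Q := e
  rw [e, ← h2, ← h3]
  simp only [map_mul]
  field_simp

theorem span_shift_le {k E : Type u} [Field k] [Field E] [Algebra k E] {ι : Type} (s : ι → E) (o : ι → k) (X : Set E) :
    Submodule.span k (insert 1 (Set.range (fun i => s i - algebraMap k E (o i)) ∪ X)) ≤ Submodule.span k (insert 1 (Set.range s ∪ X)) := by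
  rw [Submodule.span_le]
  have h1 : (1 : E) ∈ Submodule.span k (insert 1 (Set.range s ∪ X)) := Submodule.subset_span (by simp)
  rintro _ (rfl | ⟨i, rfl⟩ | h)
  · exact h1
  · refine Submodule.sub_mem _ (Submodule.subset_span (by simp)) ?_
    rw [Algebra.algebraMap_eq_smul_one]
    exact Submodule.smul_mem _ _ h1
  · exact Submodule.subset_span (by simp [h])

theorem span_shift {k E : Type u} [Field k] [Field E] [Algebra k E] {ι : Type} (s : ι → E) (o : ι → k) (X : Set E) :
    Submodule.span k (insert 1 (Set.range (fun i => s i - algebraMap k E (o i)) ∪ X)) = Submodule.span k (insert 1 (Set.range s ∪ X)) := by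
  refine le_antisymm (span_shift_le s o X) ?_
  have := span_shift_le (fun i => s i - algebraMap k E (o i)) (fun i => - o i) X
  simpa using this

theorem adjoin_shift {k E : Type u} [Field k] [Field E] [Algebra k E] {ι : Type} (s : ι → E) (o : ι → k) :
    IntermediateField.adjoin k (Set.range (fun i => s i - algebraMap k E (o i))) = IntermediateField.adjoin k (Set.range s) := by
  apply le_antisymm
  · rw [IntermediateField.adjoin_le_iff]
    rintro _ ⟨i, rfl⟩
    exact sub_mem (IntermediateField.subset_adjoin _ _ ⟨i, rfl⟩) (IntermediateField.algebraMap_mem _ _)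
  · rw [IntermediateField.adjoin_le_iff]
    rintro _ ⟨i, rfl⟩
    have := add_mem (IntermediateField.subset_adjoin k (Set.range (fun i => s i - algebraMap k E (o i))) ⟨i, rfl⟩) (IntermediateField.algebraMap_mem (IntermediateField.adjoin k (Set.range (fun i => s i - algebraMap k E (o i)))) (o i))
    simpa using this

theorem T_at_o {k E : Type u} [Field k] [IsAlgClosed k] [Field E] [Algebra k E] {ι T : Type} [Fintype ι] [Nonempty ι] [Fintype T]
    (s : ι → E) (hs : AlgebraicIndependent k s)
    (K : IntermediateField k E) (hK : K = IntermediateField.adjoin k (Set.range s)) [FiniteDimensional K E] [Algebra.IsSeparable K E]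
    (hfin : Module.finrank K E ≤ Fintype.card T + 1)
    (ζ : T → E) (hw : LinearIndependent k (frame s ζ)) (M : ℕ) 
    (hM : (Submodule.span k (Set.range (frame s ζ)))^(M+1) ≤ 
      Submodule.span k (insert 1 (Set.range s)) * (Submodule.span k (Set.range (frame s ζ)))^M) :
    ∃ g : MvPolynomial ι k, g ≠ 0 ∧ ∀ o : ι → k, MvPolynomial.eval o g ≠ 0 → 
    (∀ (c0 : E) (c : T → E), c0 ∈ K → (∀ i, c i ∈ K) → 
      c0 + ∑ i, c i * ζ i = 0 → c0 = 0 ∧ ∀ i, c i = 0) ∧ 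
     ∀ a b, ∃ (f0 : E) (f : T → E), PrDeg (k := k) (fun i => s i - algebraMap k E (o i)) 2 f0 ∧ 
      (∀ i, PrDeg (k := k) (fun i => s i - algebraMap k E (o i)) 1 (f i)) ∧ 
       ζ a * ζ b = f0 + ∑ i, f i * ζ i := by
  classical
  obtain ⟨pb⟩ : Nonempty (PowerBasis K E) := ⟨Field.powerBasisOfFiniteOfSeparable K E⟩
  have hsep : (minpoly K pb.gen).Separable := Algebra.IsSeparable.isSeparable K pb.gen
  obtain ⟨a, b, hab⟩ := hsep
  obtain ⟨f, hf⟩ : ∃ f, f = minpoly K pb.gen := ⟨_, rfl⟩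
  rw [← hf] at hab
  have hfr : ∀ c : K, ∃ N D : MvPolynomial ι k, D ≠ 0 ∧ MvPolynomial.aeval s D * (c : E) = MvPolynomial.aeval s N := by
    intro c
    obtain ⟨N, D, h1, -, h3⟩ := exists_frac s hs c (by rw [← hK]; exact c.2)
    exact ⟨N, D, h1, h3⟩
  choose num den hden hnum using hfr
  let Fs : Finset K := {0} ∪ f.coeffs ∪ a.coeffs ∪ b.coeffs
  refine ⟨∏ c ∈ Fs, den c, Finset.prod_ne_zero_iff.2 fun c _ => hden c, ?_⟩
  intro o ho
  have ho' : ∀ c ∈ Fs, MvPolynomial.eval o (den c) ≠ 0 := by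
    rw [map_prod] at ho
    exact Finset.prod_ne_zero_iff.1 ho
  have hmem : ∀ n, ∀ c : K, (c = f.coeff n ∨ c = a.coeff n ∨ c = b.coeff n) → c ∈ Fs := by
    intro n c hc
    by_cases h0 : c = 0
    · simp [Fs, h0]
    · simp only [Fs, Finset.mem_union]
      rcases hc with hc | hc | hc
      · left; left; right; rw [hc]; exact Polynomial.coeff_mem_coeffs (by rwa [← hc])
      · left; right; rw [hc]; exact Polynomial.coeff_mem_coeffs (by rwa [← hc])
      · right; rw [hc]; exact Polynomial.coeff_mem_coeffs (by rwa [← hc])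
  set s' := (fun i => s i - algebraMap k E (o i)) with hs'
  have hadj : IntermediateField.adjoin k (Set.range s') = K := by rw [hK]; exact adjoin_shift s o
  have hsind : AlgebraicIndependent k s' := by
    refine algInd_gen s s' hs ?_ ?_
    · intro i; rw [← hK, ← hadj]; exact IntermediateField.subset_adjoin _ _ ⟨i, rfl⟩
    · intro i; rw [hadj, hK]; exact IntermediateField.subset_adjoin _ _ ⟨i, rfl⟩
  let i0 : ι := Classical.arbitrary ι
  let sh : MvPolynomial ι k →ₐ[k] MvPolynomial ι k := MvPolynomial.aeval (fun i => MvPolynomial.X i + MvPolynomial.C (o i))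
  have hsh : ∀ P, MvPolynomial.aeval s' (sh P) = MvPolynomial.aeval s P := by
    intro P
    have : (MvPolynomial.aeval s').comp sh = MvPolynomial.aeval s := by
      apply MvPolynomial.algHom_ext; intro i
      simp only [AlgHom.comp_apply, sh, MvPolynomial.aeval_X, map_add, MvPolynomial.aeval_C, hs']
      ring
    exact DFunLike.congr_fun this P
  have hsh0 : ∀ P, MvPolynomial.constantCoeff (sh P) = MvPolynomial.eval o P := by
    intro P
    have : (MvPolynomial.constantCoeff).comp sh.toRingHom = MvPolynomial.eval o := by
      apply MvPolynomial.ringHom_ext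
      · intro r; simp [sh]
      · intro i; simp [sh]
    exact RingHom.congr_fun this P
  have hAC : ACl (IntermediateField.adjoin k (Set.range (fun i => s' i / s' i0)) : Set E) := by
    refine AC_hensel s' hsind i0 K hadj.symm pb f a b hf hab ?_
    intro n c hc
    refine ⟨sh (num c), sh (den c), ?_, ?_⟩
    · rw [hsh0]; exact ho' c (hmem n c hc)
    · rw [hsh, hsh]; exact hnum c
  have hsp : Submodule.span k (Set.range (frame s' ζ)) = Submodule.span k (Set.range (frame s ζ)) := by
    rw [range_frame, range_frame]; exact span_shift s o _
  have hsp2 : Submodule.span k (insert 1 (Set.range s')) = Submodule.span k (insert 1 (Set.range s)) := by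
    have := span_shift s o ∅
    simpa using this
  have hw' : LinearIndependent k (frame s' ζ) := by
    rw [linearIndependent_iff_card_eq_finrank_span] at hw ⊢
    rw [Set.finrank] at hw ⊢
    rw [hsp]; exact hw
  obtain ⟨r1, r2⟩ := T_at_0 s' hsind i0 hAC ζ hw' M (by rw [hsp, hsp2]; exact hM)
  rw [hadj] at r1 r2
  refine ⟨r1, r2 ?_⟩
  intro v
  have : ¬ LinearIndependent K v := by
    intro h
    have := h.fintype_card_le_finrank
    simp only [Fintype.card_option] at this
    omega
  rw [Fintype.not_linearIndependent_iff] at this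
  obtain ⟨c, h1, j, h2⟩ := this
  refine ⟨fun j => (c j : E), fun j => (c j).2, ⟨j, by simpa using h2⟩, h1⟩

theorem T_main {k E : Type u} [Field k] [IsAlgClosed k] [Field E] [Algebra k E] {ι T : Type} [Fintype ι] [Nonempty ι] [Fintype T]
    (s : ι → E) (hs : AlgebraicIndependent k s)
    (K : IntermediateField k E) (hK : K = IntermediateField.adjoin k (Set.range s)) [FiniteDimensional K E] [Algebra.IsSeparable K E]
    (hfin : Module.finrank K E ≤ Fintype.card T + 1)
    (ζ : T → E) (hw : LinearIndependent k (frame s ζ)) (M : ℕ) 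
    (hM : (Submodule.span k (Set.range (frame s ζ)))^(M+1) ≤ 
      Submodule.span k (insert 1 (Set.range s)) * (Submodule.span k (Set.range (frame s ζ)))^M) :
    (∀ (c0 : E) (c : T → E), c0 ∈ K → (∀ i, c i ∈ K) → 
      c0 + ∑ i, c i * ζ i = 0 → c0 = 0 ∧ ∀ i, c i = 0) ∧ 
     ∀ a b, ∃ (f0 : MvPolynomial ι k) (f : T → MvPolynomial ι k), f0.totalDegree ≤ 2 ∧ (∀ i, (f i).totalDegree ≤ 1) ∧
       ζ a * ζ b = MvPolynomial.aeval s f0 + ∑ i, MvPolynomial.aeval s (f i) * ζ i := by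
  classical
  haveI : Infinite k := IsAlgClosed.instInfinite
  obtain ⟨g, hg, H⟩ := T_at_o s hs K hK hfin ζ hw M hM
  obtain ⟨o1, ho1⟩ := exists_eval_ne g hg
  obtain ⟨r1, r2⟩ := H o1 ho1
  refine ⟨r1, ?_⟩
  intro a b
  obtain ⟨f0, f, hf0, hf, e⟩ := r2 a b
  have hf0' := hf0.mem
  have hf' := fun i => (hf i).mem
  rw [adjoin_shift] at hf0'
  simp only [adjoin_shift] at hf'
  obtain ⟨N0, D0, h1, h2, h3⟩ := exists_frac s hs f0 hf0'
  choose N D h4 h5 h6 using fun i => exists_frac s hs (f i) (hf' i)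
  have hg2 : g * (D0 * ∏ i, D i) ≠ 0 := mul_ne_zero hg (mul_ne_zero h1 (Finset.prod_ne_zero_iff.2 fun i _ => h4 i))
  obtain ⟨o, ho⟩ := exists_eval_ne _ hg2
  simp only [map_mul, map_prod, mul_ne_zero_iff, Finset.prod_ne_zero_iff] at ho
  obtain ⟨hog, hoD0, hoD⟩ := ho
  obtain ⟨-, r3⟩ := H o hog
  obtain ⟨f0', f', hf0'', hf'', e'⟩ := r3 a b
  have hm0 := hf0''.mem
  have hm := fun i => (hf'' i).mem
  rw [adjoin_shift] at hm0
  simp only [adjoin_shift] at hm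
  rw [← hK] at hm0 hf0'
  simp only [← hK] at hm hf'
  have huniq := r1 (f0' - f0) (fun i => f' i - f i) (sub_mem hm0 hf0') (fun i => sub_mem (hm i) (hf' i)) (by
    simp only [sub_mul, Finset.sum_sub_distrib]
    have := e'.symm.trans e
    linear_combination this)
  have u0 : f0' = f0 := sub_eq_zero.1 huniq.1
  have ui : ∀ i, f' i = f i := fun i => sub_eq_zero.1 (huniq.2 i)
  rw [u0] at hf0''
  simp only [ui] at hf''
  obtain ⟨P0, hP0, e0⟩ := PrDeg_final s hs f0 N0 D0 h2 h3 o hoD0 2 hf0''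
  choose P hP ei using fun i => PrDeg_final s hs (f i) (N i) (D i) (h5 i) (h6 i) o (hoD i (Finset.mem_univ _)) 1 (hf'' i)
  refine ⟨P0, P, hP0, hP, ?_⟩
  rw [e, e0]
  simp only [← ei]

end TM

section AV

theorem avoid_step {k R : Type u} [Field k] [Infinite k] [CommRing R] [IsNoetherianRing R] [Algebra k R]
    (U : Submodule k R) (J : Ideal R) (c : ℕ∞)
    (hc : ∀ Q : Ideal R, Q.IsPrime → J ≤ Q → ¬ U ≤ Q.restrictScalars k → c ≤ Q.height) (H : Submodule k R) :
    ∃ u ∈ U, (U ≤ H ∨ u ∉ H) ∧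
      ∀ Q : Ideal R, Q.IsPrime → J ⊔ Ideal.span {u} ≤ Q → ¬ U ≤ Q.restrictScalars k → c + 1 ≤ Q.height := by
  classical
  let F : Set (Submodule k U) := {P | P ≠ ⊤ ∧ (P = H.comap U.subtype ∨ ∃ Q ∈ J.minimalPrimes, P = (Q.restrictScalars k).comap U.subtype)}
  have hF : F.Finite := by
    have h1 : ((fun Q : Ideal R => (Q.restrictScalars k).comap U.subtype) '' J.minimalPrimes).Finite :=
      (J.finite_minimalPrimes_of_isNoetherianRing).image _
    refine (h1.insert (H.comap U.subtype)).subset ?_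
    rintro P ⟨-, h | ⟨Q, hQ, h⟩⟩
    · exact Or.inl h
    · exact Or.inr ⟨Q, hQ, h.symm⟩
  have hne := Subspace.biUnion_ne_univ_of_top_notMem (k := k) (s := hF.toFinset) (by simp [F])
  obtain ⟨⟨u, hu⟩, hu2⟩ := (Set.ne_univ_iff_exists_notMem _).1 hne
  simp only [Set.mem_iUnion, not_exists] at hu2
  refine ⟨u, hu, ?_, ?_⟩
  · by_cases h : U ≤ H
    · exact Or.inl h
    right
    intro huH
    refine hu2 (H.comap U.subtype) (hF.mem_toFinset.2 ⟨?_, Or.inl rfl⟩) huH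
    intro ht
    exact h (fun x hx => by
      have : (⟨x, hx⟩ : U) ∈ H.comap U.subtype := by rw [ht]; trivial
      exact this)
  · intro Q hQ hJ hU
    obtain ⟨Q', hQ', hle⟩ := Ideal.exists_minimalPrimes_le (le_sup_left.trans hJ)
    have : Q'.IsPrime := hQ'.1.1
    have hU' : ¬ U ≤ Q'.restrictScalars k := fun h => hU (h.trans hle)
    have hlt : Q' < Q := by
      refine lt_of_le_of_ne hle ?_
      rintro rfl
      refine hu2 ((Q'.restrictScalars k).comap U.subtype) (hF.mem_toFinset.2 ⟨?_, Or.inr ⟨Q', hQ', rfl⟩⟩) ?_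
      · intro ht
        exact hU' (fun x hx => by
          have : (⟨x, hx⟩ : U) ∈ (Q'.restrictScalars k).comap U.subtype := by rw [ht]; trivial
          exact this)
      · exact hJ (Ideal.mem_sup_right (Ideal.mem_span_singleton_self u))
    exact (add_le_add_left (hc Q' this hQ'.1.2 hU') 1).trans (Ideal.height_add_one_le_of_lt_of_isPrime hlt)

theorem avoid_iter {k R : Type u} [Field k] [Infinite k] [CommRing R] [IsNoetherianRing R] [Algebra k R]
    (U : Submodule k R) (J : Ideal R) (c : ℕ∞)
    (hc : ∀ Q : Ideal R, Q.IsPrime → J ≤ Q → ¬ U ≤ Q.restrictScalars k → c ≤ Q.height) (H : Set R → Submodule k R) (r : ℕ) :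
    ∃ u : ℕ → R, (∀ i < r, u i ∈ U ∧ (U ≤ H (u '' Set.Iio i) ∨ u i ∉ H (u '' Set.Iio i))) ∧
      ∀ Q : Ideal R, Q.IsPrime → J ⊔ Ideal.span (u '' Set.Iio r) ≤ Q → ¬ U ≤ Q.restrictScalars k → c + r ≤ Q.height := by
  induction r with
  | zero => exact ⟨fun _ => 0, by simp, by simpa using hc⟩
  | succ r ih =>
    obtain ⟨u, hu, hQ⟩ := ih
    obtain ⟨v, hv, hvH, hvQ⟩ := avoid_step U _ _ hQ (H (u '' Set.Iio r))
    have him : ∀ i ≤ r, (Function.update u r v) '' Set.Iio i = u '' Set.Iio i := by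
      intro i hi
      refine Set.image_congr ?_
      intro a ha
      rw [Function.update_of_ne]
      have : a < i := ha
      omega
    refine ⟨Function.update u r v, ?_, ?_⟩
    · intro i hi
      rw [him i (by omega)]
      rcases Nat.lt_succ_iff_lt_or_eq.1 hi with h | rfl
      · rw [Function.update_of_ne (by omega)]
        exact hu i h
      · rw [Function.update_self]
        exact ⟨hv, hvH⟩
    · intro Q hQp hle hUQ
      have h1 : (Function.update u r v) '' Set.Iio (r+1) = insert v (u '' Set.Iio r) := by
        have : Set.Iio (r+1) = insert r (Set.Iio r) := by ext x; simp
        rw [this, Set.image_insert_eq, him r le_rfl, Function.update_self]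
      rw [h1, Ideal.span_insert] at hle
      have := hvQ Q hQp (by
        rw [sup_assoc, sup_comm (Ideal.span (u '' _))]; exact hle) hUQ
      rw [add_assoc] at this
      exact_mod_cast this
end AV

section GR
open MvPolynomial

def HomI {k : Type u} [Field k] {σ : Type} (p : Ideal (MvPolynomial σ k)) : Prop :=
  ∀ f ∈ p, ∀ n, homogeneousComponent n f ∈ p

theorem hcomp_mul {k : Type u} [Field k] {σ : Type} (a g : MvPolynomial σ k) (e : ℕ) (hg : g.IsHomogeneous e) (n : ℕ) :
    homogeneousComponent n (a * g) = if e ≤ n then homogeneousComponent (n - e) a * g else 0 := by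
  classical
  conv_lhs => rw [← sum_homogeneousComponent a]
  rw [Finset.sum_mul, map_sum]
  have h1 : ∀ i, homogeneousComponent n (homogeneousComponent i a * g) = if i + e = n then homogeneousComponent i a * g else 0 := by
    intro i
    rw [homogeneousComponent_of_mem (m := n) (n := i + e)]
    · simp only [eq_comm]
    · exact (homogeneousComponent_isHomogeneous i a).mul hg
  simp only [h1]
  split_ifs with h
  · rw [Finset.sum_eq_single (n - e)]
    · rw [if_pos (by omega)]
    · intro b _ hb
      rw [if_neg (by omega)]
    · intro hn
      rw [if_pos (by omega), homogeneousComponent_eq_zero _ _ (by simp at hn; omega), zero_mul]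
  · refine Finset.sum_eq_zero ?_
    intro i _
    rw [if_neg (by omega)]

theorem hspan_coeff {k : Type u} [Field k] {σ : Type} {ι : Type} [Fintype ι] (g : ι → MvPolynomial σ k) (e : ι → ℕ) (hg : ∀ i, (g i).IsHomogeneous (e i))
    (n : ℕ) (s : MvPolynomial σ k) (hs : s.IsHomogeneous n) (hsg : s ∈ Ideal.span (Set.range g)) :
    ∃ a : ι → MvPolynomial σ k, (∀ i, (a i).IsHomogeneous (n - e i)) ∧ (∀ i, n < e i → a i = 0) ∧ s = ∑ i, a i * g i := by
  obtain ⟨c, rfl⟩ := (Ideal.mem_span_range_iff_exists_fun).1 hsg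
  refine ⟨fun i => if e i ≤ n then homogeneousComponent (n - e i) (c i) else 0, ?_, ?_, ?_⟩
  · intro i
    dsimp only
    split_ifs
    · exact homogeneousComponent_isHomogeneous _ _
    · exact isHomogeneous_zero _ _ _
  · intro i hi
    dsimp only
    rw [if_neg (by omega)]
  · have h1 := homogeneousComponent_eq_self (R := k) hs
    rw [← h1, map_sum]
    refine Finset.sum_congr rfl ?_
    intro i _
    rw [hcomp_mul _ _ _ (hg i)]
    split_ifs with h <;> simp [h]

attribute [local instance] MvPolynomial.gradedAlgebra in
theorem homI_of_minimal {k : Type u} [Field k] {σ : Type} (s : Set (MvPolynomial σ k)) (hs : ∀ f ∈ s, ∃ n, f.IsHomogeneous n)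
    (Q : Ideal (MvPolynomial σ k)) (hQ : Q ∈ (Ideal.span s).minimalPrimes) : HomI Q := by
  have hh : (Ideal.span s).IsHomogeneous (homogeneousSubmodule σ k) := by
    refine Ideal.homogeneous_span _ _ ?_
    intro x hx
    obtain ⟨n, h⟩ := hs x hx
    exact ⟨n, h⟩
  have h1 : (Q.homogeneousCore (homogeneousSubmodule σ k)).toIdeal.IsPrime := hQ.1.1.homogeneousCore
  have h2 : Ideal.span s ≤ (Q.homogeneousCore (homogeneousSubmodule σ k)).toIdeal := by
    rw [← hh.toIdeal_homogeneousCore_eq_self]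
    exact Ideal.homogeneousCore_mono _ hQ.1.2
  have h3 := Ideal.toIdeal_homogeneousCore_le (homogeneousSubmodule σ k) Q
  have h4 := hQ.2 ⟨h1, h2⟩ h3
  have h5 : Q.IsHomogeneous (homogeneousSubmodule σ k) := by
    rw [Ideal.IsHomogeneous.iff_eq]
    exact le_antisymm h3 h4
  intro f hf n
  exact homogeneousComponent_mem_of_mem h5 hf n

theorem rad_step {k : Type u} [Field k] {N : ℕ} (s : Set (MvPolynomial (Fin N) k)) (hs : ∀ f ∈ s, ∃ n, f.IsHomogeneous n)
    (hQ : ∀ Q : Ideal (MvPolynomial (Fin N) k), Q.IsPrime → Ideal.span s ≤ Q → 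
      ¬ homogeneousSubmodule (Fin N) k 1 ≤ Q.restrictScalars k → (N : ℕ∞) ≤ Q.height) :
    ∃ D : ℕ, ∀ n, D ≤ n → ∀ f : MvPolynomial (Fin N) k, f.IsHomogeneous n → f ∈ Ideal.span s := by
  classical
  have key : ∀ Q ∈ (Ideal.span s).minimalPrimes, homogeneousSubmodule (Fin N) k 1 ≤ Q.restrictScalars k := by
    intro Q hQm
    by_contra hcon
    have hQp : Q.IsPrime := hQm.1.1
    have hht := hQ Q hQp hQm.1.2 hcon
    have hhom := homI_of_minimal s hs Q hQm
    set m := RingHom.ker (constantCoeff : MvPolynomial (Fin N) k →+* k) with hm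
    have hmp : m.IsPrime := RingHom.ker_isPrime _
    have hle : Q ≤ m := by
      intro f hf
      have := hhom f hf 0
      rw [homogeneousComponent_zero] at this
      rw [hm, RingHom.mem_ker]
      by_contra h0
      apply hQp.ne_top
      refine Ideal.eq_top_of_isUnit_mem _ this ?_
      exact (isUnit_iff_ne_zero.2 h0).map C
    have hlt : Q < m := by
      refine lt_of_le_of_ne hle ?_
      rintro h
      apply hcon
      intro f hf
      rw [h]
      have h2 : homogeneousComponent 0 f = 0 := by
        rw [homogeneousComponent_of_mem hf]; simp
      rw [homogeneousComponent_zero] at h2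
      exact C_injective _ _ (by rw [C_0]; exact h2)
    have h3 := Ideal.height_add_one_le_of_lt_of_isPrime hlt
    have h4 : (m.height : WithBot ℕ∞) ≤ ringKrullDim (MvPolynomial (Fin N) k) := Ideal.height_le_ringKrullDim_of_isPrime
    rw [MvPolynomial.ringKrullDim_of_isNoetherianRing, ringKrullDim_eq_zero_of_field] at h4
    have h5 : m.height ≤ (N : ℕ∞) := by
      have : ((N : ℕ∞) : WithBot ℕ∞) = 0 + (Nat.card (Fin N) : WithBot ℕ∞) := by simp
      rw [← WithBot.coe_le_coe, this]
      exact h4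
    have h6 : (N : ℕ∞) + 1 ≤ N := (add_le_add_left hht 1).trans (h3.trans h5)
    have h7 : N + 1 ≤ N := by exact_mod_cast h6
    omega
  have hrad : Ideal.span (homogeneousSubmodule (Fin N) k 1 : Set (MvPolynomial (Fin N) k)) ≤ (Ideal.span s).radical := by
    rw [Ideal.span_le, ← Ideal.sInf_minimalPrimes]
    intro f hf
    simp only [SetLike.mem_coe, Submodule.mem_sInf]
    intro Q hQ
    exact key Q hQ hf
  obtain ⟨D, hD⟩ := Ideal.exists_pow_le_of_le_radical_of_fg hrad (IsNoetherian.noetherian _)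
  refine ⟨D, ?_⟩
  intro n hn f hf
  refine hD (Ideal.pow_le_pow_right hn ?_)
  have h1 : f ∈ homogeneousSubmodule (Fin N) k 1 ^ n := by rw [homogeneousSubmodule_one_pow]; exact hf
  have h2 : ∀ n : ℕ, homogeneousSubmodule (Fin N) k 1 ^ n ≤ (Ideal.span (homogeneousSubmodule (Fin N) k 1 : Set (MvPolynomial (Fin N) k)) ^ n).restrictScalars k := by
    intro n
    induction n with
    | zero => rw [pow_zero, pow_zero]; intro x _; simp
    | succ n ih =>
      rw [pow_succ, pow_succ, Submodule.mul_le]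
      intro a ha b hb
      exact Ideal.mul_mem_mul (ih ha) (Ideal.subset_span hb)
  exact h2 n h1
end GR

section FO
open MvPolynomial

theorem fin_over {k : Type u} [Field k] {N : ℕ} {ι : Type} [Fintype ι] (g : ι → MvPolynomial (Fin N) k) (e : ι → ℕ)
    (he : ∀ i, 0 < e i) (hg : ∀ i, (g i).IsHomogeneous (e i))
    (D : ℕ) (hD : ∀ n, D ≤ n → ∀ f : MvPolynomial (Fin N) k, f.IsHomogeneous n → f ∈ Ideal.span (Set.range g)) :
    (aeval g : MvPolynomial ι k →ₐ[k] MvPolynomial (Fin N) k).toRingHom.Finite := by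
  letI := (aeval g : MvPolynomial ι k →ₐ[k] MvPolynomial (Fin N) k).toRingHom.toAlgebra
  have hmap : ∀ x, algebraMap (MvPolynomial ι k) (MvPolynomial (Fin N) k) x = aeval g x := fun x => rfl
  haveI : IsScalarTower k (MvPolynomial ι k) (MvPolynomial (Fin N) k) := by
    refine IsScalarTower.of_algebraMap_eq ?_
    intro x
    rw [hmap, AlgHom.commutes]
  suffices Module.Finite (MvPolynomial ι k) (MvPolynomial (Fin N) k) from this
  let W : ℕ → Submodule (MvPolynomial ι k) (MvPolynomial (Fin N) k) := fun n => Submodule.span _ (homogeneousSubmodule (Fin N) k n : Set _)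
  have hW : ∀ n, (W n).FG := by
    intro n
    obtain ⟨t, ht⟩ := homogeneousSubmodule_fg (Fin N) k n
    refine ⟨t, le_antisymm (Submodule.span_mono ?_) (Submodule.span_le.2 ?_)⟩
    · rw [← ht]; exact Submodule.subset_span
    · rw [← ht]; exact Submodule.span_le_restrictScalars k (MvPolynomial ι k) _
  let V := ⨆ n ∈ Finset.range D, W n
  have hV : V.FG := Submodule.fg_biSup _ _ (fun i _ => hW i)
  have key : ∀ n, ∀ f : MvPolynomial (Fin N) k, f.IsHomogeneous n → f ∈ V := by
    intro n
    induction n using Nat.strong_induction_on with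
    | _ n ih =>
      intro f hf
      by_cases hn : n < D
      · have : W n ≤ V := le_iSup₂_of_le (f := fun n (_ : n ∈ Finset.range D) => W n) n (Finset.mem_range.2 hn) le_rfl
        exact this (Submodule.subset_span hf)
      · obtain ⟨a, ha, ha0, rfl⟩ := hspan_coeff g e hg n f hf (hD n (by omega) f hf)
        refine Submodule.sum_mem _ ?_
        intro i _
        by_cases hi : n < e i
        · rw [ha0 i hi, zero_mul]; exact Submodule.zero_mem _
        · have := Submodule.smul_mem V (X i) (ih (n - e i) (by have := he i; omega) (a i) (ha i))
          rw [Algebra.smul_def, hmap, aeval_X, mul_comm] at this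
          exact this
  refine ⟨?_⟩
  have : V = ⊤ := by
    rw [eq_top_iff]
    intro f _
    rw [← sum_homogeneousComponent f]
    exact Submodule.sum_mem _ (fun i _ => key i _ (homogeneousComponent_isHomogeneous _ _))
  rw [← this]; exact hV

theorem algInd_hsop {k : Type u} [Field k] {N : ℕ} {ι : Type} [Fintype ι] (hι : Fintype.card ι = N) (g : ι → MvPolynomial (Fin N) k) 
    (hfin : (aeval g : MvPolynomial ι k →ₐ[k] MvPolynomial (Fin N) k).toRingHom.Finite) :
    AlgebraicIndependent k g := by
  have hInt := hfin.to_isIntegral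
  have : Algebra.IsAlgebraic (Algebra.adjoin k (Set.range g)) (MvPolynomial (Fin N) k) := by
    have : Algebra.IsIntegral (Algebra.adjoin k (Set.range g)) (MvPolynomial (Fin N) k) := by
      constructor
      intro x
      obtain ⟨P, hP, hx⟩ := hInt x
      have hmem : ∀ c, (aeval g : MvPolynomial ι k →ₐ[k] MvPolynomial (Fin N) k) c ∈ Algebra.adjoin k (Set.range g) := by
        intro c
        rw [Algebra.adjoin_range_eq_range_aeval]; exact ⟨c, rfl⟩
      refine ⟨P.map ((aeval g : MvPolynomial ι k →ₐ[k] MvPolynomial (Fin N) k).codRestrict _ hmem).toRingHom, hP.map _, ?_⟩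
      rw [Polynomial.eval₂_map]
      exact hx
    infer_instance
  refine (Algebra.IsAlgebraic.isTranscendenceBasis_of_lift_le_trdeg_of_finite k g ?_).1
  rw [MvPolynomial.trdeg_of_isDomain]
  simp [hι]

/-- kill the variables in a finset. -/
noncomputable def killT (k : Type u) [Field k] {σ : Type} [DecidableEq σ] (T : Finset σ) : MvPolynomial σ k →ₐ[k] MvPolynomial σ k :=
  aeval (fun i => if i ∈ T then 0 else X i)

theorem killT_height (k : Type u) [Field k] {σ : Type} [DecidableEq σ] (T : Finset σ) :
    (T.card : ℕ∞) ≤ (RingHom.ker (killT k T)).height := by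
  induction T using Finset.induction_on with
  | empty => simp
  | insert i T hi ih =>
    rw [Finset.card_insert_of_notMem hi]
    have h1 : (RingHom.ker (killT k T)).IsPrime := RingHom.ker_isPrime _
    have h2 : (RingHom.ker (killT k (insert i T))).IsPrime := RingHom.ker_isPrime _
    have hlt : RingHom.ker (killT k T) < RingHom.ker (killT k (insert i T)) := by
      refine lt_of_le_of_ne ?_ ?_
      · intro f hf
        rw [RingHom.mem_ker] at hf ⊢
        have : killT k (insert i T) = (killT k (insert i T)).comp (killT k T) := by
          refine MvPolynomial.algHom_ext ?_
          intro j
          simp only [killT, AlgHom.comp_apply, aeval_X]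
          by_cases hj : j ∈ T <;> simp [hj]
        rw [this, AlgHom.comp_apply, hf, map_zero]
      · intro h
        have : (X i : MvPolynomial σ k) ∈ RingHom.ker (killT k T) := by
          rw [h, RingHom.mem_ker]; simp [killT]
        rw [RingHom.mem_ker] at this
        simp [killT, hi] at this
    push_cast
    exact (add_le_add_left ih 1).trans (Ideal.height_add_one_le_of_lt_of_isPrime hlt)

theorem algInd_mod {k : Type u} [Field k] {N d : ℕ} (q : Fin 3 → MvPolynomial (Fin N) k) (y : Fin d → MvPolynomial (Fin N) k)
    (hfin : (aeval (Sum.elim q y) : MvPolynomial (Fin 3 ⊕ Fin d) k →ₐ[k] MvPolynomial (Fin N) k).toRingHom.Finite)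
    (hN : 3 + d = N) (p : Ideal (MvPolynomial (Fin N) k)) [hp : p.IsPrime] (hqp : ∀ i, q i ∈ p) (hht : p.height ≤ 3)
    (G : MvPolynomial (Fin d) k) (hG : aeval y G ∈ p) : G = 0 := by
  classical
  by_contra hG0
  have hinj : AlgebraicIndependent k (Sum.elim q y) := algInd_hsop (by simpa using hN) _ hfin
  letI := (aeval (Sum.elim q y) : MvPolynomial (Fin 3 ⊕ Fin d) k →ₐ[k] MvPolynomial (Fin N) k).toRingHom.toAlgebra
  have hmap : ∀ x, algebraMap (MvPolynomial (Fin 3 ⊕ Fin d) k) (MvPolynomial (Fin N) k) x = aeval (Sum.elim q y) x := fun x => rfl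
  haveI : Module.Finite (MvPolynomial (Fin 3 ⊕ Fin d) k) (MvPolynomial (Fin N) k) := hfin
  haveI : FaithfulSMul (MvPolynomial (Fin 3 ⊕ Fin d) k) (MvPolynomial (Fin N) k) := by
    rw [faithfulSMul_iff_algebraMap_injective]
    exact hinj
  have hgd : Algebra.HasGoingDown (MvPolynomial (Fin 3 ⊕ Fin d) k) (MvPolynomial (Fin N) k) := inferInstance
  have h1 := Ideal.height_eq_height_add_of_liesOver_of_hasGoingDown (p.under (MvPolynomial (Fin 3 ⊕ Fin d) k)) p
  have h2 : (p.under (MvPolynomial (Fin 3 ⊕ Fin d) k)).height ≤ 3 := (le_self_add.trans h1.symm.le).trans hht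
  let T : Finset (Fin 3 ⊕ Fin d) := Finset.univ.image Sum.inl
  have hTc : T.card = 3 := by
    simp [T, Finset.card_image_of_injective _ Sum.inl_injective]
  have h3 := killT_height k T
  rw [hTc] at h3
  have hker : ∀ F : MvPolynomial (Fin 3 ⊕ Fin d) k, killT k T F = 0 → aeval (Sum.elim q y) F ∈ p := by
    intro F hF
    have : (Ideal.Quotient.mkₐ k p).comp (aeval (Sum.elim q y)) = ((Ideal.Quotient.mkₐ k p).comp (aeval (Sum.elim q y))).comp (killT k T) := by
      refine MvPolynomial.algHom_ext ?_
      rintro (j | j)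
      · simp only [killT, AlgHom.comp_apply, aeval_X, T]
        simp [Ideal.Quotient.eq_zero_iff_mem, hqp]
      · simp [killT, T]
    have h := DFunLike.congr_fun this F
    simp only [AlgHom.comp_apply, hF, map_zero] at h
    exact Ideal.Quotient.eq_zero_iff_mem.1 h
  have hp1 : (RingHom.ker (killT k T)).IsPrime := RingHom.ker_isPrime _
  have hlt : RingHom.ker (killT k T) < p.under (MvPolynomial (Fin 3 ⊕ Fin d) k) := by
    refine lt_of_le_of_ne ?_ ?_
    · intro F hF
      exact hker F hF
    · intro h
      have : rename Sum.inr G ∈ p.under (MvPolynomial (Fin 3 ⊕ Fin d) k) := by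
        change aeval (Sum.elim q y) (rename Sum.inr G) ∈ p
        rw [aeval_rename]
        exact hG
      rw [← h, RingHom.mem_ker] at this
      have e : killT k T (rename Sum.inr G) = rename Sum.inr G := by
        simp only [killT]
        rw [aeval_rename]
        have : ((fun i => if i ∈ T then 0 else X i) ∘ Sum.inr : Fin d → MvPolynomial (Fin 3 ⊕ Fin d) k) = X ∘ Sum.inr := by
          funext j; simp [T]
        rw [this]
        have e2 : (aeval (X ∘ Sum.inr) : MvPolynomial (Fin d) k →ₐ[k] MvPolynomial (Fin 3 ⊕ Fin d) k) = rename Sum.inr := by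
          refine MvPolynomial.algHom_ext ?_
          intro j; simp
        rw [e2]
      rw [e] at this
      exact hG0 (rename_injective _ Sum.inr_injective (by rw [this, map_zero]))
  have h4 := Ideal.height_add_one_le_of_lt_of_isPrime hlt
  have h5 : ((3:ℕ) : ℕ∞) + 1 ≤ 3 := (add_le_add_left h3 1).trans (h4.trans h2)
  have : 3 + 1 ≤ 3 := by exact_mod_cast h5
  omega
end FO

section P2
open MvPolynomial

theorem P2 {k : Type u} [Field k] [Infinite k] {N d : ℕ} (hN : 3 + d = N) {ι : Type} [Finite ι] (f : ι → MvPolynomial (Fin N) k)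
    (hf : ∀ i, (f i).IsHomogeneous 2)
    (hht : ∀ Q : Ideal (MvPolynomial (Fin N) k), Q.IsPrime → Ideal.span (Set.range f) ≤ Q → 3 ≤ Q.height)
    (H : Set (MvPolynomial (Fin N) k) → Submodule k (MvPolynomial (Fin N) k)) :
    ∃ y : ℕ → MvPolynomial (Fin N) k, (∀ i < d, (y i).IsHomogeneous 1 ∧ 
      (homogeneousSubmodule (Fin N) k 1 ≤ H (y '' Set.Iio i) ∨ y i ∉ H (y '' Set.Iio i))) ∧
      (∃ D, ∀ n, D ≤ n → ∀ s : MvPolynomial (Fin N) k, s.IsHomogeneous n → 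
        s ∈ Ideal.span (Set.range (Sum.elim f (fun i : Fin d => y i)))) ∧
      ∀ p : Ideal (MvPolynomial (Fin N) k), p.IsPrime → Ideal.span (Set.range f) ≤ p → p.height ≤ 3 → 
        ∀ G : MvPolynomial (Fin d) k, aeval (fun i : Fin d => y i) G ∈ p → G = 0 := by
  obtain ⟨q, hq, hqQ⟩ := avoid_iter (Submodule.span k (Set.range f)) ⊥ 0 (by intros; simp) (fun _ => ⊤) 3
  have hqI : ∀ i < 3, q i ∈ Ideal.span (Set.range f) := by
    intro i hi
    exact Submodule.span_le_restrictScalars k (MvPolynomial (Fin N) k) _ (hq i hi).1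
  have hqh : ∀ i < 3, (q i).IsHomogeneous 2 := by
    intro i hi
    have : Submodule.span k (Set.range f) ≤ homogeneousSubmodule (Fin N) k 2 := by
      rw [Submodule.span_le]; rintro _ ⟨i, rfl⟩; exact hf i
    exact this (hq i hi).1
  have hq3 : ∀ Q : Ideal (MvPolynomial (Fin N) k), Q.IsPrime → Ideal.span (q '' Set.Iio 3) ≤ Q → 3 ≤ Q.height := by
    intro Q hQ hle
    by_cases hU : Submodule.span k (Set.range f) ≤ Q.restrictScalars k
    · refine hht Q hQ ?_
      rw [Ideal.span_le]
      intro x hx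
      exact hU (Submodule.subset_span hx)
    · have := hqQ Q hQ (by rw [bot_sup_eq]; exact hle) hU
      simpa using this
  obtain ⟨y, hy, hyQ⟩ := avoid_iter (homogeneousSubmodule (Fin N) k 1) (Ideal.span (q '' Set.Iio 3)) 3 (fun Q hQ h _ => hq3 Q hQ h) H d
  let q' : Fin 3 → MvPolynomial (Fin N) k := fun i => q i
  let y' : Fin d → MvPolynomial (Fin N) k := fun i => y i
  have hq' : q '' Set.Iio 3 = Set.range q' := by
    ext x; constructor
    · rintro ⟨i, hi, rfl⟩; exact ⟨⟨i, hi⟩, rfl⟩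
    · rintro ⟨i, rfl⟩; exact ⟨i, i.2, rfl⟩
  have hy' : y '' Set.Iio d = Set.range y' := by
    ext x; constructor
    · rintro ⟨i, hi, rfl⟩; exact ⟨⟨i, hi⟩, rfl⟩
    · rintro ⟨i, rfl⟩; exact ⟨i, i.2, rfl⟩
  have hsup : Ideal.span (q '' Set.Iio 3) ⊔ Ideal.span (y '' Set.Iio d) = Ideal.span (Set.range (Sum.elim q' y')) := by
    rw [hq', hy', Set.Sum.elim_range, Ideal.span_union]
  rw [hsup] at hyQ
  obtain ⟨D, hD⟩ := rad_step (Set.range (Sum.elim q' y')) (by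
    rintro _ ⟨i | i, rfl⟩
    · exact ⟨2, hqh i i.2⟩
    · exact ⟨1, (hy i i.2).1⟩) (by
    intro Q h1 h2 h3
    have := hyQ Q h1 h2 h3
    have e : (N : ℕ∞) = 3 + (d:ℕ∞) := by rw [← hN]; push_cast; rfl
    exact e.le.trans this)
  have hfin := fin_over (Sum.elim q' y') (Sum.elim (fun _ => 2) (fun _ => 1)) (by rintro (i | i) <;> simp)
    (by
      rintro (i | i)
      · exact hqh i i.2
      · exact (hy i i.2).1) D hD
  refine ⟨y, fun i hi => hy i hi, ⟨D, ?_⟩, ?_⟩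
  · intro n hn s hs
    have h1 := hD n hn s hs
    refine (Ideal.span_le.2 ?_ : Ideal.span (Set.range (Sum.elim q' y')) ≤ _) h1
    rintro _ ⟨i | i, rfl⟩
    · have := hqI i i.2
      rw [Set.Sum.elim_range, Ideal.span_union]
      exact Ideal.mem_sup_left this
    · exact Ideal.subset_span ⟨Sum.inr i, rfl⟩
  · intro p hp hfp hhp G hG
    exact algInd_mod q' y' hfin hN p (fun i => hfp (hqI i i.2)) hhp G hG
end P2

section SEP
open MvPolynomial

theorem der_vanish_adjoin {k E : Type u} [Field k] [Field E] [Algebra k E] (δ : Derivation k E E) (X : Set E) (hX : ∀ x ∈ X, δ x = 0)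
    (x : E) (hx : x ∈ IntermediateField.adjoin k X) : δ x = 0 := by
  have h0 : ∀ a ∈ Algebra.adjoin k X, δ a = 0 := by
    intro a ha
    exact Derivation.eqOn_adjoin (D1 := δ) (D2 := 0) (fun a ha => by simpa using hX a ha) ha
  obtain ⟨a, ha, b, hb, rfl⟩ := IntermediateField.mem_adjoin_iff_div.1 hx
  rw [div_eq_mul_inv, δ.leibniz, Derivation.leibniz_inv, h0 a ha, h0 b hb]
  simp

theorem der_span_top {k E : Type u} [Field k] [Field E] [Algebra k E] (Y : Set E)
    (h : ∀ δ : Derivation k E E, (∀ x ∈ Y, δ x = 0) → ∀ x, δ x = 0) :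
    Submodule.span E (KaehlerDifferential.D k E '' Y) = ⊤ := by
  rw [eq_top_iff, ← KaehlerDifferential.span_range_derivation, Submodule.span_le]
  rintro _ ⟨x, rfl⟩
  by_contra hx
  obtain ⟨l, hl, hle⟩ := Submodule.exists_le_ker_of_notMem hx
  apply hl
  have := h (l.compDer (KaehlerDifferential.D k E)) (by
    intro y hy
    exact hle (Submodule.subset_span ⟨y, hy, rfl⟩)) x
  exact this

theorem der_sep {k E : Type u} [Field k] [Field E] [Algebra k E] (Y : Set E) [Algebra.IsSeparable (IntermediateField.adjoin k Y) E] :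
    Submodule.span E (KaehlerDifferential.D k E '' Y) = ⊤ := by
  refine der_span_top Y ?_
  intro δ hδ x
  have hun := Algebra.FormallyUnramified.of_isSeparable (IntermediateField.adjoin k Y) E
  have hsub : Subsingleton (Ω[E⁄IntermediateField.adjoin k Y]) := hun.subsingleton_kaehlerDifferential
  have hsm : ∀ (c : IntermediateField.adjoin k Y) (a : E), δ (c • a) = c • δ a := by
    intro c a
    rw [Algebra.smul_def, δ.leibniz]
    have : δ (algebraMap (IntermediateField.adjoin k Y) E c) = 0 := der_vanish_adjoin δ Y hδ _ c.2
    rw [this]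
    simp [Algebra.smul_def]
  let δ' : Derivation (IntermediateField.adjoin k Y) E E :=
    Derivation.mk' { toFun := δ, map_add' := fun a b => map_add _ _ _, map_smul' := hsm } (fun a b => δ.leibniz a b)
  have h1 : δ'.liftKaehlerDifferential (KaehlerDifferential.D _ E x) = δ' x := by simp
  rw [Subsingleton.elim (KaehlerDifferential.D (IntermediateField.adjoin k Y) E x) 0, map_zero] at h1
  exact h1.symm

theorem sep_der {k E : Type u} [Field k] [Field E] [Algebra k E] [Algebra.EssFiniteType k E] (Y : Set E) 
    (h : Submodule.span E (KaehlerDifferential.D k E '' Y) = ⊤) : Algebra.IsSeparable (IntermediateField.adjoin k Y) E := by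
  haveI : Algebra.EssFiniteType (IntermediateField.adjoin k Y) E := Algebra.EssFiniteType.of_comp k _ _
  rw [← Algebra.FormallyUnramified.iff_isSeparable]
  have hsub : Subsingleton (Ω[E⁄IntermediateField.adjoin k Y]) := by
    have hs := KaehlerDifferential.map_surjective k (IntermediateField.adjoin k Y) E
    have hz : KaehlerDifferential.map k (IntermediateField.adjoin k Y) E E = 0 := by
      refine LinearMap.ext_on h ?_
      rintro _ ⟨y, hy, rfl⟩
      rw [KaehlerDifferential.map_D]
      have : algebraMap E E y = algebraMap (IntermediateField.adjoin k Y) E ⟨y, IntermediateField.subset_adjoin k Y hy⟩ := rfl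
      rw [this, Derivation.map_algebraMap, LinearMap.zero_apply]
    refine ⟨fun a b => ?_⟩
    obtain ⟨a, rfl⟩ := hs a
    obtain ⟨b, rfl⟩ := hs b
    rw [hz]; rfl
  exact ⟨hsub⟩

theorem fd_of_hsop {k E : Type u} [Field k] [Field E] [Algebra k E] {N d : ℕ} {ι : Type} [Fintype ι] (f : ι → MvPolynomial (Fin N) k)
    (hf : ∀ i, (f i).IsHomogeneous 2) (y : Fin d → MvPolynomial (Fin N) k) (hy : ∀ i, (y i).IsHomogeneous 1)
    (D : ℕ) (hD : ∀ n, D ≤ n → ∀ s : MvPolynomial (Fin N) k, s.IsHomogeneous n → s ∈ Ideal.span (Set.range (Sum.elim f y)))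
    (π : MvPolynomial (Fin N) k →ₐ[k] E) (hπ : IntermediateField.adjoin k (Set.range (fun i => π (X i))) = ⊤)
    (hfπ : ∀ i, π (f i) = 0) :
    FiniteDimensional (IntermediateField.adjoin k (Set.range (fun i => π (y i)))) E := by
  set K := IntermediateField.adjoin k (Set.range (fun i => π (y i))) with hK
  have hfin := fin_over (Sum.elim f y) (Sum.elim (fun _ => 2) (fun _ => 1)) (by rintro (i | i) <;> simp)
    (by
      rintro (i | i)
      · exact hf i
      · exact hy i) D hD
  have hInt := hfin.to_isIntegral
  have hmem : ∀ c : MvPolynomial (ι ⊕ Fin d) k, π (aeval (Sum.elim f y) c) ∈ K := by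
    intro c
    have : π (aeval (Sum.elim f y) c) = aeval (Sum.elim (fun _ => 0) (fun i => π (y i)) : ι ⊕ Fin d → E) c := by
      rw [← AlgHom.comp_apply]
      congr 1
      refine MvPolynomial.algHom_ext ?_
      rintro (i | i)
      · simp [hfπ]
      · simp
    rw [this]
    have h2 : (aeval (Sum.elim (fun _ => 0) (fun i => π (y i)) : ι ⊕ Fin d → E) c) ∈ 
        Algebra.adjoin k (Set.range (Sum.elim (fun _ => 0) (fun i => π (y i)) : ι ⊕ Fin d → E)) := by
      rw [Algebra.adjoin_range_eq_range_aeval]; exact ⟨c, rfl⟩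
    refine (Algebra.adjoin_le (S := K.toSubalgebra) ?_) h2
    rintro _ ⟨i | i, rfl⟩
    · exact K.zero_mem
    · exact IntermediateField.subset_adjoin _ _ ⟨i, rfl⟩
  have hI : ∀ i, IsIntegral K (π (X i)) := by
    intro i
    obtain ⟨P, hP, hx⟩ := hInt (X i)
    let ψ : MvPolynomial (ι ⊕ Fin d) k →+* K := (π.comp (aeval (Sum.elim f y))).toRingHom.codRestrict K.toSubfield hmem
    refine ⟨P.map ψ, hP.map _, ?_⟩
    rw [Polynomial.eval₂_map]
    have : (algebraMap K E).comp ψ = π.toRingHom.comp (aeval (Sum.elim f y)).toRingHom := rfl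
    rw [this]
    have h3 := Polynomial.hom_eval₂ P (aeval (Sum.elim f y) : MvPolynomial (ι ⊕ Fin d) k →ₐ[k] MvPolynomial (Fin N) k).toRingHom π.toRingHom (X i)
    refine h3.symm.trans ?_
    rw [hx]; exact map_zero _
  have h4 := IntermediateField.finiteDimensional_adjoin (K := K) (S := Set.range (fun i => π (X i))) (by
    rintro _ ⟨i, rfl⟩; exact hI i)
  have h5 : IntermediateField.adjoin K (Set.range (fun i => π (X i))) = ⊤ := by
    rw [eq_top_iff]
    intro x _
    have hx : x ∈ IntermediateField.adjoin k (Set.range (fun i => π (X i))) := by rw [hπ]; trivial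
    have hle : IntermediateField.adjoin k (Set.range (fun i => π (X i))) ≤ (IntermediateField.adjoin K (Set.range (fun i => π (X i)))).restrictScalars k := by
      rw [IntermediateField.adjoin_le_iff]
      exact IntermediateField.subset_adjoin _ _
    exact hle hx
  rw [h5] at h4
  exact Module.Finite.equiv (IntermediateField.topEquiv (F := K) (E := E)).toLinearEquiv

theorem P2sep {k E : Type u} [Field k] [IsAlgClosed k] [Field E] [Algebra k E] [Algebra.EssFiniteType k E] {N d : ℕ} (hN : 3 + d = N)
    {ι : Type} [Fintype ι] (f : ι → MvPolynomial (Fin N) k)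
    (hf : ∀ i, (f i).IsHomogeneous 2)
    (hht : ∀ Q : Ideal (MvPolynomial (Fin N) k), Q.IsPrime → Ideal.span (Set.range f) ≤ Q → 3 ≤ Q.height)
    (p : Ideal (MvPolynomial (Fin N) k)) (hp : p.IsPrime) (hfp : Ideal.span (Set.range f) ≤ p) (hp3 : p.height ≤ 3)
    (π : MvPolynomial (Fin N) k →ₐ[k] E) (hπ : IntermediateField.adjoin k (Set.range (fun i => π (X i))) = ⊤)
    (hπp : ∀ s, π s = 0 ↔ s ∈ p) :
    ∃ y : Fin d → MvPolynomial (Fin N) k, (∀ i, (y i).IsHomogeneous 1) ∧ 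
      (∃ D, ∀ n, D ≤ n → ∀ s : MvPolynomial (Fin N) k, s.IsHomogeneous n → s ∈ Ideal.span (Set.range (Sum.elim f y))) ∧
      AlgebraicIndependent k (fun i => π (y i)) ∧ FiniteDimensional (IntermediateField.adjoin k (Set.range (fun i => π (y i)))) E ∧
      Algebra.IsSeparable (IntermediateField.adjoin k (Set.range (fun i => π (y i)))) E := by
  have hfπ : ∀ i, π (f i) = 0 := fun i => (hπp _).2 (hfp (Ideal.subset_span ⟨i, rfl⟩))
  have hinf : Infinite k := IsAlgClosed.instInfinite
  have hai : ∀ y : Fin d → MvPolynomial (Fin N) k, (∀ G : MvPolynomial (Fin d) k, aeval y G ∈ p → G = 0) → 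
      AlgebraicIndependent k (fun i => π (y i)) := by
    intro y hy
    rw [algebraicIndependent_iff]
    intro G hG
    apply hy G
    rw [← hπp, ← hG, ← AlgHom.comp_apply]
    congr 1
    refine MvPolynomial.algHom_ext ?_
    intro i; simp
  -- transcendence degree
  obtain ⟨s, hs, hss⟩ := exists_isTranscendenceBasis_and_isSeparable_of_perfectField k E
  have hcard : s.card = d := by
    obtain ⟨y, hy, ⟨D, hD⟩, hyp⟩ := P2 hN f hf hht (fun _ => ⊤)
    have h1 := hai _ (hyp p hp hfp hp3)
    have h2 := fd_of_hsop f hf (fun i : Fin d => y i) (fun i => (hy i i.2).1) D hD π hπ hfπ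
    have h3 : IsTranscendenceBasis k (fun i : Fin d => π (y i)) := by
      rw [isTranscendenceBasis_iff_algebraicIndependent_isAlgebraic]
      refine ⟨h1, ?_⟩
      have h4 : Algebra.IsAlgebraic (IntermediateField.adjoin k (Set.range (fun i : Fin d => π (y i)))) E := inferInstance
      exact IntermediateField.isAlgebraic_adjoin_iff_top.1 h4
    have e1 := h3.lift_cardinalMk_eq_trdeg
    have e2 := hs.lift_cardinalMk_eq_trdeg
    simp only [Cardinal.lift_uzero, Cardinal.lift_id] at e1 e2
    rw [← e2] at e1
    simp at e1
    exact_mod_cast e1.symm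
  have hspan := der_sep (k := k) (E := E) (s : Set E)
  classical
  have hfinΩ : Module.Finite E (Ω[E⁄k]) := ⟨⟨s.image (KaehlerDifferential.D k E), by rw [Finset.coe_image]; exact hspan⟩⟩
  have hrank : Module.finrank E (Ω[E⁄k]) ≤ d := by
    classical
    rw [← finrank_top E (Ω[E⁄k]), ← hspan, ← Finset.coe_image]
    exact (finrank_span_finset_le_card _).trans (Finset.card_image_le.trans hcard.le)
  let W : Set (MvPolynomial (Fin N) k) → Submodule E (Ω[E⁄k]) := fun Y => Submodule.span E ((fun l => KaehlerDifferential.D k E (π l)) '' Y)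
  let H : Set (MvPolynomial (Fin N) k) → Submodule k (MvPolynomial (Fin N) k) := fun Y =>
    ((W Y).restrictScalars k).comap ((KaehlerDifferential.D k E).toLinearMap ∘ₗ π.toLinearMap)
  obtain ⟨y, hy, ⟨D, hD⟩, hyp⟩ := P2 hN f hf hht H
  refine ⟨fun i => y i, fun i => (hy i i.2).1, ⟨D, hD⟩, hai _ (hyp p hp hfp hp3), 
    fd_of_hsop f hf (fun i : Fin d => y i) (fun i => (hy i i.2).1) D hD π hπ hfπ, ?_⟩
  have himg : Set.range (fun i : Fin d => π (y i)) = π '' (y '' Set.Iio d) := by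
    ext x; constructor
    · rintro ⟨i, rfl⟩; exact ⟨_, ⟨i, i.2, rfl⟩, rfl⟩
    · rintro ⟨_, ⟨i, hi, rfl⟩, rfl⟩; exact ⟨⟨i, hi⟩, rfl⟩
  apply sep_der
  rw [himg, Set.image_image]
  change W (y '' Set.Iio d) = ⊤
  have hmono : ∀ i ≤ d, W (y '' Set.Iio i) ≤ W (y '' Set.Iio d) := by
    intro i hi
    exact Submodule.span_mono (Set.image_mono (Set.image_mono (Set.Iio_subset_Iio hi)))
  by_cases hex : ∃ i < d, homogeneousSubmodule (Fin N) k 1 ≤ H (y '' Set.Iio i)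
  · obtain ⟨i, hi, hle⟩ := hex
    have htop : Submodule.span E (KaehlerDifferential.D k E '' (Set.range (fun i => π (X i)))) = ⊤ := by
      refine der_span_top _ ?_
      intro δ hδ x
      exact der_vanish_adjoin δ _ hδ x (by rw [hπ]; trivial)
    rw [eq_top_iff, ← htop, Submodule.span_le]
    rintro _ ⟨_, ⟨j, rfl⟩, rfl⟩
    exact hmono i hi.le (hle (isHomogeneous_X k j))
  · push Not at hex
    have hr : ∀ i ≤ d, i ≤ Module.finrank E (W (y '' Set.Iio i)) := by
      intro i
      induction i with
      | zero => intro _; exact Nat.zero_le _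
      | succ i ih =>
        intro hi
        have h1 := (hy i (by omega)).2.resolve_left (hex i (by omega))
        have hlt : W (y '' Set.Iio i) < W (y '' Set.Iio (i+1)) := by
          refine lt_of_le_of_ne (Submodule.span_mono (Set.image_mono (Set.image_mono (Set.Iio_subset_Iio (by omega))))) ?_
          intro h
          apply h1
          change KaehlerDifferential.D k E (π (y i)) ∈ W (y '' Set.Iio i)
          rw [h]
          exact Submodule.subset_span ⟨y i, ⟨i, by simp, rfl⟩, rfl⟩
        have := Submodule.finrank_lt_finrank_of_lt hlt
        have := ih (by omega)
        omega
    refine Submodule.eq_top_of_finrank_eq (le_antisymm (Submodule.finrank_le _) (hrank.trans (hr d le_rfl)))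
end SEP

section NUM
open Filter

theorem lc_nonpos (R : Polynomial ℚ) (h : ∀ᶠ n : ℕ in atTop, R.eval (n:ℚ) ≤ 0) : R.leadingCoeff ≤ 0 := by
  by_contra hc
  push Not at hc
  by_cases hd : 0 < R.degree
  · have h1 := (R.tendsto_atTop_of_leadingCoeff_nonneg hd hc.le).comp (tendsto_natCast_atTop_atTop (R := ℚ))
    obtain ⟨n, hn1, hn2⟩ := (h.and (h1.eventually_gt_atTop 0)).exists
    simp only [Function.comp] at hn2
    linarith
  · push Not at hd
    rw [Polynomial.eq_C_of_degree_le_zero hd] at hc h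
    obtain ⟨n, hn⟩ := h.exists
    simp at hn hc
    linarith

theorem poly_cmp (P Q : Polynomial ℚ) (hP : 0 < P.leadingCoeff)
    (h : ∀ᶠ n : ℕ in atTop, P.eval (n:ℚ) ≤ Q.eval (n:ℚ)) :
    P.natDegree < Q.natDegree ∨ (P.natDegree = Q.natDegree ∧ P.leadingCoeff ≤ Q.leadingCoeff) := by
  have h1 := lc_nonpos (P - Q) (h.mono fun n hn => by simpa using hn)
  have hP0 : P ≠ 0 := by rintro rfl; simp at hP
  rcases lt_trichotomy P.natDegree Q.natDegree with h2 | h2 | h2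
  · exact Or.inl h2
  · refine Or.inr ⟨h2, ?_⟩
    by_contra hc
    push Not at hc
    have hQ0 : Q ≠ 0 ∨ Q = 0 := (em _).symm
    rcases hQ0 with hQ0 | rfl
    · rw [Polynomial.leadingCoeff_sub_of_degree_eq (by rw [Polynomial.degree_eq_natDegree hP0, Polynomial.degree_eq_natDegree hQ0, h2]) hc.ne'] at h1
      linarith
    · simp at h1; linarith
  · rw [Polynomial.leadingCoeff_sub_of_degree_lt (Polynomial.degree_lt_degree h2)] at h1
    linarith

theorem choose_poly (d r c : ℕ) (hr : r ≠ 0) : ∃ A : Polynomial ℚ, A.natDegree = d ∧ A.leadingCoeff = r * (d.factorial : ℚ)⁻¹ ∧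
    ∀ n : ℕ, A.eval (n:ℚ) = ((r * (n + c + d).choose d : ℕ) : ℚ) := by
  have hr' : (r:ℚ) ≠ 0 := by exact_mod_cast hr
  refine ⟨Polynomial.C (r:ℚ) * (Polynomial.preHilbertPoly ℚ d 0).comp (Polynomial.X + Polynomial.C (c:ℚ)), ?_, ?_, ?_⟩
  · rw [Polynomial.natDegree_C_mul hr', Polynomial.natDegree_comp, Polynomial.natDegree_X_add_C, Polynomial.natDegree_preHilbertPoly, mul_one]
  · rw [Polynomial.leadingCoeff_mul, Polynomial.leadingCoeff_C, Polynomial.leadingCoeff_comp (by rw [Polynomial.natDegree_X_add_C]; exact one_ne_zero), Polynomial.leadingCoeff_preHilbertPoly, Polynomial.leadingCoeff_X_add_C, one_pow, mul_one]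
  · intro n
    have := Polynomial.preHilbertPoly_eq_choose_sub_add ℚ d (k := 0) (n := n + c) (Nat.zero_le _)
    simp at this ⊢
    rw [this]; tauto

theorem HF_num (d : ℕ) (HF : ℕ → ℕ) (P : Polynomial ℚ) (hP : ∀ᶠ n : ℕ in atTop, (HF n : ℚ) = P.eval (n:ℚ))
    (h4 : (P.natDegree.factorial : ℚ) * P.leadingCoeff = 4)
    (hi : ∀ n, (n + d).choose d ≤ HF n) (r0 δ0 : ℕ) (hu : ∀ n, HF n ≤ r0 * (n + δ0 + d).choose d) :
    (∀ r c, (∀ n, r * (n + d).choose d ≤ HF (n + c)) → r ≤ 4) ∧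
    (∀ r δ, (∀ n, HF n ≤ r * (n + δ + d).choose d) → 4 ≤ r) := by
  have hpos : ∀ n, 0 < HF n := fun n => lt_of_lt_of_le (Nat.choose_pos (by omega)) (hi n)
  have hlc : 0 < P.leadingCoeff := by
    by_contra hc
    push Not at hc
    have := mul_nonpos_of_nonneg_of_nonpos (Nat.cast_nonneg (α := ℚ) P.natDegree.factorial) hc
    linarith
  have hup : ∀ r δ, (∀ n, HF n ≤ r * (n + δ + d).choose d) → P.natDegree < d ∨ (P.natDegree = d ∧ P.leadingCoeff ≤ r * (d.factorial : ℚ)⁻¹) := by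
    intro r δ h
    have hr : r ≠ 0 := by rintro rfl; have := h 0; have := hpos 0; omega
    obtain ⟨A, hA1, hA2, hA3⟩ := choose_poly d r δ hr
    have := poly_cmp P A hlc (hP.mono fun n hn => by rw [← hn, hA3]; exact_mod_cast h n)
    rwa [hA1, hA2] at this
  have hlo : ∀ r c, r ≠ 0 → (∀ n, r * (n + d).choose d ≤ HF (n + c)) → d < P.natDegree ∨ (d = P.natDegree ∧ r * (d.factorial : ℚ)⁻¹ ≤ P.leadingCoeff) := by
    intro r c hr h
    obtain ⟨A, hA1, hA2, hA3⟩ := choose_poly d r 0 hr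
    have hl : (P.comp (Polynomial.X + Polynomial.C (c:ℚ))).leadingCoeff = P.leadingCoeff := by
      rw [Polynomial.leadingCoeff_comp (by rw [Polynomial.natDegree_X_add_C]; exact one_ne_zero), Polynomial.leadingCoeff_X_add_C, one_pow, mul_one]
    have hn : (P.comp (Polynomial.X + Polynomial.C (c:ℚ))).natDegree = P.natDegree := by
      rw [Polynomial.natDegree_comp, Polynomial.natDegree_X_add_C, mul_one]
    have hA : 0 < A.leadingCoeff := by rw [hA2]; positivity
    have := poly_cmp A (P.comp (Polynomial.X + Polynomial.C (c:ℚ))) hA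
      (((tendsto_add_atTop_nat c).eventually hP).mono fun n hn => by
        rw [hA3, Polynomial.eval_comp]
        have h1 : Polynomial.eval (n:ℚ) (Polynomial.X + Polynomial.C (c:ℚ)) = ((n + c : ℕ):ℚ) := by simp
        rw [h1, ← hn]; exact_mod_cast h n)
    rwa [hA1, hA2, hl, hn] at this
  have hdeg : P.natDegree = d := by
    have h1 := hup r0 δ0 hu
    have h2 := hlo 1 0 one_ne_zero (by simpa using hi)
    omega
  have hf : (0:ℚ) < d.factorial := by positivity
  have hl4 : P.leadingCoeff = 4 * (d.factorial : ℚ)⁻¹ := by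
    rw [hdeg] at h4; field_simp; linarith
  have hinv : (0:ℚ) < (d.factorial : ℚ)⁻¹ := by positivity
  constructor
  · intro r c h
    by_cases hr : r = 0
    · omega
    rcases hlo r c hr h with h1 | ⟨-, h1⟩
    · omega
    · rw [hl4] at h1
      exact_mod_cast le_of_mul_le_mul_right h1 hinv
  · intro r c h
    rcases hup r c h with h1 | ⟨-, h1⟩
    · omega
    · rw [hl4] at h1
      exact_mod_cast le_of_mul_le_mul_right h1 hinv

theorem finrank_hom (k : Type u) [Field k] (d n : ℕ) :
    Module.finrank k (MvPolynomial.homogeneousSubmodule (Fin (d+1)) k n) = (n + d).choose d := by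
  have e : ({e : Fin (d+1) →₀ ℕ | e.degree = n} : Set _) = ↑((Finset.univ : Finset (Fin (d+1))).finsuppAntidiag n) := by
    ext e
    simp [Finset.mem_finsuppAntidiag, Finsupp.degree_eq_sum]
  have hc := Finset.card_finsuppAntidiag_nat_eq_choose (s := (Finset.univ : Finset (Fin (d+1)))) n
  rw [MvPolynomial.homogeneousSubmodule_eq_finsupp_supported, e]
  rw [(AddMonoidAlgebra.supportedEquivFinsupp (R := k) (S := k) _).finrank_eq, Module.finrank_finsupp_self]
  rw [← Nat.card_eq_fintype_card, Nat.card_coe_set_eq, Set.ncard_coe_finset, hc, Finset.card_univ, Fintype.card_fin]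
  have h1 : d + 1 + n - 1 = n + d := by omega
  rw [h1, Nat.choose_symm_add]
end NUM

section HILB
open MvPolynomial

variable {k : Type u} [Field k] {N d : ℕ}

/-- `s` lies, modulo `p`, in the module generated by the `h i` over the algebra generated by `y`. -/
def GenBy {ι : Type} [Fintype ι] (p : Ideal (MvPolynomial (Fin N) k)) (y : Fin d → MvPolynomial (Fin N) k) (h : ι → MvPolynomial (Fin N) k)
    (s : MvPolynomial (Fin N) k) : Prop :=
  ∃ c : ι → MvPolynomial (Fin d) k, s - ∑ i, aeval y (c i) * h i ∈ p

variable {ι : Type} [Fintype ι] {p : Ideal (MvPolynomial (Fin N) k)} {y : Fin d → MvPolynomial (Fin N) k} {h : ι → MvPolynomial (Fin N) k}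

theorem GenBy.of_mem {s} (hs : s ∈ p) : GenBy p y h s := ⟨fun _ => 0, by simpa using hs⟩

theorem GenBy.add {s t} (hs : GenBy p y h s) (ht : GenBy p y h t) : GenBy p y h (s + t) := by
  obtain ⟨a, ha⟩ := hs
  obtain ⟨b, hb⟩ := ht
  refine ⟨fun i => a i + b i, ?_⟩
  have := p.add_mem ha hb
  simp only [map_add, add_mul, Finset.sum_add_distrib]
  convert this using 1
  ring

theorem GenBy.smul {s} (a : MvPolynomial (Fin d) k) (hs : GenBy p y h s) : GenBy p y h (aeval y a * s) := by
  obtain ⟨c, hc⟩ := hs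
  refine ⟨fun i => a * c i, ?_⟩
  have := p.mul_mem_left (aeval y a) hc
  simp only [map_mul, mul_assoc]
  rw [← Finset.mul_sum, ← mul_sub]
  exact this

theorem GenBy.y_mul {s} (j : Fin d) (hs : GenBy p y h s) : GenBy p y h (y j * s) := by
  simpa using hs.smul (X j)

theorem GenBy.const {s} (a : k) (hs : GenBy p y h s) : GenBy p y h (a • s) := by
  have := hs.smul (C a)
  rwa [aeval_C, MvPolynomial.algebraMap_eq, ← smul_eq_C_mul] at this

theorem GenBy.congr {s t} (hs : GenBy p y h s) (hst : t - s ∈ p) : GenBy p y h t := by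
  have := hs.add (GenBy.of_mem (y := y) (h := h) hst)
  simpa using this

theorem GenBy.sum {T : Type*} (F : Finset T) (s : T → MvPolynomial (Fin N) k) (hs : ∀ i ∈ F, GenBy p y h (s i)) :
    GenBy p y h (∑ i ∈ F, s i) := by
  classical
  induction F using Finset.induction_on with
  | empty => simpa using GenBy.of_mem p.zero_mem
  | insert a F ha ih =>
    rw [Finset.sum_insert ha]
    exact (hs a (by simp)).add (ih fun i hi => hs i (by simp [hi]))

theorem GenBy.self (i : ι) : GenBy p y h (h i) := by
  classical
  refine ⟨Pi.single i 1, ?_⟩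
  have : ∑ j, aeval y ((Pi.single i 1 : ι → MvPolynomial (Fin d) k) j) * h j = h i := by
    rw [Finset.sum_eq_single i]
    · simp
    · intro j _ hj; simp [Pi.single_eq_of_ne hj]
    · simp
  rw [this, sub_self]; exact p.zero_mem

theorem GenBy.span {s} (hs : s ∈ Submodule.span k (Set.range h)) : GenBy p y h s := by
  induction hs using Submodule.span_induction with
  | mem x hx => obtain ⟨i, rfl⟩ := hx; exact GenBy.self i
  | zero => exact GenBy.of_mem p.zero_mem
  | add _ _ _ _ h1 h2 => exact h1.add h2
  | smul a _ _ h1 => exact h1.const a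

theorem aeval_hom (hy : ∀ i, (y i).IsHomogeneous 1) (c : MvPolynomial (Fin d) k) (n : ℕ) (hc : c.IsHomogeneous n) :
    (aeval y c).IsHomogeneous n := by
  simpa using hc.aeval (R := k) y hy

theorem hcomp_aeval (hy : ∀ i, (y i).IsHomogeneous 1) (c : MvPolynomial (Fin d) k) (n : ℕ) :
    homogeneousComponent n (aeval y c) = aeval y (homogeneousComponent n c) := by
  conv_lhs => rw [← sum_homogeneousComponent c]
  rw [map_sum, map_sum]
  have : ∀ i, homogeneousComponent n (aeval y (homogeneousComponent i c)) = if i = n then aeval y (homogeneousComponent i c) else 0 := by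
    intro i
    have := homogeneousComponent_of_mem (m := n) (aeval_hom hy _ i (homogeneousComponent_isHomogeneous i c))
    rw [this]
    split_ifs <;> first | rfl | omega
  simp only [this]
  rw [Finset.sum_ite_eq']
  split_ifs with h
  · rfl
  · rw [homogeneousComponent_eq_zero, map_zero]
    simp at h; omega

/-- generation from generation modulo `y`. -/
theorem genBy_of_mod (hpH : HomI p) (hy : ∀ i, (y i).IsHomogeneous 1) (e : ι → ℕ) (he : ∀ i, (h i).IsHomogeneous (e i))
    (H : ∀ n s, s.IsHomogeneous n → ∃ t ∈ Submodule.span k (Set.range h), s - t ∈ p ⊔ Ideal.span (Set.range y)) :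
    ∀ s, GenBy p y h s := by
  have key : ∀ n s, s.IsHomogeneous n → GenBy p y h s := by
    intro n
    induction n using Nat.strong_induction_on with
    | _ n ih =>
      intro s hs
      obtain ⟨t, ht, hst⟩ := H n s hs
      obtain ⟨q, hq, b', hb', hqb⟩ := Submodule.mem_sup.1 hst
      obtain ⟨b, rfl⟩ := Ideal.mem_span_range_iff_exists_fun.1 hb'
      have h1 := congrArg (homogeneousComponent n) hqb
      rw [map_add, map_sub, map_sum, homogeneousComponent_of_mem hs, if_pos rfl] at h1
      simp only [hcomp_mul _ _ 1 (hy _)] at h1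
      have ht' : GenBy p y h (homogeneousComponent n t) := by
        obtain ⟨c, rfl⟩ := (Submodule.mem_span_range_iff_exists_fun k).1 ht
        rw [map_sum]
        refine GenBy.sum _ _ fun i _ => ?_
        rw [map_smul, homogeneousComponent_of_mem (he i)]
        split_ifs
        · exact (GenBy.self i).const _
        · simpa using GenBy.of_mem p.zero_mem
      have h2 : s = homogeneousComponent n q + (∑ x, if 1 ≤ n then homogeneousComponent (n - 1) (b x) * y x else 0) + homogeneousComponent n t := by
        rw [h1]; ring
      rw [h2]
      refine ((GenBy.of_mem (hpH q hq n)).add (GenBy.sum _ _ fun i _ => ?_)).add ht'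
      split_ifs with hn
      · rw [mul_comm]
        exact (ih (n-1) (by omega) _ (homogeneousComponent_isHomogeneous _ _)).y_mul i
      · exact GenBy.of_mem p.zero_mem
  intro s
  rw [← sum_homogeneousComponent s]
  exact GenBy.sum _ _ fun i _ => key i _ (homogeneousComponent_isHomogeneous _ _)

/-- homogeneous coefficients. -/
theorem GenBy.homog (hpH : HomI p) (hy : ∀ i, (y i).IsHomogeneous 1) (e : ι → ℕ) (he : ∀ i, (h i).IsHomogeneous (e i))
    {s} {n : ℕ} (hs : s.IsHomogeneous n) (hg : GenBy p y h s) :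
    ∃ c : ι → MvPolynomial (Fin d) k, (∀ i, (c i).IsHomogeneous (n - e i)) ∧ (∀ i, n < e i → c i = 0) ∧ s - ∑ i, aeval y (c i) * h i ∈ p := by
  obtain ⟨c, hc⟩ := hg
  refine ⟨fun i => if e i ≤ n then homogeneousComponent (n - e i) (c i) else 0, ?_, ?_, ?_⟩
  · intro i; dsimp only; split_ifs
    · exact homogeneousComponent_isHomogeneous _ _
    · exact isHomogeneous_zero _ _ _
  · intro i hi; dsimp only; rw [if_neg (by omega)]
  · have := hpH _ hc n
    rw [map_sub, map_sum, homogeneousComponent_of_mem hs, if_pos rfl] at this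
    simp only [hcomp_mul _ _ _ (he _), hcomp_aeval hy] at this
    convert this using 3 with i
    by_cases hh : e i ≤ n
    · simp only [if_pos hh]
    · simp only [if_neg hh, map_zero, zero_mul]

end HILB

section HILB2
open MvPolynomial

variable {k : Type u} [Field k] {N d : ℕ}

theorem HF_lower (p : Ideal (MvPolynomial (Fin N) k)) (y : Fin (d+1) → MvPolynomial (Fin N) k)
    (hy : ∀ i, (y i).IsHomogeneous 1) (r c : ℕ) (h : Fin r → MvPolynomial (Fin N) k) (e : Fin r → ℕ)
    (he : ∀ i, (h i).IsHomogeneous (e i)) (hec : ∀ i, e i ≤ c)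
    (hind : ∀ a : Fin r → MvPolynomial (Fin (d+1)) k, ∑ i, aeval y (a i) * h i ∈ p → ∀ i, a i = 0) (n : ℕ) :
    r * (n + d).choose d ≤ hilbertFunction k p (n + c) := by
  rw [hilbertFunction]
  have hf : Module.finrank k (Fin r → homogeneousSubmodule (Fin (d+1)) k n) = r * (n + d).choose d := by
    rw [Module.finrank_pi_fintype]
    simp [finrank_hom]
  rw [← hf]
  let Ψ : (Fin r → homogeneousSubmodule (Fin (d+1)) k n) →ₗ[k] (MvPolynomial (Fin N) k ⧸ p) :=
    ∑ i, (Ideal.Quotient.mkₐ k p).toLinearMap ∘ₗ (LinearMap.mulRight k (y 0 ^ (c - e i) * h i)) ∘ₗ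
      (aeval y : MvPolynomial (Fin (d+1)) k →ₐ[k] _).toLinearMap ∘ₗ (Submodule.subtype _) ∘ₗ (LinearMap.proj i)
  have hΨ : ∀ a, Ψ a = Ideal.Quotient.mk p (∑ i, aeval y (a i : MvPolynomial (Fin (d+1)) k) * (y 0 ^ (c - e i) * h i)) := by
    intro a
    rw [map_sum]
    simp [Ψ, mul_assoc]
  have hinj : Function.Injective Ψ := by
    rw [injective_iff_map_eq_zero]
    intro a ha
    rw [hΨ, Ideal.Quotient.eq_zero_iff_mem] at ha
    have := hind (fun i => (a i : MvPolynomial (Fin (d+1)) k) * X 0 ^ (c - e i)) (by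
      simpa only [map_mul, map_pow, aeval_X, mul_assoc] using ha)
    funext i
    have h1 := this i
    rcases mul_eq_zero.1 h1 with h2 | h2
    · exact Subtype.ext h2
    · exact absurd h2 (pow_ne_zero _ (X_ne_zero _))
  have hmem : ∀ a, Ψ a ∈ Submodule.map (Ideal.Quotient.mkₐ k p).toLinearMap (homogeneousSubmodule (Fin N) k (n + c)) := by
    intro a
    rw [hΨ]
    refine ⟨_, ?_, rfl⟩
    refine Submodule.sum_mem _ fun i _ => ?_
    rw [mem_homogeneousSubmodule]
    have h1 := (aeval_hom hy _ n ((mem_homogeneousSubmodule _ _).1 (a i).2)).mul (((hy 0).pow (c - e i)).mul (he i))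
    have h2 : n + (1 * (c - e i) + e i) = n + c := by have := hec i; omega
    rwa [h2] at h1
  exact LinearMap.finrank_le_finrank_of_injective (f := Ψ.codRestrict _ hmem) (fun a b hab => hinj (by simpa using congrArg Subtype.val hab))

theorem HF_upper (p : Ideal (MvPolynomial (Fin N) k)) (hp : p.IsPrime) (hpH : HomI p) (y : Fin (d+1) → MvPolynomial (Fin N) k)
    (hy : ∀ i, (y i).IsHomogeneous 1) {ι : Type} [Fintype ι] (h : ι → MvPolynomial (Fin N) k) (e : ι → ℕ)
    (he : ∀ i, (h i).IsHomogeneous (e i)) (g : MvPolynomial (Fin N) k) (δ : ℕ) (hg : g.IsHomogeneous δ) (hgp : g ∉ p)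
    (H : ∀ s, GenBy p y h (g * s)) (n : ℕ) :
    hilbertFunction k p n ≤ Fintype.card ι * (n + δ + d).choose d := by
  rw [hilbertFunction]
  let Ψ : ((i : ι) → homogeneousSubmodule (Fin (d+1)) k (n + δ - e i)) →ₗ[k] (MvPolynomial (Fin N) k ⧸ p) :=
    ∑ i, (Ideal.Quotient.mkₐ k p).toLinearMap ∘ₗ (LinearMap.mulRight k (h i)) ∘ₗ
      (aeval y : MvPolynomial (Fin (d+1)) k →ₐ[k] _).toLinearMap ∘ₗ (Submodule.subtype _) ∘ₗ (LinearMap.proj i)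
  have hΨ : ∀ a, Ψ a = Ideal.Quotient.mk p (∑ i, aeval y (a i : MvPolynomial (Fin (d+1)) k) * h i) := by
    intro a
    rw [map_sum]
    simp [Ψ]
  have hf : Module.finrank k ((i : ι) → homogeneousSubmodule (Fin (d+1)) k (n + δ - e i)) ≤ Fintype.card ι * (n + δ + d).choose d := by
    rw [Module.finrank_pi_fintype]
    simp only [finrank_hom]
    refine (Finset.sum_le_card_nsmul _ _ ((n + δ + d).choose d) fun i _ => Nat.choose_le_choose _ (by omega)).trans ?_
    simp
  refine le_trans ?_ ((LinearMap.finrank_range_le Ψ).trans hf)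
  have := hp
  let G : (MvPolynomial (Fin N) k ⧸ p) →ₗ[k] (MvPolynomial (Fin N) k ⧸ p) := LinearMap.mulLeft k (Ideal.Quotient.mk p g)
  have hG : Function.Injective G := by
    intro a b hab
    refine mul_left_cancel₀ ?_ hab
    rwa [Ne, Ideal.Quotient.eq_zero_iff_mem]
  have hmem : ∀ x : Submodule.map (Ideal.Quotient.mkₐ k p).toLinearMap (homogeneousSubmodule (Fin N) k n),
      (G ∘ₗ Submodule.subtype _) x ∈ LinearMap.range Ψ := by
    rintro ⟨_, s, hs, rfl⟩
    obtain ⟨c, hc1, hc2, hc3⟩ := (H s).homog hpH hy e he (n := n + δ) (by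
      rw [add_comm]; exact hg.mul hs)
    refine ⟨fun i => ⟨c i, hc1 i⟩, ?_⟩
    rw [hΨ]
    have h1 := (Ideal.Quotient.eq.2 hc3).symm
    simpa [G] using h1
  exact LinearMap.finrank_le_finrank_of_injective (f := (G ∘ₗ Submodule.subtype _).codRestrict _ hmem)
    (fun a b hab => Subtype.ext (hG (by simpa using congrArg Subtype.val hab)))

theorem HF_pack (p : Ideal (MvPolynomial (Fin N) k)) (hp : p.IsPrime) (hpH : HomI p) (y : Fin (d+1) → MvPolynomial (Fin N) k)
    (hy : ∀ i, (y i).IsHomogeneous 1) (D : ℕ) (hD : ∀ n, D ≤ n → ∀ s, s.IsHomogeneous n → s ∈ p ⊔ Ideal.span (Set.range y))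
    (hind : ∀ a : MvPolynomial (Fin (d+1)) k, aeval y a ∈ p → a = 0)
    (hpe : hilbertSamuelMultiplicity k p = 4) :
    (∀ (r : ℕ) (h : Fin r → MvPolynomial (Fin N) k) (e : Fin r → ℕ) (_ : ∀ i, (h i).IsHomogeneous (e i))
      (_ : ∀ a : Fin r → MvPolynomial (Fin (d+1)) k, ∑ i, aeval y (a i) * h i ∈ p → ∀ i, a i = 0), r ≤ 4) ∧
    (∀ (r : ℕ) (h : Fin r → MvPolynomial (Fin N) k) (e : Fin r → ℕ) (_ : ∀ i, (h i).IsHomogeneous (e i))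
      (g : MvPolynomial (Fin N) k) (δ : ℕ) (_ : g.IsHomogeneous δ) (_ : g ∉ p)
      (_ : ∀ s, GenBy p y h (g * s)), 4 ≤ r) := by
  rw [hilbertSamuelMultiplicity] at hpe
  split_ifs at hpe with hex
  · have hP := hex.choose_spec
    generalize hex.choose = P at hP hpe
    -- generators from the finiteness statement
    let ι := Σ n : Fin D, Fin (Module.finrank k (homogeneousSubmodule (Fin N) k (n:ℕ)))
    let h : ι → MvPolynomial (Fin N) k := fun i => (Module.finBasis k (homogeneousSubmodule (Fin N) k (i.1:ℕ)) i.2 : MvPolynomial (Fin N) k)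
    have hh : ∀ i : ι, (h i).IsHomogeneous (i.1 : ℕ) := fun i =>
      (mem_homogeneousSubmodule _ _).1 (Module.finBasis k (homogeneousSubmodule (Fin N) k (i.1:ℕ)) i.2).2
    have hgen := genBy_of_mod (h := h) hpH hy (fun i => (i.1 : ℕ)) hh (by
      intro n s hs
      by_cases hn : D ≤ n
      · exact ⟨0, Submodule.zero_mem _, by simpa using hD n hn s hs⟩
      · refine ⟨s, ?_, by simp⟩
        push Not at hn
        have h1 := (Module.finBasis k (homogeneousSubmodule (Fin N) k n)).sum_repr ⟨s, hs⟩
        have h2 := congrArg Subtype.val h1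
        refine (Eq.subst (motive := fun z => z ∈ Submodule.span k (Set.range h)) h2 ?_ : s ∈ _)
        rw [Submodule.coe_sum]
        refine Submodule.sum_mem _ fun i _ => ?_
        rw [Submodule.coe_smul]
        exact Submodule.smul_mem _ _ (Submodule.subset_span ⟨⟨⟨n, hn⟩, i⟩, rfl⟩))
    have hu := HF_upper p hp hpH y hy h (fun i => (i.1:ℕ)) hh 1 0 (isHomogeneous_one _ _) ((Ideal.ne_top_iff_one p).1 hp.ne_top)
      (fun s => by rw [one_mul]; exact hgen s)
    have hi : ∀ n, (n + d).choose d ≤ hilbertFunction k p n := by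
      intro n
      have := HF_lower p y hy 1 0 (fun _ => 1) (fun _ => 0) (fun _ => isHomogeneous_one _ _) (fun _ => le_rfl) (by
        intro a ha i
        obtain rfl : i = 0 := Subsingleton.elim _ _
        exact hind _ (by simpa using ha)) n
      simpa using this
    have := HF_num d (hilbertFunction k p) P hP hpe hi _ _ hu
    refine ⟨?_, ?_⟩
    · intro r h e he hindep
      refine this.1 r (∑ i, e i) fun n => HF_lower p y hy r _ h e he (fun i => Finset.single_le_sum (fun _ _ => Nat.zero_le _) (Finset.mem_univ i)) hindep n
    · intro r h e he g δ hg hgp H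
      refine this.2 r δ fun n => ?_
      have := HF_upper p hp hpH y hy h e he g δ hg hgp H n
      rwa [Fintype.card_fin] at this
  · norm_num at hpe

end HILB2

section FIN4
open MvPolynomial

theorem finrank_le_four {k E : Type u} [Field k] [Field E] [Algebra k E] {N d : ℕ} (p : Ideal (MvPolynomial (Fin N) k))
    (π : MvPolynomial (Fin N) k →ₐ[k] E)
    (hπ : IntermediateField.adjoin k (Set.range (fun i => π (X i))) = ⊤) (hπp : ∀ s, π s = 0 ↔ s ∈ p)
    (y : Fin (d+1) → MvPolynomial (Fin N) k) (hs : AlgebraicIndependent k (fun i => π (y i)))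
    (K : IntermediateField k E) (hK : K = IntermediateField.adjoin k (Set.range (fun i => π (y i))))
    [FiniteDimensional K E]
    (HL : ∀ (r : ℕ) (h : Fin r → MvPolynomial (Fin N) k) (e : Fin r → ℕ) (_ : ∀ i, (h i).IsHomogeneous (e i))
      (_ : ∀ a : Fin r → MvPolynomial (Fin (d+1)) k, ∑ i, aeval y (a i) * h i ∈ p → ∀ i, a i = 0), r ≤ 4) :
    Module.finrank K E ≤ 4 := by
  have h1 : IntermediateField.adjoin K (Set.range (fun i => π (X i))) = ⊤ :=
    IntermediateField.adjoin_eq_top_of_adjoin_eq_top k hπ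
  have h2 : Algebra.adjoin K (Set.range (fun i => π (X i))) = ⊤ := by
    rw [← IntermediateField.adjoin_toSubalgebra_of_isAlgebraic (fun x _ => Algebra.IsAlgebraic.isAlgebraic x), h1, IntermediateField.top_toSubalgebra]
  have h3 : Submodule.span K (π '' {s | ∃ n, s.IsHomogeneous n}) = ⊤ := by
    rw [eq_top_iff, ← Algebra.top_toSubmodule, ← h2, Algebra.adjoin_eq_span]
    apply Submodule.span_mono
    intro x hx
    induction hx using Submonoid.closure_induction with
    | mem x hx => obtain ⟨i, rfl⟩ := hx; exact ⟨X i, ⟨1, isHomogeneous_X _ _⟩, rfl⟩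
    | one => exact ⟨1, ⟨0, isHomogeneous_one _ _⟩, map_one _⟩
    | mul x y _ _ hx hy =>
      obtain ⟨a, ⟨n, ha⟩, rfl⟩ := hx
      obtain ⟨b, ⟨m, hb⟩, rfl⟩ := hy
      exact ⟨a * b, ⟨n + m, ha.mul hb⟩, map_mul _ _ _⟩
  obtain ⟨v, hv1, -, hv3⟩ := Submodule.exists_fun_fin_finrank_span_eq K (π '' {s | ∃ n, s.IsHomogeneous n})
  have hfr : Module.finrank K E = Module.finrank K (Submodule.span K (π '' {s | ∃ n, s.IsHomogeneous n})) := by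
    rw [h3, finrank_top]
  rw [hfr]
  choose h hh hhv using hv1
  choose e he using hh
  refine HL _ h e he fun a ha => ?_
  rw [← hπp, map_sum] at ha
  have hmem : ∀ c : MvPolynomial (Fin (d+1)) k, π (aeval y c) ∈ K := by
    intro c
    have : π (aeval y c) = aeval (fun i => π (y i)) c := by
      rw [← comp_aeval_apply]
    rw [this, hK]
    have h5 : aeval (fun i => π (y i)) c ∈ Algebra.adjoin k (Set.range (fun i => π (y i))) := by
      rw [Algebra.adjoin_range_eq_range_aeval]; exact ⟨c, rfl⟩
    exact IntermediateField.algebra_adjoin_le_adjoin _ _ h5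
  have h4 := Fintype.linearIndependent_iff.1 hv3 (fun i => ⟨π (aeval y (a i)), hmem _⟩) (by
    rw [← ha]
    refine Finset.sum_congr rfl fun i _ => ?_
    rw [map_mul, hhv]
    rfl)
  intro i
  have h5 : π (aeval y (a i)) = 0 := congrArg Subtype.val (h4 i)
  rw [comp_aeval_apply] at h5
  exact (injective_iff_map_eq_zero _).1 hs _ h5

theorem nondeg {k E : Type u} [Field k] [IsAlgClosed k] [Field E] [Algebra k E] {N d : ℕ} (hN : 3 + (d+1) = N) (p : Ideal (MvPolynomial (Fin N) k))
    (hp : p.IsPrime) (hpH : HomI p)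
    (π : MvPolynomial (Fin N) k →ₐ[k] E) (hπp : ∀ s, π s = 0 ↔ s ∈ p)
    (y : Fin (d+1) → MvPolynomial (Fin N) k) (hy : ∀ i, (y i).IsHomogeneous 1) (hs : AlgebraicIndependent k (fun i => π (y i)))
    (K : IntermediateField k E) (hK : K = IntermediateField.adjoin k (Set.range (fun i => π (y i))))
    [FiniteDimensional K E] [Algebra.IsSeparable K E] (hfin : Module.finrank K E ≤ 4)
    (D : ℕ) (hD : ∀ n, D ≤ n → ∀ s, s.IsHomogeneous n → s ∈ p ⊔ Ideal.span (Set.range y))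
    (hdeg : ∀ l : MvPolynomial (Fin N) k, l.IsHomogeneous 1 → l ∈ p → l = 0)
    (G : Set (MvPolynomial (Fin N) k)) (hG : ∀ g ∈ G, g.IsHomogeneous 2 ∧ g ∈ p) :
    PDLT (MvPolynomial (Fin N) k) (MvPolynomial (Fin N) k ⧸ Ideal.span G) 9 := by
  have hyli : LinearIndependent k y := by
    have := hs.linearIndependent
    exact LinearIndependent.of_comp π.toLinearMap this
  obtain ⟨m, z, hm, hz, hli⟩ := exists_extend y hy hyli
  obtain rfl : m = 3 := by omega
  have hspan := span_eq_S1 (Sum.elim z y) (by rintro (i | i); exacts [hz i, hy i]) hli (by simp; omega)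
  rw [Set.Sum.elim_range, Submodule.span_union] at hspan
  have hw : LinearIndependent k (frame (fun i => π (y i)) (fun i => π (z i))) := by
    rw [Fintype.linearIndependent_iff]
    intro c hc
    rw [Fintype.sum_option, Fintype.sum_sum_type] at hc
    simp only [frame, Option.elim, Sum.elim_inl, Sum.elim_inr] at hc
    have hc' : C (c none) + (∑ i, c (some (Sum.inl i)) • y i + ∑ i, c (some (Sum.inr i)) • z i) ∈ p := by
      rw [← hπp]
      simp only [map_add, map_sum, map_smul]
      rw [← hc, ← MvPolynomial.algebraMap_eq, AlgHom.commutes, Algebra.algebraMap_eq_smul_one]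
    have hl : (∑ i, c (some (Sum.inl i)) • y i + ∑ i, c (some (Sum.inr i)) • z i).IsHomogeneous 1 := by
      refine IsHomogeneous.add ?_ ?_
      · exact IsHomogeneous.sum _ _ _ fun i _ => (homogeneousSubmodule (Fin N) k 1).smul_mem _ (hy i)
      · exact IsHomogeneous.sum _ _ _ fun i _ => (homogeneousSubmodule (Fin N) k 1).smul_mem _ (hz i)
    have hl0 := hpH _ hc' 1
    rw [map_add, homogeneousComponent_of_mem hl, if_pos rfl, homogeneousComponent_of_mem (isHomogeneous_C _ _), if_neg (by decide), zero_add] at hl0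
    have hl1 := hdeg _ hl hl0
    rw [hl1, add_zero] at hc'
    have hc0 : c none = 0 := by
      by_contra h0
      exact hp.ne_top (Ideal.eq_top_of_isUnit_mem _ hc' ((isUnit_iff_ne_zero.2 h0).map C))
    have h2 := Fintype.linearIndependent_iff.1 hli (Sum.elim (fun i => c (some (Sum.inr i))) (fun i => c (some (Sum.inl i)))) (by
      rw [Fintype.sum_sum_type]
      simp only [Sum.elim_inl, Sum.elim_inr]
      rw [add_comm]; exact hl1)
    rintro (_ | i | i)
    · exact hc0
    · exact h2 (Sum.inr i)
    · exact h2 (Sum.inl i)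
  set W := Submodule.span k (Set.range (frame (fun i => π (y i)) (fun i => π (z i)))) with hW
  set U := Submodule.span k (insert 1 (Set.range (fun i => π (y i)))) with hU
  have h1W : (1 : E) ∈ W := by
    rw [hW, range_frame]; exact Submodule.subset_span (by simp)
  have h1W' : (1 : Submodule k E) ≤ W := by
    rw [Submodule.one_le]; exact h1W
  have hS1 : Submodule.map π.toLinearMap (homogeneousSubmodule (Fin N) k 1) ≤ W := by
    rw [← hspan, Submodule.map_sup, sup_le_iff, Submodule.map_span, Submodule.map_span, Submodule.span_le, Submodule.span_le, hW, range_frame]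
    constructor
    · rintro _ ⟨_, ⟨i, rfl⟩, rfl⟩; exact Submodule.subset_span (by simp)
    · rintro _ ⟨_, ⟨i, rfl⟩, rfl⟩; exact Submodule.subset_span (by simp)
  have hSn : ∀ n (s : MvPolynomial (Fin N) k), s.IsHomogeneous n → π s ∈ W ^ n := by
    intro n s hsn
    have h1 : s ∈ (homogeneousSubmodule (Fin N) k 1)^n := by
      rw [homogeneousSubmodule_one_pow]; exact hsn
    have h2 : π s ∈ Submodule.map π.toLinearMap ((homogeneousSubmodule (Fin N) k 1)^n) := ⟨s, h1, rfl⟩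
    rw [Submodule.map_pow] at h2
    exact pow_le_pow_left' hS1 n h2
  have hWT : ∀ n, ∀ x ∈ W ^ n, ∃ s : MvPolynomial (Fin N) k, s.totalDegree ≤ n ∧ π s = x := by
    have h1 : W ≤ Submodule.map π.toLinearMap (restrictTotalDegree (Fin N) k 1) := by
      rw [hW, range_frame, Submodule.span_le]
      rintro _ (rfl | ⟨i, rfl⟩ | ⟨i, rfl⟩)
      · exact ⟨1, (mem_restrictTotalDegree _ _ _).2 (by simp), map_one π⟩
      · exact ⟨y i, (mem_restrictTotalDegree _ _ _).2 (hy i).totalDegree_le, rfl⟩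
      · exact ⟨z i, (mem_restrictTotalDegree _ _ _).2 (hz i).totalDegree_le, rfl⟩
    intro n
    induction n with
    | zero =>
      intro x hx
      rw [pow_zero, Submodule.mem_one] at hx
      obtain ⟨a, rfl⟩ := hx
      exact ⟨C a, by simp, by rw [← MvPolynomial.algebraMap_eq, AlgHom.commutes]⟩
    | succ n ih =>
      intro x hx
      rw [pow_succ] at hx
      induction hx using Submodule.mul_induction_on' with
      | mem_mul_mem a ha b hb =>
        obtain ⟨s, hs, rfl⟩ := ih a ha
        obtain ⟨t, ht, rfl⟩ := h1 hb
        refine ⟨s * t, (totalDegree_mul _ _).trans (add_le_add hs ((mem_restrictTotalDegree _ _ _).1 ht)), map_mul _ _ _⟩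
      | add a _ b _ h1 h2 =>
        obtain ⟨s, hs, rfl⟩ := h1
        obtain ⟨t, ht, rfl⟩ := h2
        exact ⟨s + t, (totalDegree_add _ _).trans (max_le hs ht), map_add _ _ _⟩
  have hWmono : ∀ i n, i ≤ n → W ^ i ≤ W ^ n := fun i n h => pow_le_pow_right' h1W' h
  have h1U : (1:E) ∈ U := Submodule.subset_span (by simp)
  have hM : W ^ (D + 1) ≤ U * W ^ D := by
    intro x hx
    obtain ⟨s, hs, rfl⟩ := hWT _ x hx
    rw [← sum_homogeneousComponent s, map_sum]
    refine Submodule.sum_mem _ fun i hi => ?_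
    rw [Finset.mem_range] at hi
    by_cases hiD : i ≤ D
    · rw [← one_mul (π _)]
      exact Submodule.mul_mem_mul h1U (hWmono i D hiD (hSn i _ (homogeneousComponent_isHomogeneous _ _)))
    · obtain rfl : i = D + 1 := by omega
      obtain ⟨q, hq, b', hb', hqb⟩ := Submodule.mem_sup.1 (hD (D+1) (by omega) _ (homogeneousComponent_isHomogeneous (D+1) s))
      obtain ⟨b, rfl⟩ := Ideal.mem_span_range_iff_exists_fun.1 hb'
      have h1 := congrArg (homogeneousComponent (D+1)) hqb
      rw [homogeneousComponent_of_mem (homogeneousComponent_isHomogeneous _ _), if_pos rfl, map_add, map_sum] at h1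
      simp only [hcomp_mul _ _ 1 (hy _)] at h1
      rw [← h1, map_add, (hπp _).2 (hpH q hq _), zero_add, map_sum]
      refine Submodule.sum_mem _ fun j _ => ?_
      rw [if_pos (by omega), map_mul, mul_comm (π _) (π (y j))]
      refine Submodule.mul_mem_mul (Submodule.subset_span (Set.mem_insert_of_mem _ (Set.mem_range_self j))) ?_
      exact hSn D _ (homogeneousComponent_isHomogeneous _ _)
  obtain ⟨hind, hmul⟩ := T_main (fun i => π (y i)) hs K hK (by simpa using hfin) (fun i => π (z i)) hw D hM
  choose f0 f hf0 hf hff using hmul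
  have hπa : ∀ c : MvPolynomial (Fin (d+1)) k, aeval (fun i => π (y i)) c = π (aeval y c) := fun c => by
    rw [← comp_aeval_apply]
  have hQ : QuadStr p y z (fun i j l => aeval y (homogeneousComponent 1 (f i j l))) (fun i j => aeval y (homogeneousComponent 2 (f0 i j))) := by
    refine ⟨hy, hz, ?_, ?_, ?_, ?_, ?_⟩
    · rw [sup_comm, hspan]
    · intro i j l
      have h1 : homogeneousComponent 1 (f i j l) ∈ homogeneousSubmodule (Fin (d+1)) k 1 := homogeneousComponent_isHomogeneous _ _
      rw [homogeneousSubmodule_one_eq_span_X] at h1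
      have h2 : aeval y (homogeneousComponent 1 (f i j l)) ∈ Submodule.map (aeval y : MvPolynomial (Fin (d+1)) k →ₐ[k] _).toLinearMap (Submodule.span k (Set.range X)) := ⟨_, h1, rfl⟩
      rw [Submodule.map_span, ← Set.range_comp] at h2
      have h3 : ((aeval y : MvPolynomial (Fin (d+1)) k →ₐ[k] _).toLinearMap ∘ (X : Fin (d+1) → MvPolynomial (Fin (d+1)) k)) = y := by
        funext i; simp
      rw [h3] at h2
      exact h2
    · intro i j
      rw [Algebra.adjoin_range_eq_range_aeval]; exact ⟨_, rfl⟩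
    · intro i j
      have h1 := hff i j
      simp only [hπa] at h1
      have h2 : z i * z j - (aeval y (f0 i j) + ∑ l, aeval y (f i j l) * z l) ∈ p := by
        rw [← hπp, map_sub, map_mul, h1, map_add, map_sum]
        simp
      have h3 := hpH _ h2 2
      rw [map_sub, map_add, map_sum, homogeneousComponent_of_mem ((hz i).mul (hz j)), if_pos rfl, hcomp_aeval hy] at h3
      simp only [hcomp_mul _ _ 1 (hz _), hcomp_aeval hy] at h3
      rw [show z i * z j - ∑ l, aeval y (homogeneousComponent 1 (f i j l)) * z l - aeval y (homogeneousComponent 2 (f0 i j)) =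
        z i * z j - (aeval y (homogeneousComponent 2 (f0 i j)) + ∑ l, aeval y (homogeneousComponent 1 (f i j l)) * z l) by ring]
      simpa using h3
    · intro c e hc he hce
      rw [Algebra.adjoin_range_eq_range_aeval] at hc
      simp only [Algebra.adjoin_range_eq_range_aeval] at he
      obtain ⟨c, rfl⟩ := hc
      choose e' he' using he
      obtain rfl : (fun i => aeval y (e' i)) = e := funext he'
      have hmem : ∀ c : MvPolynomial (Fin (d+1)) k, π (aeval y c) ∈ K := by
        intro c
        rw [← hπa, hK]
        have h5 : aeval (fun i => π (y i)) c ∈ Algebra.adjoin k (Set.range (fun i => π (y i))) := by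
          rw [Algebra.adjoin_range_eq_range_aeval]; exact ⟨c, rfl⟩
        exact IntermediateField.algebra_adjoin_le_adjoin _ _ h5
      have h1 := hind (π (aeval y c)) (fun i => π (aeval y (e' i))) (hmem _) (fun _ => hmem _) (by
        have := (hπp _).2 hce
        rw [map_add, map_sum] at this
        simp only [map_mul] at this
        exact this)
      have hz0 : ∀ c : MvPolynomial (Fin (d+1)) k, π (aeval y c) = 0 → aeval y c = 0 := by
        intro c hc
        rw [← hπa] at hc
        rw [(injective_iff_map_eq_zero _).1 hs _ hc, map_zero]
      exact ⟨hz0 _ h1.1, fun i => hz0 _ (h1.2 i)⟩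
  exact hQ.pd G hG

end FIN4

section PDL
open MvPolynomial

theorem relprime_syz {D : Type*} [CommRing D] [IsDomain D] [UniqueFactorizationMonoid D] (p q : D) (h : IsRelPrime p q) (a b : D)
    (hab : a * p + b * q = 0) : ∃ c, a = c * q ∧ b = -(c * p) := by
  by_cases hq : q = 0
  · subst hq
    have hu : IsUnit p := h dvd_rfl (dvd_zero p)
    obtain ⟨v, rfl⟩ := hu
    have ha : a = 0 := by
      have : a * (v : D) = 0 := by simpa using hab
      exact (mul_eq_zero.1 this).resolve_right v.ne_zero
    exact ⟨-(b * ↑v⁻¹), by simp [ha], by simp⟩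
  · have h1 : q ∣ a * p := ⟨-b, by linear_combination hab⟩
    obtain ⟨c, rfl⟩ := h.symm.dvd_of_dvd_mul_right h1
    refine ⟨c, mul_comm _ _, ?_⟩
    apply mul_right_cancel₀ hq
    linear_combination hab

variable {k : Type u} [Field k] {N : ℕ}

theorem ufd_quot {r : ℕ} (ls : Fin r → MvPolynomial (Fin N) k) (hls : ∀ i, (ls i).IsHomogeneous 1) (hli : LinearIndependent k ls) :
    IsDomain (MvPolynomial (Fin N) k ⧸ Ideal.span (Set.range ls)) ∧
    ∃ _ : IsDomain (MvPolynomial (Fin N) k ⧸ Ideal.span (Set.range ls)), UniqueFactorizationMonoid (MvPolynomial (Fin N) k ⧸ Ideal.span (Set.range ls)) := by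
  obtain ⟨m, v, hm, hv, hind⟩ := exists_extend ls hls hli
  have hbij := aeval_bij (Sum.elim v ls) (by rintro (i | i); exacts [hv i, hls i]) hind (by simp; omega)
  let e := AlgEquiv.ofBijective _ hbij
  let ρ : MvPolynomial (Fin N) k →ₐ[k] MvPolynomial (Fin m) k :=
    (aeval (Sum.elim (X : Fin m → MvPolynomial (Fin m) k) (fun _ => 0)) : MvPolynomial (Fin m ⊕ Fin r) k →ₐ[k] _).comp (e.symm : MvPolynomial (Fin N) k →ₐ[k] _)
  have hev : ∀ i, e.symm (v i) = X (Sum.inl i) := by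
    intro i; rw [AlgEquiv.symm_apply_eq]; simp [e]
  have hel : ∀ i, e.symm (ls i) = X (Sum.inr i) := by
    intro i; rw [AlgEquiv.symm_apply_eq]; simp [e]
  have hρl : ∀ i, ρ (ls i) = 0 := by
    intro i; simp [ρ, hel]
  have hρv : ∀ i, ρ (v i) = X i := by
    intro i; simp [ρ, hev]
  have hcomp : ∀ s, Ideal.Quotient.mk (Ideal.span (Set.range ls)) (aeval v (ρ s)) = Ideal.Quotient.mk (Ideal.span (Set.range ls)) s := by
    have : ((Ideal.Quotient.mkₐ k (Ideal.span (Set.range ls))).comp ((aeval v : MvPolynomial (Fin m) k →ₐ[k] MvPolynomial (Fin N) k).comp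
      (ρ.comp (e : MvPolynomial (Fin m ⊕ Fin r) k →ₐ[k] _)))) = (Ideal.Quotient.mkₐ k (Ideal.span (Set.range ls))).comp (e : MvPolynomial (Fin m ⊕ Fin r) k →ₐ[k] _) := by
      apply MvPolynomial.algHom_ext
      have h1 : ∀ i, e (X (Sum.inl i)) = v i := fun i => by rw [← hev]; simp
      have h2 : ∀ i, e (X (Sum.inr i)) = ls i := fun i => by rw [← hel]; simp
      rintro (i | i)
      · simp only [AlgHom.comp_apply, AlgEquiv.coe_algHom, h1, hρv, aeval_X]
      · simp only [AlgHom.comp_apply, AlgEquiv.coe_algHom, h2, hρl, map_zero]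
        exact (Ideal.Quotient.eq_zero_iff_mem.2 (Ideal.subset_span (Set.mem_range_self i))).symm
    intro s
    have h3 := DFunLike.congr_fun this (e.symm s)
    simpa using h3
  let φ : (MvPolynomial (Fin N) k ⧸ Ideal.span (Set.range ls)) →+* MvPolynomial (Fin m) k :=
    Ideal.Quotient.lift _ ρ.toRingHom (by
      intro a ha
      have : Ideal.span (Set.range ls) ≤ RingHom.ker ρ.toRingHom := by
        rw [Ideal.span_le]; rintro _ ⟨i, rfl⟩; exact hρl i
      exact this ha)
  have hφ : Function.Bijective φ := by
    constructor
    · rw [injective_iff_map_eq_zero]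
      intro a ha
      obtain ⟨s, rfl⟩ := Ideal.Quotient.mk_surjective a
      have h1 : ρ s = 0 := ha
      rw [← hcomp, h1]; simp
    · intro s
      refine ⟨Ideal.Quotient.mk _ (aeval v s), ?_⟩
      have h1 : ρ (aeval v s) = s := by
        have : ρ.comp (aeval v : MvPolynomial (Fin m) k →ₐ[k] MvPolynomial (Fin N) k) = AlgHom.id k _ := by
          apply MvPolynomial.algHom_ext
          intro i; rw [AlgHom.comp_apply, aeval_X, hρv, AlgHom.id_apply]
        exact DFunLike.congr_fun this s
      exact h1
  let ε := RingEquiv.ofBijective φ hφ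
  have hdom : IsDomain (MvPolynomial (Fin N) k ⧸ Ideal.span (Set.range ls)) := ε.toMulEquiv.isDomain _
  exact ⟨hdom, hdom, ε.symm.toMulEquiv.uniqueFactorizationMonoid inferInstance⟩

theorem pdlt_prod {R A B : Type u} [CommRing R] [AddCommGroup A] [Module R A] [AddCommGroup B] [Module R B] (n : ℕ) (hA : PDLT R A n) (hB : PDLT R B n) :
    PDLT R (A × B) n :=
  pdlt_mid (LinearMap.inl R A B) (LinearMap.snd R A B) LinearMap.inl_injective LinearMap.snd_surjective
    (Function.Exact.inl_snd) n hA hB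

/-- over a quotient `D` of `R` that is a UFD. -/
theorem pdlt_two {R : Type u} [CommRing R] (L : Ideal R) (h1 : IsDomain (R ⧸ L)) (h2 : UniqueFactorizationMonoid (R ⧸ L)) (n : ℕ)
    (hn : PDLT R (R ⧸ L) (n+1)) (a b : R) : PDLT R (R ⧸ (L ⊔ Ideal.span {a, b})) (n + 3) := by
  set a' := Ideal.Quotient.mk L a with ha'
  set b' := Ideal.Quotient.mk L b with hb'
  have hle : L ≤ L ⊔ Ideal.span {a, b} := le_sup_left
  let θ : (R ⧸ L) →ₗ[R] (R ⧸ (L ⊔ Ideal.span {a, b})) := Submodule.mapQ L (L ⊔ Ideal.span {a, b}) LinearMap.id hle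
  have hθ : ∀ s, θ (Ideal.Quotient.mk L s) = Ideal.Quotient.mk _ s := fun s => rfl
  let J : Submodule R (R ⧸ L) := (Ideal.span {a', b'}).restrictScalars R
  have hθs : Function.Surjective θ := by
    intro x
    obtain ⟨s, rfl⟩ := Ideal.Quotient.mk_surjective x
    exact ⟨Ideal.Quotient.mk L s, rfl⟩
  have hker : Function.Exact J.subtype θ := by
    intro x
    obtain ⟨s, rfl⟩ := Ideal.Quotient.mk_surjective x
    rw [hθ, Ideal.Quotient.eq_zero_iff_mem]
    have h3 : Set.range J.subtype = (J : Set (R ⧸ L)) := by simp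
    rw [h3]
    have h4 : s ∈ L ⊔ Ideal.span {a, b} ↔ Ideal.Quotient.mk L s ∈ Ideal.map (Ideal.Quotient.mk L) (Ideal.span {a, b}) := by
      rw [← Ideal.mem_comap, Ideal.comap_map_of_surjective _ Ideal.Quotient.mk_surjective, sup_comm]
      simp [← RingHom.ker_eq_comap_bot]
    rw [h4, Ideal.map_span, Set.image_pair]
    rfl
  have hJ : PDLT R J (n + 2) := by
    by_cases h0 : a' = 0 ∧ b' = 0
    · have : Subsingleton J := by
        rw [Submodule.subsingleton_iff_eq_bot, eq_bot_iff]
        intro x hx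
        have h3 : x ∈ Ideal.span {a', b'} := hx
        rw [h0.1, h0.2] at h3
        simpa using h3
      have e : PUnit.{u+1} ≃ₗ[R] J := 0
      have hp : PDLT R PUnit.{u+1} 1 := pdlt_proj.2 inferInstance
      exact pdlt_mono (by omega) (pdlt_equiv e hp)
    · obtain ⟨a'', b'', c, hrel, hca, hcb, hc⟩ : ∃ a'' b'' c : R ⧸ L, IsRelPrime a'' b'' ∧ c * a'' = a' ∧ c * b'' = b' ∧ c ≠ 0 := by
        by_cases ha : a' = 0
        · have hb : b' ≠ 0 := fun h => h0 ⟨ha, h⟩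
          obtain ⟨x, y, c, h1, h2, h3⟩ := UniqueFactorizationMonoid.exists_reduced_factors b' hb a'
          exact ⟨y, x, c, h1.symm, h3, h2, by rintro rfl; exact hb (by rw [← h2, zero_mul])⟩
        · obtain ⟨x, y, c, h1, h2, h3⟩ := UniqueFactorizationMonoid.exists_reduced_factors a' ha b'
          exact ⟨x, y, c, h1, h2, h3, by rintro rfl; exact ha (by rw [← h2, zero_mul])⟩
      have hne : ¬ (a'' = 0 ∧ b'' = 0) := by
        rintro ⟨h3, h4⟩; apply h0; rw [← hca, ← hcb, h3, h4]; simp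
      let α : (R ⧸ L) →ₗ[R] (R ⧸ L) × (R ⧸ L) := (LinearMap.mulRight R b'').prod (LinearMap.mulRight R (-a''))
      let β0 : (R ⧸ L) × (R ⧸ L) →ₗ[R] (R ⧸ L) := (LinearMap.mulRight R a').coprod (LinearMap.mulRight R b')
      have hβ0 : ∀ x, β0 x = x.1 * a' + x.2 * b' := fun x => by simp [β0]
      let β : (R ⧸ L) × (R ⧸ L) →ₗ[R] J := β0.codRestrict J (fun x => by
        show _ ∈ Ideal.span {a', b'}
        rw [hβ0]
        exact Ideal.mem_span_pair.2 ⟨_, _, rfl⟩)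
      have hβs : Function.Surjective β := by
        rintro ⟨x, hx⟩
        have hx' : x ∈ Ideal.span {a', b'} := hx
        obtain ⟨s, t, hst⟩ := Ideal.mem_span_pair.1 hx'
        exact ⟨(s, t), Subtype.ext ((hβ0 _).trans hst)⟩
      have hαi : Function.Injective α := by
        rw [injective_iff_map_eq_zero]
        intro x hx
        have h3 : x * b'' = 0 := congrArg Prod.fst hx
        have h4 : x * (-a'') = 0 := congrArg Prod.snd hx
        by_contra hx0
        exact hne ⟨by simpa [hx0] using h4, by simpa [hx0] using h3⟩
      have hex : Function.Exact α β := by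
        rintro ⟨s, t⟩
        have h3 : β (s, t) = 0 ↔ s * a' + t * b' = 0 := by
          rw [← hβ0 (s,t)]
          exact ⟨fun h => congrArg Subtype.val h, fun h => Subtype.ext h⟩
        rw [h3]
        constructor
        · intro h
          rw [← hca, ← hcb] at h
          have h5 : c * (s * a'' + t * b'') = 0 := by linear_combination h
          obtain ⟨e, he1, he2⟩ := relprime_syz a'' b'' hrel s t ((mul_eq_zero.1 h5).resolve_left hc)
          exact ⟨e, Prod.ext he1.symm (by rw [he2]; show e * (-a'') = _; ring)⟩
        · rintro ⟨e, he⟩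
          have h5 : e * b'' = s := congrArg Prod.fst he
          have h6 : e * (-a'') = t := congrArg Prod.snd he
          rw [← h5, ← h6, ← hca, ← hcb]; ring
      exact pdlt_right α β hαi hβs hex (n+1) hn (pdlt_mono (by omega) (pdlt_prod _ hn hn))
  exact pdlt_right J.subtype θ J.injective_subtype hθs hker (n+2) hJ (pdlt_mono (by omega) hn)

end PDL

section LEMF
open MvPolynomial

/-- colon computation. -/
theorem colon_aux {R : Type u} [CommRing R] [IsDomain R] (x : R) (hx : x ≠ 0) (h1 : IsDomain (R ⧸ Ideal.span {x})) (h2 : UniqueFactorizationMonoid (R ⧸ Ideal.span {x}))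
    (q1 q2 : R) (hrel : IsRelPrime (Ideal.Quotient.mk (Ideal.span {x}) q1) (Ideal.Quotient.mk (Ideal.span {x}) q2)) (L : Ideal R) (s : R)
    (hs : x * s ∈ Ideal.span {x} * L ⊔ Ideal.span {q1, q2}) : s ∈ L ⊔ Ideal.span {q1, q2} := by
  obtain ⟨t', ht', w, hw, hsum⟩ := Submodule.mem_sup.1 hs
  obtain ⟨t, ht, rfl⟩ := Ideal.mem_span_singleton_mul.1 ht'
  obtain ⟨a, b, rfl⟩ := Ideal.mem_span_pair.1 hw
  have h3 : Ideal.Quotient.mk (Ideal.span {x}) a * Ideal.Quotient.mk (Ideal.span {x}) q1 + Ideal.Quotient.mk (Ideal.span {x}) b * Ideal.Quotient.mk (Ideal.span {x}) q2 = 0 := by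
    rw [← map_mul, ← map_mul, ← map_add, Ideal.Quotient.eq_zero_iff_mem, Ideal.mem_span_singleton]
    exact ⟨s - t, by linear_combination hsum⟩
  obtain ⟨c', hc1, hc2⟩ := relprime_syz _ _ hrel _ _ h3
  obtain ⟨c, rfl⟩ := Ideal.Quotient.mk_surjective c'
  rw [← map_mul, Ideal.Quotient.eq, Ideal.mem_span_singleton] at hc1
  rw [← map_mul, ← map_neg, Ideal.Quotient.eq, Ideal.mem_span_singleton] at hc2
  obtain ⟨e, he⟩ := hc1
  obtain ⟨f, hf⟩ := hc2
  have h4 : s = t + (e * q1 + f * q2) := by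
    apply mul_left_cancel₀ hx
    linear_combination -hsum + q1 * he + q2 * hf
  rw [h4]
  exact Submodule.add_mem_sup ht (Ideal.mem_span_pair.2 ⟨e, f, rfl⟩)

theorem relprime_of_height {R : Type u} [CommRing R] [IsNoetherianRing R] (x : R) (h1 : IsDomain (R ⧸ Ideal.span {x})) (h2 : UniqueFactorizationMonoid (R ⧸ Ideal.span {x}))
    (q1 q2 : R) (hht : ∀ P : Ideal R, P.IsPrime → x ∈ P → q1 ∈ P → q2 ∈ P → 3 ≤ P.height) :
    IsRelPrime (Ideal.Quotient.mk (Ideal.span {x}) q1) (Ideal.Quotient.mk (Ideal.span {x}) q2) := by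
  have hgen : ∀ h : R, (Ideal.span {Ideal.Quotient.mk (Ideal.span {x}) h}).IsPrime → Ideal.Quotient.mk (Ideal.span {x}) h ∣ Ideal.Quotient.mk (Ideal.span {x}) q1 →
      Ideal.Quotient.mk (Ideal.span {x}) h ∣ Ideal.Quotient.mk (Ideal.span {x}) q2 → False := by
    intro h hp hd1 hd2
    let P := Ideal.comap (Ideal.Quotient.mk (Ideal.span {x})) (Ideal.span {Ideal.Quotient.mk (Ideal.span {x}) h})
    have hP : P.IsPrime := Ideal.comap_isPrime _ _
    have hPe : P = Ideal.span {h, x} := by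
      have : Ideal.span {Ideal.Quotient.mk (Ideal.span {x}) h} = Ideal.map (Ideal.Quotient.mk (Ideal.span {x})) (Ideal.span {h}) := by
        rw [Ideal.map_span, Set.image_singleton]
      simp only [P]
      rw [this, Ideal.comap_map_of_surjective _ Ideal.Quotient.mk_surjective, ← RingHom.ker_eq_comap_bot, Ideal.mk_ker, Ideal.span_insert]
    have h3 := hht P hP (by rw [hPe]; exact Ideal.subset_span (by simp)) (Ideal.mem_comap.2 (Ideal.mem_span_singleton.2 hd1)) (Ideal.mem_comap.2 (Ideal.mem_span_singleton.2 hd2))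
    classical
    have h4 := Ideal.height_le_card_of_mem_minimalPrimes_span_finset (s := ({h, x} : Finset R)) (p := P) (by
      have : (Ideal.span (({h, x} : Finset R) : Set R)) = P := by rw [hPe]; simp
      rw [this, Ideal.minimalPrimes_eq_subsingleton_self]; rfl)
    have h5 : ((({h, x} : Finset R).card : ℕ) : ℕ∞) ≤ 2 := by exact_mod_cast Finset.card_le_two
    have h6 := h3.trans (h4.trans h5)
    exact absurd h6 (by decide)
  apply WfDvdMonoid.isRelPrime_of_no_irreducible_factors
  · rintro ⟨h3, h4⟩
    refine hgen 0 ?_ (by rw [h3]; exact dvd_zero _) (by rw [h4]; exact dvd_zero _)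
    rw [map_zero, Ideal.span_singleton_eq_bot.2 rfl]
    exact Ideal.isPrime_bot
  · intro z hz hz1 hz2
    obtain ⟨h, rfl⟩ := Ideal.Quotient.mk_surjective z
    exact hgen h ((Ideal.span_singleton_prime hz.ne_zero).2 (UniqueFactorizationMonoid.irreducible_iff_prime.1 hz)) hz1 hz2

theorem pdlt_ext {R : Type u} [CommRing R] (x : R) (J I K : Ideal R) (n : ℕ) (hJ : ∀ s, x * s ∈ I ↔ s ∈ J) (hK : K = Ideal.span {x} ⊔ I)
    (h1 : PDLT R (R ⧸ J) n) (h2 : PDLT R (R ⧸ K) n) : PDLT R (R ⧸ I) n := by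
  let μ : (R ⧸ J) →ₗ[R] (R ⧸ I) := Submodule.mapQ J I (LinearMap.mulLeft R x) (fun s hs => (hJ s).2 hs)
  let θ : (R ⧸ I) →ₗ[R] (R ⧸ K) := Submodule.mapQ I K LinearMap.id (by rw [hK]; exact le_sup_right)
  have hμ : ∀ s, μ (Ideal.Quotient.mk J s) = Ideal.Quotient.mk I (x * s) := fun s => rfl
  have hθ : ∀ s, θ (Ideal.Quotient.mk I s) = Ideal.Quotient.mk K s := fun s => rfl
  refine pdlt_mid μ θ ?_ ?_ ?_ n h1 h2
  · rw [injective_iff_map_eq_zero]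
    intro a ha
    obtain ⟨s, rfl⟩ := Ideal.Quotient.mk_surjective a
    rw [hμ, Ideal.Quotient.eq_zero_iff_mem] at ha
    exact Ideal.Quotient.eq_zero_iff_mem.2 ((hJ s).1 ha)
  · intro a
    obtain ⟨s, rfl⟩ := Ideal.Quotient.mk_surjective a
    exact ⟨_, hθ s⟩
  · intro a
    obtain ⟨s, rfl⟩ := Ideal.Quotient.mk_surjective a
    rw [hθ, Ideal.Quotient.eq_zero_iff_mem, hK]
    constructor
    · intro h
      obtain ⟨a, ha, b, hb, hab⟩ := Submodule.mem_sup.1 h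
      obtain ⟨c, rfl⟩ := Ideal.mem_span_singleton.1 ha
      refine ⟨Ideal.Quotient.mk J c, ?_⟩
      rw [hμ, Ideal.Quotient.eq, ← hab]
      have : x * c - (x * c + b) = -b := by ring
      rw [this]; exact I.neg_mem hb
    · rintro ⟨b, hb⟩
      obtain ⟨c, rfl⟩ := Ideal.Quotient.mk_surjective b
      rw [hμ, Ideal.Quotient.eq] at hb
      have : s = x * c - (x * c - s) := by ring
      rw [this]
      exact Submodule.sub_mem _ (Ideal.mem_sup_left (Ideal.mem_span_singleton.2 ⟨c, rfl⟩)) (Ideal.mem_sup_right hb)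

theorem lemF {k : Type u} [Field k] {N : ℕ} (x : MvPolynomial (Fin N) k) (hx : x.IsHomogeneous 1) (hx0 : x ≠ 0) (r : ℕ)
    (ls : Fin r → MvPolynomial (Fin N) k) (hls : ∀ i, (ls i).IsHomogeneous 1) (hli : LinearIndependent k ls)
    (q1 q2 : MvPolynomial (Fin N) k) (hht : ∀ P : Ideal (MvPolynomial (Fin N) k), P.IsPrime → x ∈ P → q1 ∈ P → q2 ∈ P → 3 ≤ P.height)
    (n : ℕ) (hn : r + 3 ≤ n) (hn' : 4 ≤ n) :
    PDLT (MvPolynomial (Fin N) k) (MvPolynomial (Fin N) k ⧸ (Ideal.span {x} * Ideal.span (Set.range ls) ⊔ Ideal.span {q1, q2})) n := by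
  have hpd : ∀ {r : ℕ} (ls : Fin r → MvPolynomial (Fin N) k) (hls : ∀ i, (ls i).IsHomogeneous 1) (hli : LinearIndependent k ls),
      PDLT (MvPolynomial (Fin N) k) (MvPolynomial (Fin N) k ⧸ (Ideal.span (Set.range ls) ⊔ Ideal.span {q1, q2})) (r + 3) := by
    intro r ls hls hli
    obtain ⟨h1, _, h2⟩ := ufd_quot ls hls hli
    exact pdlt_two _ h1 h2 r (pdlt_of_adjoin ls hls hli _ Algebra.subset_adjoin) q1 q2
  have hxli : LinearIndependent k (fun _ : Fin 1 => x) := by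
    rw [linearIndependent_unique_iff]; exact hx0
  have hr : Set.range (fun _ : Fin 1 => x) = {x} := by simp
  have hx1 := hpd (fun _ : Fin 1 => x) (fun _ => hx) hxli
  obtain ⟨h1, _, h2⟩ := ufd_quot (fun _ : Fin 1 => x) (fun _ => hx) hxli
  rw [hr] at hx1 h1 
  have h2' : UniqueFactorizationMonoid (MvPolynomial (Fin N) k ⧸ Ideal.span {x}) := by
    obtain ⟨_, _, h2⟩ := ufd_quot (fun _ : Fin 1 => x) (fun _ => hx) hxli
    rw [hr] at h2
    exact h2
  have hrel := relprime_of_height x h1 h2' q1 q2 hht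
  refine pdlt_ext x (Ideal.span (Set.range ls) ⊔ Ideal.span {q1, q2}) _ (Ideal.span {x} ⊔ Ideal.span {q1, q2}) n ?_ ?_ 
    (pdlt_mono hn (hpd ls hls hli)) (pdlt_mono (by omega) hx1)
  · intro s
    refine ⟨colon_aux x hx0 h1 h2' q1 q2 hrel _ s, fun hs => ?_⟩
    obtain ⟨a, ha, b, hb, rfl⟩ := Submodule.mem_sup.1 hs
    rw [mul_add]
    exact Submodule.add_mem_sup (Ideal.mul_mem_mul (Ideal.mem_span_singleton_self x) ha) (Ideal.mul_mem_left _ _ hb)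
  · have hle : Ideal.span {x} * Ideal.span (Set.range ls) ≤ Ideal.span {x} := Ideal.mul_le_left
    rw [← sup_assoc, sup_eq_left.2 hle]

end LEMF

section DEGEN
open MvPolynomial

theorem binary_zero {k : Type u} [Field k] [IsAlgClosed k] (a b c : k) :
    ∃ s t : k, (s ≠ 0 ∨ t ≠ 0) ∧ a * s ^ 2 + b * (s * t) + c * t ^ 2 = 0 := by
  by_cases ha : a = 0
  · exact ⟨1, 0, Or.inl one_ne_zero, by simp [ha]⟩
  · obtain ⟨s, hs⟩ := IsAlgClosed.exists_root (Polynomial.C a * Polynomial.X ^ 2 + Polynomial.C b * Polynomial.X + Polynomial.C c)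
      (by rw [Polynomial.degree_quadratic ha]; decide)
    refine ⟨s, 1, Or.inr one_ne_zero, ?_⟩
    simpa [Polynomial.IsRoot] using hs

theorem lin_alg {k : Type u} [Field k] [IsAlgClosed k] (V : Submodule k (Fin 3 → k)) (hV : V ≠ ⊤)
    (hz : ∀ s t : k, (s ≠ 0 ∨ t ≠ 0) → ∃ w ∈ V, w 0 * s ^ 2 + w 1 * (s * t) + w 2 * t ^ 2 ≠ 0) :
    ∃ α β : k, (α ≠ 0 ∨ β ≠ 0) ∧ ![α ^ 2, 2 * (α * β), β ^ 2] ∈ V := by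
  obtain ⟨z, hzV⟩ : ∃ z, z ∉ V := by
    by_contra h
    push Not at h
    exact hV (eq_top_iff.2 fun z _ => h z)
  obtain ⟨φ, hφz, hφ⟩ := Submodule.exists_le_ker_of_notMem hzV
  have h2 : 2 ≤ Module.finrank k V := by
    by_contra hlt
    have h1 : Module.finrank k V ≤ 1 := by omega
    obtain ⟨v, hv⟩ := finrank_le_one_iff.1 h1
    obtain ⟨s, t, hst, h0⟩ := binary_zero ((v : Fin 3 → k) 0) ((v : Fin 3 → k) 1) ((v : Fin 3 → k) 2)
    obtain ⟨w, hw, hne⟩ := hz s t hst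
    obtain ⟨c, hc⟩ := hv ⟨w, hw⟩
    apply hne
    have hc' : w = c • (v : Fin 3 → k) := by
      have := congrArg Subtype.val hc
      exact this.symm
    rw [hc']
    simp only [Pi.smul_apply, smul_eq_mul]
    linear_combination c * h0
  have hker : V = LinearMap.ker φ := by
    apply Submodule.eq_of_le_of_finrank_le hφ
    have hlt : LinearMap.ker φ < ⊤ := lt_top_iff_ne_top.2 (by
      intro h
      apply hφz
      have : z ∈ LinearMap.ker φ := by rw [h]; trivial
      exact this)
    have := Submodule.finrank_lt_finrank_of_lt hlt
    rw [finrank_top, Module.finrank_fin_fun] at this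
    omega
  have hsum : ∀ w : Fin 3 → k, φ w = w 0 * φ (Pi.single 0 1) + w 1 * φ (Pi.single 1 1) + w 2 * φ (Pi.single 2 1) := by
    intro w
    conv_lhs => rw [pi_eq_sum_univ' w]
    rw [map_sum, Fin.sum_univ_three]
    simp only [map_smul, smul_eq_mul]
  obtain ⟨s, t, hst, h0⟩ := binary_zero (φ (Pi.single 0 1)) (2 * φ (Pi.single 1 1)) (φ (Pi.single 2 1))
  refine ⟨s, t, hst, ?_⟩
  rw [hker, LinearMap.mem_ker, hsum]
  simp only [Matrix.cons_val_zero, Matrix.cons_val_one, Matrix.cons_val]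
  linear_combination h0

variable {k : Type u} [Field k] {N m : ℕ}

/-- spanning of linear forms -/
def LSpan (x : MvPolynomial (Fin N) k) (y : Fin m → MvPolynomial (Fin N) k) (u v : MvPolynomial (Fin N) k) : Prop :=
  ∀ l : MvPolynomial (Fin N) k, l.IsHomogeneous 1 → ∃ (a b c : k) (e : Fin m → k),
    l = C a * u + C b * v + C c * x + ∑ j, C (e j) * y j

/-- evaluation points -/
def LEval (x : MvPolynomial (Fin N) k) (y : Fin m → MvPolynomial (Fin N) k) (u v : MvPolynomial (Fin N) k) : Prop :=
  ∀ s t : k, ∃ ε : MvPolynomial (Fin N) k →ₐ[k] k, ε u = s ∧ ε v = t ∧ ε x = 0 ∧ ∀ j, ε (y j) = 0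

/-- the ideal of `x` and `y` -/
noncomputable abbrev JJ (x : MvPolynomial (Fin N) k) (y : Fin m → MvPolynomial (Fin N) k) : Ideal (MvPolynomial (Fin N) k) :=
  Ideal.span {x} ⊔ Ideal.span (Set.range y)

variable {x : MvPolynomial (Fin N) k} {y : Fin m → MvPolynomial (Fin N) k} {u v : MvPolynomial (Fin N) k}

theorem x_mem_JJ : x ∈ JJ x y := Ideal.mem_sup_left (Ideal.mem_span_singleton_self x)
theorem y_mem_JJ (j : Fin m) : y j ∈ JJ x y := Ideal.mem_sup_right (Ideal.subset_span (Set.mem_range_self j))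

theorem lin_mod (hsp : LSpan x y u v) (l : MvPolynomial (Fin N) k) (hl : l.IsHomogeneous 1) :
    ∃ a b : k, l - (C a * u + C b * v) ∈ JJ x y := by
  obtain ⟨a, b, c, e, rfl⟩ := hsp l hl
  refine ⟨a, b, ?_⟩
  have : C a * u + C b * v + C c * x + ∑ j, C (e j) * y j - (C a * u + C b * v) = C c * x + ∑ j, C (e j) * y j := by ring
  rw [this]
  exact (JJ x y).add_mem (Ideal.mul_mem_left _ _ x_mem_JJ) (Ideal.sum_mem _ fun j _ => Ideal.mul_mem_left _ _ (y_mem_JJ j))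

theorem quad_mod (hsp : LSpan x y u v) (g : MvPolynomial (Fin N) k) (hg : g.IsHomogeneous 2) :
    ∃ w : Fin 3 → k, g - (C (w 0) * u ^ 2 + C (w 1) * (u * v) + C (w 2) * v ^ 2) ∈ JJ x y := by
  have hg' : g ∈ homogeneousSubmodule (Fin N) k 1 * homogeneousSubmodule (Fin N) k 1 := by
    rw [← pow_two, homogeneousSubmodule_one_pow]; exact hg
  induction hg' using Submodule.mul_induction_on' with
  | mem_mul_mem l hl l' hl' =>
    obtain ⟨a, b, h⟩ := lin_mod hsp l hl
    obtain ⟨a', b', h'⟩ := lin_mod hsp l' hl'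
    refine ⟨![a * a', a * b' + b * a', b * b'], ?_⟩
    simp only [Matrix.cons_val_zero, Matrix.cons_val_one, Matrix.cons_val, map_add, map_mul]
    have : l * l' - (C a * C a' * u ^ 2 + (C a * C b' + C b * C a') * (u * v) + C b * C b' * v ^ 2) =
        l' * (l - (C a * u + C b * v)) + (C a * u + C b * v) * (l' - (C a' * u + C b' * v)) := by ring
    rw [this]
    exact (JJ x y).add_mem (Ideal.mul_mem_left _ _ h) (Ideal.mul_mem_left _ _ h')
  | add g hg1 g' hg2 h h' =>
    have e2 : ∀ g, g ∈ homogeneousSubmodule (Fin N) k 1 * homogeneousSubmodule (Fin N) k 1 → g.IsHomogeneous 2 := by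
      intro g hg; rw [← pow_two, homogeneousSubmodule_one_pow] at hg; exact hg
    obtain ⟨w, h⟩ := h (e2 _ hg1)
    obtain ⟨w', h'⟩ := h' (e2 _ hg2)
    refine ⟨w + w', ?_⟩
    have := (JJ x y).add_mem h h'
    simp only [Pi.add_apply, map_add]
    have e : g + g' - ((C (w 0) + C (w' 0)) * u ^ 2 + (C (w 1) + C (w' 1)) * (u * v) + (C (w 2) + C (w' 2)) * v ^ 2)
      = g - (C (w 0) * u ^ 2 + C (w 1) * (u * v) + C (w 2) * v ^ 2) + (g' - (C (w' 0) * u ^ 2 + C (w' 1) * (u * v) + C (w' 2) * v ^ 2)) := by ring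
    rw [e]; exact this

/-- expansion of a quadric in the ideal of `x`, `y` -/
theorem exp_quad (hsp : LSpan x y u v) (hx : x.IsHomogeneous 1) (hy : ∀ i, (y i).IsHomogeneous 1)
    (g : MvPolynomial (Fin N) k) (hg : g.IsHomogeneous 2) (hgJ : g ∈ JJ x y) :
    ∃ (l : MvPolynomial (Fin N) k) (c0 c1 c2 : MvPolynomial (Fin m) k), l.IsHomogeneous 1 ∧ c1.IsHomogeneous 1 ∧ c2.IsHomogeneous 1 ∧
      g = x * l + aeval y c0 + aeval y c1 * u + aeval y c2 * v := by
  obtain ⟨a', ha, b', hb, hab⟩ := Submodule.mem_sup.1 hgJ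
  obtain ⟨a, rfl⟩ := Ideal.mem_span_singleton'.1 ha
  obtain ⟨b, rfl⟩ := Ideal.mem_span_range_iff_exists_fun.1 hb
  have h1 := congrArg (homogeneousComponent 2) hab
  rw [map_add, map_sum, homogeneousComponent_of_mem hg, if_pos rfl] at h1
  simp only [hcomp_mul _ _ 1 hx, hcomp_mul _ _ 1 (hy _)] at h1
  norm_num at h1
  choose A B Cc E hE using fun j => hsp _ (homogeneousComponent_isHomogeneous (n := 1) (φ := b j))
  have hlin : ∀ c : k, ∀ j : Fin m, (C c * X j : MvPolynomial (Fin m) k).IsHomogeneous 1 := fun c j => by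
    simpa using (isHomogeneous_C (Fin m) c).mul (isHomogeneous_X k j)
  refine ⟨homogeneousComponent 1 a + ∑ j, C (Cc j) * y j, ∑ j, (∑ i, C (E j i) * X i) * X j, ∑ j, C (A j) * X j, ∑ j, C (B j) * X j, ?_, ?_, ?_, ?_⟩
  · refine (homogeneousComponent_isHomogeneous _ _).add (IsHomogeneous.sum _ _ _ fun j _ => ?_)
    simpa using (isHomogeneous_C (Fin N) (Cc j)).mul (hy j)
  · exact IsHomogeneous.sum _ _ _ fun j _ => hlin _ _
  · exact IsHomogeneous.sum _ _ _ fun j _ => hlin _ _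
  · rw [← h1]
    simp only [map_sum, map_mul, aeval_C, aeval_X, MvPolynomial.algebraMap_eq]
    have : ∀ j, homogeneousComponent 1 (b j) * y j = (C (A j) * y j) * u + (C (B j) * y j) * v + x * (C (Cc j) * y j) + (∑ i, C (E j i) * y i) * y j := by
      intro j
      conv_lhs => rw [hE j]
      ring
    simp only [this, Finset.sum_add_distrib, ← Finset.sum_mul, ← Finset.mul_sum]
    ring

theorem closure_mod {ι : Type} [Fintype ι] {p : Ideal (MvPolynomial (Fin N) k)} (hxp : x ∈ p) (hsp : LSpan x y u v) (h : ι → MvPolynomial (Fin N) k)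
    (h1 : (1 : MvPolynomial (Fin N) k) ∈ Submodule.span k (Set.range h))
    (hu : ∀ i, ∃ t ∈ Submodule.span k (Set.range h), u * h i - t ∈ p ⊔ Ideal.span (Set.range y))
    (hv : ∀ i, ∃ t ∈ Submodule.span k (Set.range h), v * h i - t ∈ p ⊔ Ideal.span (Set.range y)) :
    ∀ s, ∃ t ∈ Submodule.span k (Set.range h), s - t ∈ p ⊔ Ideal.span (Set.range y) := by
  set K := p ⊔ Ideal.span (Set.range y) with hK
  have hmul : ∀ z : MvPolynomial (Fin N) k, (∀ i, ∃ t ∈ Submodule.span k (Set.range h), z * h i - t ∈ K) →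
      ∀ t ∈ Submodule.span k (Set.range h), ∃ t' ∈ Submodule.span k (Set.range h), z * t - t' ∈ K := by
    intro z hz t ht
    induction ht using Submodule.span_induction with
    | mem t ht => obtain ⟨i, rfl⟩ := ht; exact hz i
    | zero => exact ⟨0, Submodule.zero_mem _, by simp⟩
    | add a b _ _ ha hb =>
      obtain ⟨a', ha', h1⟩ := ha
      obtain ⟨b', hb', h2⟩ := hb
      refine ⟨a' + b', Submodule.add_mem _ ha' hb', ?_⟩
      have : z * (a + b) - (a' + b') = (z * a - a') + (z * b - b') := by ring
      rw [this]; exact K.add_mem h1 h2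
    | smul c a _ ha =>
      obtain ⟨a', ha', h1⟩ := ha
      refine ⟨c • a', Submodule.smul_mem _ _ ha', ?_⟩
      have : z * (c • a) - c • a' = C c * (z * a - a') := by rw [smul_eq_C_mul, smul_eq_C_mul]; ring
      rw [this]; exact K.mul_mem_left _ h1
  intro s
  induction s using MvPolynomial.induction_on with
  | C a => 
    refine ⟨C a, ?_, by simp⟩
    have := Submodule.smul_mem _ a h1
    rwa [smul_eq_C_mul, mul_one] at this
  | add a b ha hb =>
    obtain ⟨a', ha', h1⟩ := ha
    obtain ⟨b', hb', h2⟩ := hb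
    refine ⟨a' + b', Submodule.add_mem _ ha' hb', ?_⟩
    have : (a + b) - (a' + b') = (a - a') + (b - b') := by ring
    rw [this]; exact K.add_mem h1 h2
  | mul_X s i hs =>
    obtain ⟨t, ht, hst⟩ := hs
    obtain ⟨a, b, c, e, hX⟩ := hsp (X i) (isHomogeneous_X k i)
    obtain ⟨tu, htu, hu'⟩ := hmul u hu t ht
    obtain ⟨tv, htv, hv'⟩ := hmul v hv t ht
    refine ⟨a • tu + b • tv, Submodule.add_mem _ (Submodule.smul_mem _ _ htu) (Submodule.smul_mem _ _ htv), ?_⟩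
    have : s * X i - (a • tu + b • tv) = X i * (s - t) + C a * (u * t - tu) + C b * (v * t - tv) + (C c * t) * x + t * ∑ j, C (e j) * y j := by
      rw [smul_eq_C_mul, smul_eq_C_mul, mul_sub, mul_comm (X i) s]
      linear_combination t * hX
    rw [this]
    refine K.add_mem (K.add_mem (K.add_mem (K.add_mem (K.mul_mem_left _ hst) (K.mul_mem_left _ hu')) (K.mul_mem_left _ hv')) 
      (K.mul_mem_left _ (Ideal.mem_sup_left hxp))) (K.mul_mem_left _ (K.sum_mem fun j _ => K.mul_mem_left _ (Ideal.mem_sup_right (Ideal.subset_span (Set.mem_range_self j)))))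

end DEGEN

section DEGEN2
open MvPolynomial

variable {k : Type u} [Field k] {N m : ℕ}
variable {x : MvPolynomial (Fin N) k} {y : Fin m → MvPolynomial (Fin N) k} {u v : MvPolynomial (Fin N) k} {p : Ideal (MvPolynomial (Fin N) k)}

/-- at least four generators are needed generically -/
def HUp (p : Ideal (MvPolynomial (Fin N) k)) (y : Fin m → MvPolynomial (Fin N) k) : Prop :=
  ∀ (r : ℕ) (h : Fin r → MvPolynomial (Fin N) k) (e : Fin r → ℕ) (_ : ∀ i, (h i).IsHomogeneous (e i))
      (g : MvPolynomial (Fin N) k) (δ : ℕ) (_ : g.IsHomogeneous δ) (_ : g ∉ p)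
      (_ : ∀ s, GenBy p y h (g * s)), 4 ≤ r

theorem coords (hm : 3 + m = N) (hx : x.IsHomogeneous 1) (hx0 : x ≠ 0) (hy : ∀ i, (y i).IsHomogeneous 1) (hxp : x ∈ p)
    (hind : ∀ a : MvPolynomial (Fin m) k, aeval y a ∈ p → a = 0) :
    ∃ u v : MvPolynomial (Fin N) k, u.IsHomogeneous 1 ∧ v.IsHomogeneous 1 ∧ LSpan x y u v ∧ LEval x y u v := by
  have hyi : ∀ c : Fin m → k, ∑ j, c j • y j ∈ p → c = 0 := by
    intro c hc
    have := hind (∑ j, C (c j) * X j) (by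
      simp only [map_sum, ← smul_eq_C_mul, map_smul, aeval_X]; exact hc)
    funext j
    have h2 := congrArg (coeff (Finsupp.single j 1)) this
    simp only [coeff_sum, coeff_C_mul, coeff_X', coeff_zero] at h2
    classical
    simpa [Finsupp.single_left_inj] using h2
  have hyli : LinearIndependent k y := by
    rw [Fintype.linearIndependent_iff]
    intro c hc j
    exact congrFun (hyi c (by rw [hc]; exact p.zero_mem)) j
  have hli : LinearIndependent k (Fin.cons x y : Fin (m+1) → MvPolynomial (Fin N) k) := by
    rw [linearIndependent_finCons]
    refine ⟨hyli, fun hmem => ?_⟩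
    obtain ⟨c, hc⟩ := (Submodule.mem_span_range_iff_exists_fun k).1 hmem
    have := hyi c (by rw [hc]; exact hxp)
    rw [this] at hc
    simp at hc
    exact hx0 hc.symm
  have hw : ∀ i, ((Fin.cons x y : Fin (m+1) → MvPolynomial (Fin N) k) i).IsHomogeneous 1 := by
    intro i
    refine Fin.cases ?_ (fun j => ?_) i
    · simpa using hx
    · simpa using hy j
  obtain ⟨m', z, hm', hz, hzli⟩ := exists_extend _ hw hli
  obtain rfl : m' = 2 := by omega
  have hall : ∀ i, (Sum.elim z (Fin.cons x y : Fin (m+1) → MvPolynomial (Fin N) k) i).IsHomogeneous 1 := by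
    rintro (i | i)
    · exact hz i
    · exact hw i
  have hc : Fintype.card (Fin 2 ⊕ Fin (m+1)) = N := by simp; omega
  refine ⟨z 0, z 1, hz 0, hz 1, ?_, ?_⟩
  · intro l hl
    have : l ∈ Submodule.span k (Set.range (Sum.elim z (Fin.cons x y : Fin (m+1) → MvPolynomial (Fin N) k))) := by
      rw [span_eq_S1 _ hall hzli hc]; exact hl
    obtain ⟨c, rfl⟩ := (Submodule.mem_span_range_iff_exists_fun k).1 this
    refine ⟨c (Sum.inl 0), c (Sum.inl 1), c (Sum.inr 0), fun j => c (Sum.inr j.succ), ?_⟩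
    rw [Fintype.sum_sum_type, Fin.sum_univ_two, Fin.sum_univ_succ]
    simp only [Sum.elim_inl, Sum.elim_inr, Fin.cons_zero, Fin.cons_succ, smul_eq_C_mul]
    ring
  · intro s t
    let e := AlgEquiv.ofBijective _ (aeval_bij _ hall hzli hc)
    let ev : MvPolynomial (Fin 2 ⊕ Fin (m+1)) k →ₐ[k] k := aeval (Sum.elim ![s, t] 0)
    have he : ∀ i, e.symm (Sum.elim z (Fin.cons x y : Fin (m+1) → MvPolynomial (Fin N) k) i) = X i := by
      intro i
      rw [AlgEquiv.symm_apply_eq]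
      exact (aeval_X _ i).symm
    have hev : ∀ i, (ev.comp e.symm.toAlgHom) (Sum.elim z (Fin.cons x y : Fin (m+1) → MvPolynomial (Fin N) k) i) = (Sum.elim ![s, t] 0 : Fin 2 ⊕ Fin (m+1) → k) i := by
      intro i
      have h1 : (ev.comp e.symm.toAlgHom) (Sum.elim z (Fin.cons x y : Fin (m+1) → MvPolynomial (Fin N) k) i) = ev (e.symm (Sum.elim z (Fin.cons x y : Fin (m+1) → MvPolynomial (Fin N) k) i)) := rfl
      rw [h1, he]
      exact aeval_X _ i
    exact ⟨ev.comp e.symm.toAlgHom, hev (Sum.inl 0), hev (Sum.inl 1), hev (Sum.inr 0), fun j => hev (Sum.inr j.succ)⟩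

/-- the three quadratic monomials cannot all vanish modulo `p` and `y` -/
theorem not_all (hpH : HomI p) (h1p : (1 : MvPolynomial (Fin N) k) ∉ p) (hy : ∀ i, (y i).IsHomogeneous 1) (hxp : x ∈ p) (hu : u.IsHomogeneous 1) (hv : v.IsHomogeneous 1)
    (hsp : LSpan x y u v) (HU : HUp p y) (h1 : u ^ 2 ∈ p ⊔ Ideal.span (Set.range y)) (h2 : u * v ∈ p ⊔ Ideal.span (Set.range y))
    (h3 : v ^ 2 ∈ p ⊔ Ideal.span (Set.range y)) : False := by
  have hm0 : ∀ i, (![1, u, v] : Fin 3 → MvPolynomial (Fin N) k) i ∈ Submodule.span k (Set.range (![1, u, v] : Fin 3 → MvPolynomial (Fin N) k)) :=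
    fun i => Submodule.subset_span (Set.mem_range_self i)
  have hh : ∀ i, ((![1, u, v] : Fin 3 → MvPolynomial (Fin N) k) i).IsHomogeneous ((![0, 1, 1] : Fin 3 → ℕ) i) := by
    intro i; fin_cases i
    · exact isHomogeneous_one _ _
    · exact hu
    · exact hv
  have key := closure_mod (p := p) hxp hsp (![1, u, v] : Fin 3 → MvPolynomial (Fin N) k) (hm0 0)
    (by
      intro i; fin_cases i
      · refine ⟨u, hm0 1, ?_⟩; simp
      · refine ⟨0, Submodule.zero_mem _, ?_⟩; simpa [← pow_two] using h1
      · refine ⟨0, Submodule.zero_mem _, ?_⟩; simpa using h2)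
    (by
      intro i; fin_cases i
      · refine ⟨v, hm0 2, ?_⟩; simp
      · refine ⟨0, Submodule.zero_mem _, ?_⟩; simpa [mul_comm v u] using h2
      · refine ⟨0, Submodule.zero_mem _, ?_⟩; simpa [← pow_two] using h3)
  have := HU 3 _ _ hh 1 0 (isHomogeneous_one _ _) h1p (fun s => by
    rw [one_mul]; exact genBy_of_mod hpH hy _ hh (fun n s _ => key s) s)
  omega

/-- coefficients of the quadrics modulo `x`, `y` -/
def VV (F : Submodule k (MvPolynomial (Fin N) k)) (x : MvPolynomial (Fin N) k) (y : Fin m → MvPolynomial (Fin N) k) (u v : MvPolynomial (Fin N) k) : Submodule k (Fin 3 → k) where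
  carrier := {w | ∃ g ∈ F, g - (C (w 0) * u ^ 2 + C (w 1) * (u * v) + C (w 2) * v ^ 2) ∈ JJ x y}
  zero_mem' := ⟨0, F.zero_mem, by simp⟩
  add_mem' := by
    rintro w w' ⟨g, hg, h⟩ ⟨g', hg', h'⟩
    refine ⟨g + g', F.add_mem hg hg', ?_⟩
    have := (JJ x y).add_mem h h'
    simp only [Pi.add_apply, map_add]
    have e : g + g' - ((C (w 0) + C (w' 0)) * u ^ 2 + (C (w 1) + C (w' 1)) * (u * v) + (C (w 2) + C (w' 2)) * v ^ 2)
      = g - (C (w 0) * u ^ 2 + C (w 1) * (u * v) + C (w 2) * v ^ 2) + (g' - (C (w' 0) * u ^ 2 + C (w' 1) * (u * v) + C (w' 2) * v ^ 2)) := by ring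
    rw [e]; exact this
  smul_mem' := by
    rintro c w ⟨g, hg, h⟩
    refine ⟨c • g, F.smul_mem c hg, ?_⟩
    have := (JJ x y).mul_mem_left (C c) h
    simp only [Pi.smul_apply, smul_eq_mul, map_mul, smul_eq_C_mul]
    have e : C c * g - (C c * C (w 0) * u ^ 2 + C c * C (w 1) * (u * v) + C c * C (w 2) * v ^ 2)
      = C c * (g - (C (w 0) * u ^ 2 + C (w 1) * (u * v) + C (w 2) * v ^ 2)) := by ring
    rw [e]; exact this

theorem mem_VV {F : Submodule k (MvPolynomial (Fin N) k)} {w : Fin 3 → k} : 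
    w ∈ VV F x y u v ↔ ∃ g ∈ F, g - (C (w 0) * u ^ 2 + C (w 1) * (u * v) + C (w 2) * v ^ 2) ∈ JJ x y := Iff.rfl

theorem JJ_le (hxp : x ∈ p) : JJ x y ≤ p ⊔ Ideal.span (Set.range y) :=
  sup_le_sup_right ((Ideal.span_singleton_le_iff_mem p).2 hxp) _

theorem VV_mod {F : Submodule k (MvPolynomial (Fin N) k)} (hF : ∀ g ∈ F, g ∈ p) (hxp : x ∈ p) {w : Fin 3 → k} (hw : w ∈ VV F x y u v) : 
    C (w 0) * u ^ 2 + C (w 1) * (u * v) + C (w 2) * v ^ 2 ∈ p ⊔ Ideal.span (Set.range y) := by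
  obtain ⟨g, hg, h⟩ := hw
  have h1 := JJ_le hxp h
  have h2 : g ∈ p ⊔ Ideal.span (Set.range y) := Ideal.mem_sup_left (hF g hg)
  have := Ideal.sub_mem _ h2 h1
  rwa [sub_sub_cancel] at this

theorem VV_eps {F : Submodule k (MvPolynomial (Fin N) k)} {w : Fin 3 → k} {g : MvPolynomial (Fin N) k}
    (h : g - (C (w 0) * u ^ 2 + C (w 1) * (u * v) + C (w 2) * v ^ 2) ∈ JJ x y) (ε : MvPolynomial (Fin N) k →ₐ[k] k)
    (hx : ε x = 0) (hy : ∀ j, ε (y j) = 0) : ε g = w 0 * ε u ^ 2 + w 1 * (ε u * ε v) + w 2 * ε v ^ 2 := by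
  have hle : JJ x y ≤ RingHom.ker ε.toRingHom := by
    refine sup_le ((Ideal.span_singleton_le_iff_mem _).2 hx) (Ideal.span_le.2 ?_)
    rintro _ ⟨j, rfl⟩; exact hy j
  have h1 : ε (g - (C (w 0) * u ^ 2 + C (w 1) * (u * v) + C (w 2) * v ^ 2)) = 0 := hle h
  rw [map_sub, sub_eq_zero] at h1
  rw [h1]
  have hC : ∀ c : k, ε (C c) = c := fun c => ε.commutes c
  simp only [map_add, map_mul, map_pow, hC]

theorem VV_ne_top {F : Submodule k (MvPolynomial (Fin N) k)} (hF : ∀ g ∈ F, g ∈ p) (hpH : HomI p) (h1p : (1 : MvPolynomial (Fin N) k) ∉ p) (hy : ∀ i, (y i).IsHomogeneous 1) (hxp : x ∈ p) (hu : u.IsHomogeneous 1) (hv : v.IsHomogeneous 1)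
    (hsp : LSpan x y u v) (HU : HUp p y) : VV F x y u v ≠ ⊤ := by
  intro htop
  have hm : ∀ w, w ∈ VV F x y u v := fun w => by rw [htop]; trivial
  refine not_all hpH h1p hy hxp hu hv hsp HU ?_ ?_ ?_
  · simpa using VV_mod hF hxp (hm ![1, 0, 0])
  · simpa using VV_mod hF hxp (hm ![0, 1, 0])
  · simpa using VV_mod hF hxp (hm ![0, 0, 1])

theorem VV_zero {ι : Type} [Fintype ι] {f : ι → MvPolynomial (Fin N) k} (hf : ∀ i, (f i).IsHomogeneous 2) (D : ℕ)
    (hD : ∀ n, D ≤ n → ∀ s, s.IsHomogeneous n → s ∈ Ideal.span (Set.range (Sum.elim f y))) (hu : u.IsHomogeneous 1) (hv : v.IsHomogeneous 1)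
    (hsp : LSpan x y u v) (hev : LEval x y u v) (s t : k) (hst : s ≠ 0 ∨ t ≠ 0) :
    ∃ w ∈ VV (Submodule.span k (Set.range f)) x y u v, w 0 * s ^ 2 + w 1 * (s * t) + w 2 * t ^ 2 ≠ 0 := by
  by_contra hcon
  push Not at hcon
  obtain ⟨ε, h1, h2, h3, h4⟩ := hev s t
  have hfe : ∀ i, ε (f i) = 0 := by
    intro i
    obtain ⟨w, hw⟩ := quad_mod hsp (f i) (hf i)
    rw [VV_eps (F := ⊤) hw ε h3 h4, h1, h2]
    exact hcon w ⟨f i, Submodule.subset_span (Set.mem_range_self i), hw⟩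
  have hle : Ideal.span (Set.range (Sum.elim f y)) ≤ RingHom.ker ε.toRingHom := by
    rw [Ideal.span_le]
    rintro _ ⟨i | j, rfl⟩
    · exact hfe i
    · exact h4 j
  rcases hst with h | h
  · have : ε (u ^ D) = 0 := hle (hD D le_rfl _ (by simpa using hu.pow D))
    rw [map_pow, h1] at this
    exact h (eq_zero_of_pow_eq_zero this)
  · have : ε (v ^ D) = 0 := hle (hD D le_rfl _ (by simpa using hv.pow D))
    rw [map_pow, h2] at this
    exact h (eq_zero_of_pow_eq_zero this)

/-- change of coordinates -/
theorem change_coords [IsAlgClosed k] {F : Submodule k (MvPolynomial (Fin N) k)} (hu : u.IsHomogeneous 1) (hv : v.IsHomogeneous 1)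
    (hsp : LSpan x y u v) (hev : LEval x y u v) (hV : VV F x y u v ≠ ⊤)
    (hz : ∀ s t : k, (s ≠ 0 ∨ t ≠ 0) → ∃ w ∈ VV F x y u v, w 0 * s ^ 2 + w 1 * (s * t) + w 2 * t ^ 2 ≠ 0) :
    ∃ u' v' : MvPolynomial (Fin N) k, u'.IsHomogeneous 1 ∧ v'.IsHomogeneous 1 ∧ LSpan x y u' v' ∧ LEval x y u' v' ∧ ![1, 0, 0] ∈ VV F x y u' v' := by
  obtain ⟨α, β, hab, hmem⟩ := lin_alg _ hV hz
  obtain ⟨γ, δ, hdet⟩ : ∃ γ δ : k, α * δ - β * γ = 1 := by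
    rcases hab with h | h
    · exact ⟨0, α⁻¹, by field_simp; ring⟩
    · exact ⟨-β⁻¹, 0, by field_simp; ring⟩
  have hdetC : (C α * C δ - C β * C γ : MvPolynomial (Fin N) k) = 1 := by
    rw [← C_mul, ← C_mul, ← C_sub, hdet, C_1]
  have hh : ∀ a b : k, (C a * u + C b * v).IsHomogeneous 1 := fun a b => by
    have h1 := (isHomogeneous_C (Fin N) a).mul hu
    have h2 := (isHomogeneous_C (Fin N) b).mul hv
    rw [zero_add] at h1 h2
    exact h1.add h2
  refine ⟨C α * u + C β * v, C γ * u + C δ * v, hh _ _, hh _ _, ?_, ?_, ?_⟩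
  · intro l hl
    obtain ⟨a, b, c, e, rfl⟩ := hsp l hl
    refine ⟨a * δ - b * γ, b * α - a * β, c, e, ?_⟩
    simp only [C_sub, C_mul]
    linear_combination (-(C a * u + C b * v)) * hdetC
  · intro s t
    obtain ⟨ε, h1, h2, h3, h4⟩ := hev (δ * s - β * t) (α * t - γ * s)
    have hC : ∀ c : k, ε (C c) = c := fun c => ε.commutes c
    refine ⟨ε, ?_, ?_, h3, h4⟩
    · simp only [map_add, map_mul, hC, h1, h2]
      linear_combination s * hdet
    · simp only [map_add, map_mul, hC, h1, h2]
      linear_combination t * hdet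
  · obtain ⟨g, hg, h⟩ := hmem
    refine ⟨g, hg, ?_⟩
    have e : g - (C ((![1, 0, 0] : Fin 3 → k) 0) * (C α * u + C β * v) ^ 2 + C ((![1, 0, 0] : Fin 3 → k) 1) * ((C α * u + C β * v) * (C γ * u + C δ * v)) + C ((![1, 0, 0] : Fin 3 → k) 2) * (C γ * u + C δ * v) ^ 2) =
      g - (C ((![α ^ 2, 2 * (α * β), β ^ 2] : Fin 3 → k) 0) * u ^ 2 + C ((![α ^ 2, 2 * (α * β), β ^ 2] : Fin 3 → k) 1) * (u * v) + C ((![α ^ 2, 2 * (α * β), β ^ 2] : Fin 3 → k) 2) * v ^ 2) := by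
      simp only [Matrix.cons_val_zero, Matrix.cons_val_one, Matrix.cons_val, map_pow, map_mul, map_ofNat, C_1, C_0]
      ring
    rw [e]; exact h

end DEGEN2

section DEGEN3
open MvPolynomial

variable {k : Type u} [Field k] {N m : ℕ}
variable {x : MvPolynomial (Fin N) k} {y : Fin m → MvPolynomial (Fin N) k} {u v : MvPolynomial (Fin N) k} {p : Ideal (MvPolynomial (Fin N) k)}

theorem gen4 (hpH : HomI p) (hy : ∀ i, (y i).IsHomogeneous 1) (hxp : x ∈ p) (hu : u.IsHomogeneous 1) (hv : v.IsHomogeneous 1)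
    (hsp : LSpan x y u v) (a : k) (h1 : u ^ 2 ∈ p ⊔ Ideal.span (Set.range y)) (h2 : C a * (u * v) + v ^ 2 ∈ p ⊔ Ideal.span (Set.range y)) :
    ∀ s, GenBy p y (![1, u, v, u * v] : Fin 4 → MvPolynomial (Fin N) k) s := by
  have hm0 : ∀ i, (![1, u, v, u * v] : Fin 4 → MvPolynomial (Fin N) k) i ∈ Submodule.span k (Set.range (![1, u, v, u * v] : Fin 4 → MvPolynomial (Fin N) k)) :=
    fun i => Submodule.subset_span (Set.mem_range_self i)
  have hh : ∀ i, ((![1, u, v, u * v] : Fin 4 → MvPolynomial (Fin N) k) i).IsHomogeneous ((![0, 1, 1, 2] : Fin 4 → ℕ) i) := by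
    intro i; fin_cases i
    · exact isHomogeneous_one _ _
    · exact hu
    · exact hv
    · exact hu.mul hv
  have key := closure_mod (p := p) hxp hsp (![1, u, v, u * v] : Fin 4 → MvPolynomial (Fin N) k) (hm0 0)
    (by
      intro i; fin_cases i
      · refine ⟨u, hm0 1, ?_⟩; simp
      · refine ⟨0, Submodule.zero_mem _, ?_⟩; simpa [← pow_two] using h1
      · refine ⟨u * v, hm0 3, ?_⟩; simp
      · refine ⟨0, Submodule.zero_mem _, ?_⟩
        have := Ideal.mul_mem_left _ v h1
        have e : u * (![1, u, v, u * v] : Fin 4 → MvPolynomial (Fin N) k) 3 - 0 = v * u ^ 2 := by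
          simp only [Matrix.cons_val]; ring
        exact e ▸ this)
    (by
      intro i; fin_cases i
      · refine ⟨v, hm0 2, ?_⟩; simp
      · refine ⟨u * v, hm0 3, ?_⟩; simp [mul_comm v u] 
      · refine ⟨(-a) • (u * v), Submodule.smul_mem _ _ (hm0 3), ?_⟩
        have e : v * (![1, u, v, u * v] : Fin 4 → MvPolynomial (Fin N) k) 2 - (-a) • (u * v) = C a * (u * v) + v ^ 2 := by
          simp only [Matrix.cons_val, neg_smul, smul_eq_C_mul]; ring
        exact e ▸ h2
      · refine ⟨0, Submodule.zero_mem _, ?_⟩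
        have e : v * (![1, u, v, u * v] : Fin 4 → MvPolynomial (Fin N) k) 3 - 0 = u * (C a * (u * v) + v ^ 2) - (C a * v) * u ^ 2 := by
          simp only [Matrix.cons_val]; ring
        exact e ▸ Ideal.sub_mem _ (Ideal.mul_mem_left _ _ h2) (Ideal.mul_mem_left _ _ h1))
  exact genBy_of_mod hpH hy _ hh (fun n s _ => key s)

theorem claimR (hpH : HomI p) (hy : ∀ i, (y i).IsHomogeneous 1) (hx : x.IsHomogeneous 1) (hxp : x ∈ p) (hu : u.IsHomogeneous 1) (hv : v.IsHomogeneous 1)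
    (hind : ∀ a : MvPolynomial (Fin m) k, aeval y a ∈ p → a = 0)
    (hsp : LSpan x y u v) (HU : HUp p y) (q1 : MvPolynomial (Fin N) k) (hq1 : q1.IsHomogeneous 2) (hq1p : q1 ∈ p) (hq1u : q1 - u ^ 2 ∈ JJ x y)
    (h4 : ∀ s, GenBy p y (![1, u, v, u * v] : Fin 4 → MvPolynomial (Fin N) k) s)
    (c0 c1 c2 : MvPolynomial (Fin m) k) (hc1 : c1.IsHomogeneous 1) (hc2 : c2.IsHomogeneous 1)
    (hmem : aeval y c0 + aeval y c1 * u + aeval y c2 * v ∈ p) : aeval y c0 + aeval y c1 * u + aeval y c2 * v = 0 := by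
  have hh : ∀ i, ((![1, u, v] : Fin 3 → MvPolynomial (Fin N) k) i).IsHomogeneous ((![0, 1, 1] : Fin 3 → ℕ) i) := by
    intro i; fin_cases i
    · exact isHomogeneous_one _ _
    · exact hu
    · exact hv
  have g1 : GenBy p y (![1, u, v] : Fin 3 → MvPolynomial (Fin N) k) 1 := GenBy.self (h := (![1, u, v] : Fin 3 → MvPolynomial (Fin N) k)) 0
  have gu : GenBy p y (![1, u, v] : Fin 3 → MvPolynomial (Fin N) k) u := GenBy.self (h := (![1, u, v] : Fin 3 → MvPolynomial (Fin N) k)) 1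
  have gv : GenBy p y (![1, u, v] : Fin 3 → MvPolynomial (Fin N) k) v := GenBy.self (h := (![1, u, v] : Fin 3 → MvPolynomial (Fin N) k)) 2
  have gu2 : GenBy p y (![1, u, v] : Fin 3 → MvPolynomial (Fin N) k) (u ^ 2) := by
    have hq : (q1 - u ^ 2).IsHomogeneous 2 := hq1.sub (by simpa using hu.pow 2)
    obtain ⟨l, b0, b1, b2, _, _, _, hexp⟩ := exp_quad hsp hx hy _ hq hq1u
    refine (((g1.smul (-b0)).add (gu.smul (-b1))).add (gv.smul (-b2))).congr ?_
    have : u ^ 2 - (aeval y (-b0) * 1 + aeval y (-b1) * u + aeval y (-b2) * v) = q1 - l * x := by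
      simp only [map_neg]
      linear_combination -hexp
    rw [this]
    exact p.sub_mem hq1p (p.mul_mem_left _ hxp)
  have fin : ∀ g, (GenBy p y (![1, u, v] : Fin 3 → MvPolynomial (Fin N) k) (g * 1)) → (GenBy p y (![1, u, v] : Fin 3 → MvPolynomial (Fin N) k) (g * u)) →
      (GenBy p y (![1, u, v] : Fin 3 → MvPolynomial (Fin N) k) (g * v)) → (GenBy p y (![1, u, v] : Fin 3 → MvPolynomial (Fin N) k) (g * (u * v))) →
      ∀ s, GenBy p y (![1, u, v] : Fin 3 → MvPolynomial (Fin N) k) (g * s) := by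
    intro g a1 a2 a3 a4 s
    obtain ⟨c, hc⟩ := h4 s
    refine ((((a1.smul (c 0)).add (a2.smul (c 1))).add (a3.smul (c 2))).add (a4.smul (c 3))).congr ?_
    have := p.mul_mem_left g hc
    rw [Fin.sum_univ_four] at this
    simp only [Matrix.cons_val_zero, Matrix.cons_val_one, Matrix.cons_val] at this
    have e : g * s - (aeval y (c 0) * (g * 1) + aeval y (c 1) * (g * u) + aeval y (c 2) * (g * v) + aeval y (c 3) * (g * (u * v))) =
      g * (s - (aeval y (c 0) * 1 + aeval y (c 1) * u + aeval y (c 2) * v + aeval y (c 3) * (u * v))) := by ring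
    rw [e]; exact this
  have h2 : c2 = 0 := by
    by_contra hne
    have hg : aeval y c2 ∉ p := fun h => hne (hind _ h)
    have := HU 3 _ _ hh (aeval y c2) 1 (aeval_hom hy c2 1 hc2) hg (fin _ (g1.smul c2) (gu.smul c2) 
      (((g1.smul (-c0)).add (gu.smul (-c1))).congr (by
        have e : aeval y c2 * v - (aeval y (-c0) * 1 + aeval y (-c1) * u) = aeval y c0 + aeval y c1 * u + aeval y c2 * v := by
          simp only [map_neg]; ring
        rw [e]; exact hmem))
      (((gu.smul (-c0)).add (gu2.smul (-c1))).congr (by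
        have e : aeval y c2 * (u * v) - (aeval y (-c0) * u + aeval y (-c1) * u ^ 2) = u * (aeval y c0 + aeval y c1 * u + aeval y c2 * v) := by
          simp only [map_neg]; ring
        rw [e]; exact p.mul_mem_left _ hmem)))
    omega
  subst h2
  rw [map_zero, zero_mul, add_zero] at hmem ⊢
  have h1 : c1 = 0 := by
    by_contra hne
    have hg : aeval y c1 ∉ p := fun h => hne (hind _ h)
    have := HU 3 _ _ hh (aeval y c1) 1 (aeval_hom hy c1 1 hc1) hg (fin _ (g1.smul c1) (gu.smul c1) (gv.smul c1)
      ((gv.smul (-c0)).congr (by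
        have e : aeval y c1 * (u * v) - (aeval y (-c0) * v) = v * (aeval y c0 + aeval y c1 * u) := by
          simp only [map_neg]; ring
        rw [e]; exact p.mul_mem_left _ hmem)))
    omega
  subst h1
  rw [map_zero, zero_mul, add_zero] at hmem ⊢
  rw [hind _ hmem, map_zero]

theorem degen [IsAlgClosed k] (hm : 3 + m = N) (hx : x.IsHomogeneous 1) (hx0 : x ≠ 0) (hy : ∀ i, (y i).IsHomogeneous 1) (hxp : x ∈ p)
    (hpH : HomI p) (hp : p.IsPrime) (hind : ∀ a : MvPolynomial (Fin m) k, aeval y a ∈ p → a = 0) (HU : HUp p y)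
    {n : ℕ} (f : Fin n → MvPolynomial (Fin N) k) (hf : ∀ i, (f i).IsHomogeneous 2) (hfp : ∀ i, f i ∈ p) (D : ℕ)
    (hD : ∀ n, D ≤ n → ∀ s, s.IsHomogeneous n → s ∈ Ideal.span (Set.range (Sum.elim f y)))
    (hht : ∀ P : Ideal (MvPolynomial (Fin N) k), P.IsPrime → Ideal.span (Set.range f) ≤ P → 3 ≤ P.height) :
    PDLT (MvPolynomial (Fin N) k) (MvPolynomial (Fin N) k ⧸ Ideal.span (Set.range f)) (max n 8 + 1) := by
  have h1p : (1 : MvPolynomial (Fin N) k) ∉ p := (Ideal.ne_top_iff_one p).1 hp.ne_top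
  set F := Submodule.span k (Set.range f) with hFdef
  have hF : ∀ g ∈ F, g ∈ p := by
    have : F ≤ p.restrictScalars k := by
      rw [hFdef, Submodule.span_le]; rintro _ ⟨i, rfl⟩; exact hfp i
    exact fun g hg => this hg
  have hFI : ∀ g ∈ F, g ∈ Ideal.span (Set.range f) := by
    have : F ≤ (Ideal.span (Set.range f)).restrictScalars k := by
      rw [hFdef, Submodule.span_le]; rintro _ ⟨i, rfl⟩; exact Ideal.subset_span (Set.mem_range_self i)
    exact fun g hg => this hg
  have hF2 : ∀ g ∈ F, g.IsHomogeneous 2 := by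
    have : F ≤ homogeneousSubmodule (Fin N) k 2 := by
      rw [hFdef, Submodule.span_le]; rintro _ ⟨i, rfl⟩; exact hf i
    exact fun g hg => this hg
  obtain ⟨u0, v0, hu0, hv0, hsp0, hev0⟩ := coords hm hx hx0 hy hxp hind
  obtain ⟨u, v, hu, hv, hsp, hev, hV1⟩ := change_coords hu0 hv0 hsp0 hev0 (VV_ne_top hF hpH h1p hy hxp hu0 hv0 hsp0 HU)
    (VV_zero hf D hD hu0 hv0 hsp0 hev0)
  obtain ⟨w, hwV, hw⟩ := VV_zero hf D hD hu hv hsp hev 0 1 (Or.inr one_ne_zero)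
  have hw2 : w 2 ≠ 0 := by simpa using hw
  set a := (w 2)⁻¹ * w 1 with ha
  have hV2 : ![0, a, 1] ∈ VV F x y u v := by
    have := Submodule.sub_mem _ (Submodule.smul_mem _ (w 2)⁻¹ hwV) (Submodule.smul_mem _ ((w 2)⁻¹ * w 0) hV1)
    convert this using 1
    ext i; fin_cases i
    · simp
    · simp [ha]
    · simp [hw2]
  have hu2 : u ^ 2 ∈ p ⊔ Ideal.span (Set.range y) := by simpa using VV_mod hF hxp hV1
  have hv2 : C a * (u * v) + v ^ 2 ∈ p ⊔ Ideal.span (Set.range y) := by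
    have := VV_mod hF hxp hV2
    simp only [Matrix.cons_val_zero, Matrix.cons_val_one, Matrix.cons_val, C_0, C_1, zero_mul, one_mul, zero_add] at this
    exact this
  have huv : ∀ c : k, ![0, c, 0] ∈ VV F x y u v → c = 0 := by
    intro c hc
    by_contra hne
    have h1 : u * v ∈ p ⊔ Ideal.span (Set.range y) := by
      have := VV_mod hF hxp (Submodule.smul_mem _ c⁻¹ hc)
      simpa [hne] using this
    refine not_all hpH h1p hy hxp hu hv hsp HU hu2 h1 ?_
    have := Ideal.sub_mem _ hv2 (Ideal.mul_mem_left _ (C a) h1)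
    rwa [add_sub_cancel_left] at this
  have h4 := gen4 hpH hy hxp hu hv hsp a hu2 hv2
  obtain ⟨q1, hq1F, hq1⟩ := hV1
  obtain ⟨q2, hq2F, hq2⟩ := hV2
  have hq1' : q1 - u ^ 2 ∈ JJ x y := by simpa using hq1
  -- elements of `F` in the ideal of `x`, `y`
  have hdiv : ∀ g ∈ F, g ∈ JJ x y → ∃ l : MvPolynomial (Fin N) k, l.IsHomogeneous 1 ∧ g = x * l := by
    intro g hg hgJ
    obtain ⟨l, c0, c1, c2, hl, hc1, hc2, hexp⟩ := exp_quad hsp hx hy g (hF2 g hg) hgJ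
    refine ⟨l, hl, ?_⟩
    have h0 := claimR hpH hy hx hxp hu hv hind hsp HU q1 (hF2 _ hq1F) (hF _ hq1F) hq1' h4 c0 c1 c2 hc1 hc2 (by
      have e : aeval y c0 + aeval y c1 * u + aeval y c2 * v = g - l * x := by linear_combination -hexp
      rw [e]; exact p.sub_mem (hF g hg) (p.mul_mem_left _ hxp))
    linear_combination hexp + h0
  have hdec : ∀ g ∈ F, ∃ (b c : k) (l : MvPolynomial (Fin N) k), l.IsHomogeneous 1 ∧ g = C b * q1 + C c * q2 + x * l := by
    intro g hg
    obtain ⟨z, hz⟩ := quad_mod hsp g (hF2 g hg)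
    have hzV : z ∈ VV F x y u v := ⟨g, hg, hz⟩
    have hc := huv (z 1 - z 2 * a) (by
      have := Submodule.sub_mem _ (Submodule.sub_mem _ hzV (Submodule.smul_mem _ (z 0) (mem_VV.2 ⟨q1, hq1F, hq1⟩))) (Submodule.smul_mem _ (z 2) (mem_VV.2 ⟨q2, hq2F, hq2⟩))
      convert this using 1
      ext i; fin_cases i
      · simp [Matrix.vecHead, Matrix.vecTail]
      · simp [Matrix.vecHead, Matrix.vecTail]
      · simp [Matrix.vecHead, Matrix.vecTail])
    have hg' : g - C (z 0) * q1 - C (z 2) * q2 ∈ F := by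
      rw [← smul_eq_C_mul, ← smul_eq_C_mul]
      exact F.sub_mem (F.sub_mem hg (F.smul_mem _ hq1F)) (F.smul_mem _ hq2F)
    obtain ⟨l, hl, hgl⟩ := hdiv _ hg' (by
      have h3 := Ideal.sub_mem _ (Ideal.sub_mem _ hz (Ideal.mul_mem_left _ (C (z 0)) hq1)) (Ideal.mul_mem_left _ (C (z 2)) hq2)
      have hz1 : z 1 = z 2 * a := sub_eq_zero.1 hc
      have e : g - C (z 0) * q1 - C (z 2) * q2 = g - (C (z 0) * u ^ 2 + C (z 1) * (u * v) + C (z 2) * v ^ 2) - 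
        C (z 0) * (q1 - (C ((![1, 0, 0] : Fin 3 → k) 0) * u ^ 2 + C ((![1, 0, 0] : Fin 3 → k) 1) * (u * v) + C ((![1, 0, 0] : Fin 3 → k) 2) * v ^ 2)) -
        C (z 2) * (q2 - (C ((![0, a, 1] : Fin 3 → k) 0) * u ^ 2 + C ((![0, a, 1] : Fin 3 → k) 1) * (u * v) + C ((![0, a, 1] : Fin 3 → k) 2) * v ^ 2)) := by
        rw [hz1]
        simp only [Matrix.cons_val_zero, Matrix.cons_val_one, Matrix.cons_val, C_0, C_1, C_mul]
        ring
      rw [e]; exact h3)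
    exact ⟨z 0, z 2, l, hl, by linear_combination hgl⟩
  -- the space of linear cofactors
  let L : Submodule k (MvPolynomial (Fin N) k) := homogeneousSubmodule (Fin N) k 1 ⊓ F.comap (LinearMap.mulLeft k x)
  have hL : ∀ l, l ∈ L ↔ l.IsHomogeneous 1 ∧ x * l ∈ F := fun l => Iff.rfl
  haveI : FiniteDimensional k F := by rw [hFdef]; exact FiniteDimensional.span_of_finite k (Set.finite_range f)
  haveI : FiniteDimensional k L := Submodule.finiteDimensional_of_le (inf_le_left : L ≤ homogeneousSubmodule (Fin N) k 1)
  have hrank : Module.finrank k L + 2 ≤ n := by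
    let Ψ : (L × (k × k)) →ₗ[k] MvPolynomial (Fin N) k :=
      ((LinearMap.mulLeft k x).comp L.subtype).coprod ((LinearMap.toSpanSingleton k _ q1).coprod (LinearMap.toSpanSingleton k _ q2))
    have hΨ : ∀ z, Ψ z = x * (z.1 : MvPolynomial (Fin N) k) + (z.2.1 • q1 + z.2.2 • q2) := fun z => rfl
    have hinj : Function.Injective Ψ := by
      rw [injective_iff_map_eq_zero]
      rintro ⟨l, b, c⟩ h0
      rw [hΨ] at h0
      dsimp only at h0
      have hb : b = 0 := by
        obtain ⟨ε, h1, h2, h3, h4⟩ := hev 1 0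
        have e1 := VV_eps (F := ⊤) hq1 ε h3 h4
        have e2 := VV_eps (F := ⊤) hq2 ε h3 h4
        have := congrArg ε h0
        simpa [h1, h2, h3, e1, e2] using this
      have hc : c = 0 := by
        obtain ⟨ε, h1, h2, h3, h4⟩ := hev 0 1
        have e1 := VV_eps (F := ⊤) hq1 ε h3 h4
        have e2 := VV_eps (F := ⊤) hq2 ε h3 h4
        have := congrArg ε h0
        simpa [h1, h2, h3, e1, e2] using this
      subst hb hc
      rw [zero_smul, zero_smul, add_zero, add_zero] at h0
      have := (mul_eq_zero.1 h0).resolve_left hx0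
      have hl0 : l = 0 := Subtype.ext this
      rw [hl0]; rfl
    have hle : LinearMap.range Ψ ≤ F := by
      rintro _ ⟨z, rfl⟩
      rw [hΨ]
      exact F.add_mem z.1.2.2 (F.add_mem (F.smul_mem _ hq1F) (F.smul_mem _ hq2F))
    have h1 := Submodule.finrank_mono hle
    rw [LinearMap.finrank_range_of_inj hinj, Module.finrank_prod, Module.finrank_prod, Module.finrank_self] at h1
    have h2 : Module.finrank k F ≤ n := by
      have := finrank_range_le_card (R := k) f
      rwa [Fintype.card_fin] at this
    omega
  let B := Module.finBasis k L
  let ls : Fin (Module.finrank k L) → MvPolynomial (Fin N) k := fun i => (B i : MvPolynomial (Fin N) k)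
  have hls : ∀ i, (ls i).IsHomogeneous 1 := fun i => ((hL _).1 (B i).2).1
  have hlsF : ∀ i, x * ls i ∈ F := fun i => ((hL _).1 (B i).2).2
  have hli : LinearIndependent k ls := B.linearIndependent.map' L.subtype (Submodule.ker_subtype L)
  have hspanL : ∀ l ∈ L, l ∈ Ideal.span (Set.range ls) := by
    intro l hl
    have := B.sum_repr ⟨l, hl⟩
    have h2 := congrArg (L.subtype) this
    rw [map_sum] at h2
    have h3 : l = ∑ i, (B.repr ⟨l, hl⟩ i) • ls i := h2.symm
    rw [h3]
    refine Ideal.sum_mem _ fun i _ => ?_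
    rw [smul_eq_C_mul]
    exact Ideal.mul_mem_left _ _ (Ideal.subset_span (Set.mem_range_self i))
  have hI : Ideal.span (Set.range f) = Ideal.span {x} * Ideal.span (Set.range ls) ⊔ Ideal.span {q1, q2} := by
    apply le_antisymm
    · rw [Ideal.span_le]
      rintro _ ⟨i, rfl⟩
      have hfi : f i ∈ F := Submodule.subset_span (Set.mem_range_self i)
      obtain ⟨b, c, l, hl, hfl⟩ := hdec (f i) hfi
      have hlL : l ∈ L := by
        refine (hL l).2 ⟨hl, ?_⟩
        have e : x * l = f i - b • q1 - c • q2 := by rw [smul_eq_C_mul, smul_eq_C_mul]; linear_combination -hfl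
        rw [e]; exact F.sub_mem (F.sub_mem hfi (F.smul_mem _ hq1F)) (F.smul_mem _ hq2F)
      rw [hfl]
      refine Ideal.add_mem _ (Ideal.mem_sup_right (Ideal.add_mem _ ?_ ?_)) (Ideal.mem_sup_left (Ideal.mul_mem_mul (Ideal.mem_span_singleton_self x) (hspanL l hlL)))
      · exact Ideal.mul_mem_left _ _ (Ideal.subset_span (by simp))
      · exact Ideal.mul_mem_left _ _ (Ideal.subset_span (by simp))
    · refine sup_le ?_ ?_
      · rw [Ideal.span_singleton_mul_le_iff]
        intro z hz
        obtain ⟨c, rfl⟩ := Ideal.mem_span_range_iff_exists_fun.1 hz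
        rw [Finset.mul_sum]
        refine Ideal.sum_mem _ fun i _ => ?_
        rw [mul_left_comm]
        exact Ideal.mul_mem_left _ _ (hFI _ (hlsF i))
      · rw [Ideal.span_le]
        intro z hz
        rcases hz with rfl | hz
        · exact hFI _ hq1F
        · rw [Set.mem_singleton_iff.1 hz]; exact hFI _ hq2F
  have hfinal := lemF x hx hx0 _ ls hls hli q1 q2 (by
    intro P hP h1 h2 h3
    refine hht P hP ?_
    rw [hI]
    refine sup_le ?_ ?_
    · exact le_trans Ideal.mul_le_left ((Ideal.span_singleton_le_iff_mem P).2 h1)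
    · rw [Ideal.span_le]
      intro z hz
      rcases hz with rfl | hz
      · exact h2
      · rw [Set.mem_singleton_iff.1 hz]; exact h3) (max n 8 + 1) (by have := le_max_left n 8; omega) (by have := le_max_right n 8; omega)
  rw [hI]
  exact hfinal

end DEGEN3

section FINAL
open MvPolynomial

theorem adjoin_frac {k E : Type u} [Field k] [Field E] [Algebra k E] {N : ℕ} (p : Ideal (MvPolynomial (Fin N) k))
    [Algebra (MvPolynomial (Fin N) k ⧸ p) E] [IsDomain (MvPolynomial (Fin N) k ⧸ p)] [IsFractionRing (MvPolynomial (Fin N) k ⧸ p) E]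
    (π : MvPolynomial (Fin N) k →ₐ[k] E) (hπ : ∀ s, π s = algebraMap (MvPolynomial (Fin N) k ⧸ p) E (Ideal.Quotient.mk p s)) :
    IntermediateField.adjoin k (Set.range (fun i => π (X i))) = ⊤ := by
  have h1 : ∀ s, π s ∈ IntermediateField.adjoin k (Set.range (fun i => π (X i))) := by
    intro s
    induction s using MvPolynomial.induction_on with
    | C a =>
      have : π (C a) = algebraMap k E a := π.commutes a
      rw [this]; exact IntermediateField.algebraMap_mem _ a
    | add a b ha hb => rw [map_add]; exact add_mem ha hb
    | mul_X a i ha => rw [map_mul]; exact mul_mem ha (IntermediateField.subset_adjoin k _ (Set.mem_range_self i))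
  rw [eq_top_iff]
  intro e _
  obtain ⟨a, b, _, rfl⟩ := IsFractionRing.div_surjective (A := MvPolynomial (Fin N) k ⧸ p) e
  obtain ⟨a, rfl⟩ := Ideal.Quotient.mk_surjective a
  obtain ⟨b, rfl⟩ := Ideal.Quotient.mk_surjective b
  rw [← hπ, ← hπ]
  exact div_mem (h1 a) (h1 b)

theorem main_field {k E : Type u} [Field k] [IsAlgClosed k] [Field E] [Algebra k E] [Algebra.EssFiniteType k E] {N d : ℕ} (hN : 3 + (d + 1) = N)
    {n : ℕ} (f : Fin n → MvPolynomial (Fin N) k) (hf : ∀ i, (f i).IsHomogeneous 2)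
    (hht : ∀ Q : Ideal (MvPolynomial (Fin N) k), Q.IsPrime → Ideal.span (Set.range f) ≤ Q → 3 ≤ Q.height)
    (p : Ideal (MvPolynomial (Fin N) k)) (hp : p.IsPrime) (hpH : HomI p) (hfp : Ideal.span (Set.range f) ≤ p) (hp3 : p.height ≤ 3)
    (π : MvPolynomial (Fin N) k →ₐ[k] E) (hπ : IntermediateField.adjoin k (Set.range (fun i => π (X i))) = ⊤)
    (hπp : ∀ s, π s = 0 ↔ s ∈ p) (hpe : hilbertSamuelMultiplicity k p = 4) :
    PDLT (MvPolynomial (Fin N) k) (MvPolynomial (Fin N) k ⧸ Ideal.span (Set.range f)) (max n 8 + 1) := by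
  obtain ⟨y, hy, ⟨D, hD⟩, hs, hfd, hsep⟩ := P2sep hN f hf hht p hp hfp hp3 π hπ hπp
  have hfp' : ∀ i, f i ∈ p := fun i => hfp (Ideal.subset_span (Set.mem_range_self i))
  have hind : ∀ a : MvPolynomial (Fin (d+1)) k, aeval y a ∈ p → a = 0 := by
    intro a ha
    refine (algebraicIndependent_iff.1 hs) a ?_
    rw [← hπp, comp_aeval_apply] at ha
    exact ha
  have hle : Ideal.span (Set.range (Sum.elim f y)) ≤ p ⊔ Ideal.span (Set.range y) := by
    rw [Ideal.span_le]
    rintro _ ⟨i | j, rfl⟩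
    · exact Ideal.mem_sup_left (hfp' i)
    · exact Ideal.mem_sup_right (Ideal.subset_span (Set.mem_range_self j))
  have hD' : ∀ n, D ≤ n → ∀ s, s.IsHomogeneous n → s ∈ p ⊔ Ideal.span (Set.range y) := fun n hn s hs => hle (hD n hn s hs)
  obtain ⟨HL, HU⟩ := HF_pack p hp hpH y hy D hD' hind hpe
  by_cases hdeg : ∀ l : MvPolynomial (Fin N) k, l.IsHomogeneous 1 → l ∈ p → l = 0
  · have hfin := finrank_le_four p π hπ hπp y hs _ rfl HL
    have := nondeg hN p hp hpH π hπp y hy hs _ rfl hfin D hD' hdeg (Set.range f) (by rintro _ ⟨i, rfl⟩; exact ⟨hf i, hfp' i⟩)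
    exact pdlt_mono (by have := le_max_right n 8; omega) this
  · push Not at hdeg
    obtain ⟨x, hx, hxp, hx0⟩ := hdeg
    exact degen hN hx hx0 hy hxp hpH hp hind HU f hf hfp' D hD hht

theorem main_aux {k : Type u} [Field k] [IsAlgClosed k] {N d : ℕ} (hN : 3 + (d + 1) = N)
    {n : ℕ} (f : Fin n → MvPolynomial (Fin N) k) (hf : ∀ i, (f i).IsHomogeneous 2)
    (hht : ∀ Q : Ideal (MvPolynomial (Fin N) k), Q.IsPrime → Ideal.span (Set.range f) ≤ Q → 3 ≤ Q.height)
    (p : Ideal (MvPolynomial (Fin N) k)) (hp : p.IsPrime) (hpH : HomI p) (hfp : Ideal.span (Set.range f) ≤ p) (hp3 : p.height ≤ 3)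
    (hpe : hilbertSamuelMultiplicity k p = 4) :
    PDLT (MvPolynomial (Fin N) k) (MvPolynomial (Fin N) k ⧸ Ideal.span (Set.range f)) (max n 8 + 1) := by
  let π : MvPolynomial (Fin N) k →ₐ[k] FractionRing (MvPolynomial (Fin N) k ⧸ p) :=
    (IsScalarTower.toAlgHom k (MvPolynomial (Fin N) k ⧸ p) (FractionRing (MvPolynomial (Fin N) k ⧸ p))).comp (Ideal.Quotient.mkₐ k p)
  have hπ : ∀ s, π s = algebraMap (MvPolynomial (Fin N) k ⧸ p) (FractionRing (MvPolynomial (Fin N) k ⧸ p)) (Ideal.Quotient.mk p s) := fun s => rfl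
  refine main_field hN f hf hht p hp hpH hfp hp3 π (adjoin_frac p π hπ) ?_ hpe
  intro s
  rw [hπ, map_eq_zero_iff _ (IsFractionRing.injective (MvPolynomial (Fin N) k ⧸ p) (FractionRing (MvPolynomial (Fin N) k ⧸ p))), Ideal.Quotient.eq_zero_iff_mem]

end FINAL

/-- If `I` is a homogeneous ideal generated by `n` quadrics in a polynomial ring over an
algebraically closed field, and `I` has an associated prime `p` with `height p = 3` and
Hilbert–Samuel multiplicity `e(S/p) = 4`, then the stated bound on `pd_S(S/I)` holds. -/
theorem pd_le_of_assoc_prime_mult_four (k : Type u) [Field k] [IsAlgClosed k] (N : ℕ) (n : ℕ)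
    (f : Fin n → MvPolynomial (Fin N) k)
    (hf : ∀ i, (f i).IsHomogeneous 2)
    (I : Ideal (MvPolynomial (Fin N) k))
    (hI : I = Ideal.span (Set.range f))
    (hht : I.heightENat = 3)
    (p : Ideal (MvPolynomial (Fin N) k))
    (hp : IsAssociatedPrime p (MvPolynomial (Fin N) k ⧸ I))
    (hpht : p.heightENat = 3)
    (hpe : hilbertSamuelMultiplicity k p = 4) :
    projDim (MvPolynomial (Fin N) k) (MvPolynomial (Fin N) k ⧸ I) ≤ (max n 8 : ℕ) := by
  refine projDim_le_of_PDLT _ _ _ ?_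
  by_cases hN8 : N ≤ 8
  · exact pdlt_mono (by have := le_max_right n 8; omega) (pdlt_mvPolynomial k N _)
  · obtain ⟨d, hd⟩ : ∃ d, 3 + (d + 1) = N := ⟨N - 4, by omega⟩
    have hpp : p.IsPrime := hp.isPrime
    have hIp : I ≤ p := by
      have := hp.annihilator_le
      rwa [Submodule.annihilator_top, Ideal.annihilator_quotient] at this
    have hle : ∀ Q : Ideal (MvPolynomial (Fin N) k), Q.IsPrime → I ≤ Q → 3 ≤ Q.height := by
      intro Q hQ hIQ
      rw [← hht, (⟨Q, hQ⟩ : PrimeSpectrum _).height_eq_orderHeight]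
      exact iInf₂_le (⟨Q, hQ⟩ : PrimeSpectrum _) hIQ
    have hp3 : p.height ≤ 3 := by
      rw [← hpht, Ideal.heightENat]
      refine le_iInf₂ fun q hq => ?_
      rw [← q.height_eq_orderHeight]
      exact Ideal.height_mono hq
    have hmin : p ∈ I.minimalPrimes := by
      refine ⟨⟨hpp, hIp⟩, ?_⟩
      rintro Q ⟨hQ, hIQ⟩ hQp
      by_contra hne
      have hlt : Q < p := lt_of_le_not_ge hQp hne
      have := Ideal.height_add_one_le_of_lt_of_isPrime hlt
      have h3 := hle Q hQ hIQ
      have h4 : (3 : ℕ∞) + 1 ≤ 3 := le_trans (add_le_add_left h3 1) (le_trans this hp3)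
      exact absurd h4 (by decide)
    subst hI
    exact main_aux hd f hf hle p hpp (homI_of_minimal _ (by rintro _ ⟨i, rfl⟩; exact ⟨2, hf i⟩) p hmin) hIp hp3 hpe
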